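/- Let 1/4 < s < 1/2, 0 ≤ ε < min(2s − 1/2, 1/2), 3/4 − ε/2 < θ ≤ s + 1/2 − ε, θ < 1 − ε. Let p̃, p, q satisfy 1 − 2s < 1/p̃ < 1/2, 2/p = 1 − 1/q, and max((1−2s)/3, s/2) < 1/q < 2s/3. There is a constant C such that for all Schwartz functions A_0, w on ℝ^{1+2}, ‖A_0·w‖_{H^{s,θ−1+ε}} ≤ C·( ‖A_0‖_{L^{p̃}_t L^∞_x} + ‖D_x^s A_0‖_{L^p_t L^q_x} )·‖w‖_{H^{s,θ}}. -/

import Mathlib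

noncomputable section

open MeasureTheory Real
open scoped ENNReal RealInnerProductSpace

/-- The spatial domain `ℝ²`. -/
abbrev V2 : Type := EuclideanSpace ℝ (Fin 2)

/-- Space-time Fourier transform on `ℝ^{1+2}`, convention `e^{-i(tτ + x·ξ)}`. -/
def ftST (u : ℝ × V2 → ℂ) (τ : ℝ) (ξ : V2) : ℂ :=
  ∫ p : ℝ × V2, Complex.exp (-Complex.I * ((p.1 * τ + ⟪p.2, ξ⟫ : ℝ) : ℂ)) * u p

/-- The weight `(1+|ξ|²)^{s/2} (1+||τ|-|ξ||)^θ`. -/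
def wgt (s θ τ : ℝ) (ξ : V2) : ℝ :=
  (1 + ‖ξ‖ ^ 2) ^ (s / 2) * (1 + |(|τ| - ‖ξ‖)|) ^ θ

/-- The Wave–Sobolev norm `H^{s,θ}` on `ℝ^{1+2}`. -/
def HN (s θ : ℝ) (u : ℝ × V2 → ℂ) : ℝ≥0∞ :=
  (∫⁻ q : ℝ × V2, (ENNReal.ofReal (wgt s θ q.1 q.2) * (‖ftST u q.1 q.2‖₊ : ℝ≥0∞)) ^ (2 : ℕ)) ^
    ((1 : ℝ) / 2)

/-- Time derivative `∂ₜ u`. -/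
def dtime (u : ℝ × V2 → ℂ) : ℝ × V2 → ℂ :=
  fun p => fderiv ℝ u p ((1 : ℝ), (0 : V2))

/-- The norm of `𝓗^{s,θ}`: `‖u‖_{H^{s,θ}} + ‖∂ₜu‖_{H^{s-1,θ}}`. -/
def HHN (s θ : ℝ) (u : ℝ × V2 → ℂ) : ℝ≥0∞ :=
  HN s θ u + HN (s - 1) θ (dtime u)

/-- Spatial partial derivative `∂ⱼ u`, `j = 0, 1`. -/
def pdx (j : Fin 2) (u : ℝ × V2 → ℂ) : ℝ × V2 → ℂ :=
  fun p => fderiv ℝ u p ((0 : ℝ), EuclideanSpace.single j 1)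

/-- Inverse space-time Fourier transform. -/
def iftST (F : ℝ → V2 → ℂ) (t : ℝ) (x : V2) : ℂ :=
  ((((2 * π) ^ 3)⁻¹ : ℝ) : ℂ) *
    ∫ q : ℝ × V2, Complex.exp (Complex.I * ((t * q.1 + ⟪x, q.2⟫ : ℝ) : ℂ)) * F q.1 q.2

/-- The space-time Fourier multiplier with symbol `m`. -/
def mult (m : ℝ → V2 → ℂ) (u : ℝ × V2 → ℂ) : ℝ × V2 → ℂ :=
  fun p => iftST (fun τ ξ => m τ ξ * ftST u τ ξ) p.1 p.2

/-- Spatial Fourier transform on `ℝ²`, convention `e^{-i x·ξ}`. -/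
def ft2 (g : V2 → ℂ) (ξ : V2) : ℂ :=
  ∫ x : V2, Complex.exp (-Complex.I * ((⟪x, ξ⟫ : ℝ) : ℂ)) * g x

/-- Inverse spatial Fourier transform on `ℝ²`. -/
def ift2 (G : V2 → ℂ) (x : V2) : ℂ :=
  ((((2 * π) ^ 2)⁻¹ : ℝ) : ℂ) *
    ∫ ξ : V2, Complex.exp (Complex.I * ((⟪x, ξ⟫ : ℝ) : ℂ)) * G ξ

/-- The spatial Fourier multiplier `D_x^a` with symbol `|ξ|^a`, acting on functions
on space-time for each fixed time. -/
def DxA (a : ℝ) (u : ℝ × V2 → ℂ) : ℝ × V2 → ℂ :=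
  fun p => ift2 (fun ξ => ((‖ξ‖ ^ a : ℝ) : ℂ) * ft2 (fun y => u (p.1, y)) ξ) p.2

/-- Mixed norm `L^p_t L^q_x` on `ℝ^{1+2}`, `p, q` finite. -/
def LpLq (p q : ℝ) (u : ℝ × V2 → ℂ) : ℝ≥0∞ :=
  (∫⁻ t : ℝ, (∫⁻ x : V2, (‖u (t, x)‖₊ : ℝ≥0∞) ^ q) ^ (p / q)) ^ p⁻¹

/-- Mixed norm `L^p_t L^∞_x` on `ℝ^{1+2}`, `p` finite. -/
def LpLinf (p : ℝ) (u : ℝ × V2 → ℂ) : ℝ≥0∞ :=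
  (∫⁻ t : ℝ, (essSup (fun x : V2 => (‖u (t, x)‖₊ : ℝ≥0∞)) volume) ^ p) ^ p⁻¹

section bessel
variable {W : Type*} [NormedAddCommGroup W] [InnerProductSpace ℝ W] [FiniteDimensional ℝ W]
  [MeasurableSpace W] [BorelSpace W]

lemma norm_cexp_I_mul (r : ℝ) : ‖Complex.exp (Complex.I * (r : ℂ))‖ = 1 := by
  rw [mul_comm]; exact Complex.norm_exp_ofReal_mul_I r

lemma continuous_ch0 (G : W → ℂ) (hG : Integrable G) :
    Continuous (fun x : W => ∫ ξ, Complex.exp (Complex.I * ((⟪x, ξ⟫ : ℝ) : ℂ)) * G ξ) := by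
  apply continuous_of_dominated (bound := fun ξ => ‖G ξ‖)
  · intro x
    exact (Continuous.aestronglyMeasurable (by fun_prop)).mul hG.1
  · intro x; filter_upwards with ξ
    rw [norm_mul, norm_cexp_I_mul, one_mul]
  · exact hG.norm
  · filter_upwards with ξ
    fun_prop

lemma gauss_int {b : ℝ} (hb : 0 < b) : Integrable (fun v : W => ((Real.exp (-b * ‖v‖ ^ 2) : ℝ) : ℂ)) := by
  have := GaussianFourier.integrable_cexp_neg_mul_sq_norm_add (V := W) (b := (b : ℂ)) (by simpa using hb) 0 0
  convert this using 2 with v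
  push_cast; simp

lemma gauss_lint {b : ℝ} (hb : 0 < b) :
    ∫⁻ v : W, ENNReal.ofReal (Real.exp (-b * ‖v‖ ^ 2)) =
      ENNReal.ofReal ((π / b) ^ ((Module.finrank ℝ W : ℝ) / 2)) := by
  rw [← GaussianFourier.integral_rexp_neg_mul_sq_norm hb, ofReal_integral_eq_lintegral_ofReal]
  · exact (gauss_int (W := W) hb).re
  · filter_upwards with v; positivity

lemma gauss_ft {b : ℝ} (hb : 0 < b) (w : W) :
    ∫ v : W, ((Real.exp (-b * ‖v‖ ^ 2) : ℝ) : ℂ) * Complex.exp (Complex.I * ((⟪w, v⟫ : ℝ) : ℂ)) =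
      (((π / b) ^ ((Module.finrank ℝ W : ℝ) / 2) * Real.exp (-‖w‖ ^ 2 / (4 * b)) : ℝ) : ℂ) := by
  have := GaussianFourier.integral_cexp_neg_mul_sq_norm_add (V := W) (b := (b : ℂ)) (by simpa using hb)
    Complex.I w
  push_cast
  rw [Complex.ofReal_cpow (by positivity)]
  push_cast
  convert this using 2
  · ext v; rw [← Complex.exp_add]
  · simp

lemma bessel_b (G : W → ℂ) (hG : Integrable G) {b : ℝ} (hb : 0 < b) :
    ∫⁻ x : W, ENNReal.ofReal (Real.exp (-b * ‖x‖ ^ 2)) *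
      ‖∫ ξ, Complex.exp (Complex.I * ((⟪x, ξ⟫ : ℝ) : ℂ)) * G ξ‖ₑ ^ 2 ≤
    ENNReal.ofReal ((4 * π ^ 2) ^ ((Module.finrank ℝ W : ℝ) / 2)) * ∫⁻ ξ, ‖G ξ‖ₑ ^ 2 := by
  set Gh : W → ℂ := fun x => ∫ ξ, Complex.exp (Complex.I * ((⟪x, ξ⟫ : ℝ) : ℂ)) * G ξ with hGh
  set Φ : W × (W × W) → ℂ := fun z => ((Real.exp (-b * ‖z.1‖ ^ 2) : ℝ) : ℂ) *
    (Complex.exp (Complex.I * ((⟪z.2.1 - z.2.2, z.1⟫ : ℝ) : ℂ)) *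
      (G z.2.1 * (starRingEnd ℂ) (G z.2.2))) with hΦ
  have hGc : Integrable (fun ξ => (starRingEnd ℂ) (G ξ)) := by
    exact (Complex.conjLIE.toContinuousLinearEquiv.integrable_comp_iff).2 hG
  have hΦi : Integrable Φ (volume.prod (volume.prod volume)) := by
    have h1 := (gauss_int (W := W) hb).mul_prod (hG.mul_prod hGc)
    refine h1.mono ?_ ?_
    · have h2 : AEStronglyMeasurable (fun z : W × (W × W) =>
        Complex.exp (Complex.I * ((⟪z.2.1 - z.2.2, z.1⟫ : ℝ) : ℂ))) (volume.prod (volume.prod volume)) :=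
        Continuous.aestronglyMeasurable (by fun_prop)
      refine (h2.mul h1.1).congr ?_
      filter_upwards with z
      simp only [hΦ, Pi.mul_apply]; ring
    · filter_upwards with z
      simp only [hΦ, norm_mul, norm_cexp_I_mul, one_mul]
      exact le_refl _
  have hH : ∀ x, ∫ y, Φ (x, y) = ((Real.exp (-b * ‖x‖ ^ 2) * ‖Gh x‖ ^ 2 : ℝ) : ℂ) := by
    intro x
    have e1 : ∀ y : W × W, Φ (x, y) = ((Real.exp (-b * ‖x‖ ^ 2) : ℝ) : ℂ) *
        ((Complex.exp (Complex.I * ((⟪x, y.1⟫ : ℝ) : ℂ)) * G y.1) *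
        ((starRingEnd ℂ) (Complex.exp (Complex.I * ((⟪x, y.2⟫ : ℝ) : ℂ)) * G y.2))) := by
      intro y
      simp only [hΦ, map_mul, ← Complex.exp_conj, Complex.conj_I, Complex.conj_ofReal]
      rw [inner_sub_left, real_inner_comm, real_inner_comm x y.2]
      push_cast
      rw [mul_sub, Complex.exp_sub, neg_mul, neg_mul, Complex.exp_neg (Complex.I * _)]
      ring
    simp_rw [e1]
    rw [integral_const_mul, Measure.volume_eq_prod,
      integral_prod_mul (f := fun y => (Complex.exp (Complex.I * ((⟪x, y⟫ : ℝ) : ℂ)) * G y))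
       (g := fun y => (starRingEnd ℂ) (Complex.exp (Complex.I * ((⟪x, y⟫ : ℝ) : ℂ)) * G y)),
      integral_conj, Complex.mul_conj, Complex.normSq_eq_norm_sq]
    push_cast; rfl
  have hint : Integrable (fun x => Real.exp (-b * ‖x‖ ^ 2) * ‖Gh x‖ ^ 2) := by
    have h := hΦi.integral_prod_left
    have h' : Integrable (fun x : W => ((Real.exp (-b * ‖x‖ ^ 2) * ‖Gh x‖ ^ 2 : ℝ) : ℂ)) := by
      refine h.congr ?_
      filter_upwards with x
      exact hH x
    exact h'.re
  have e2 : ∫⁻ x : W, ENNReal.ofReal (Real.exp (-b * ‖x‖ ^ 2)) * ‖Gh x‖ₑ ^ 2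
      = ENNReal.ofReal (∫ x, Real.exp (-b * ‖x‖ ^ 2) * ‖Gh x‖ ^ 2) := by
    rw [ofReal_integral_eq_lintegral_ofReal hint]
    · congr 1; ext x
      rw [ENNReal.ofReal_mul (by positivity), ENNReal.ofReal_pow (by positivity), ofReal_norm]
    · filter_upwards with x; positivity
  rw [e2]
  have e3 : ENNReal.ofReal (∫ x, Real.exp (-b * ‖x‖ ^ 2) * ‖Gh x‖ ^ 2) =
      ‖∫ y : W × W, ∫ x, Φ (x, y)‖ₑ := by
    have : ∫ y : W × W, ∫ x, Φ (x, y) = ∫ x, ∫ y, Φ (x, y) :=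
      (integral_integral_swap (f := fun x y => Φ (x,y)) hΦi).symm
    rw [this]
    simp_rw [hH]
    rw [integral_complex_ofReal, ← ofReal_norm, Complex.norm_real, Real.norm_of_nonneg]
    apply integral_nonneg; intro x; positivity
  rw [e3]
  set k : ℝ := (π / b) ^ ((Module.finrank ℝ W : ℝ) / 2) with hk
  have hk0 : 0 ≤ k := by positivity
  set K : W → ℝ≥0∞ := fun v => ENNReal.ofReal k * ENNReal.ofReal (Real.exp (-(1/(4*b)) * ‖v‖ ^ 2)) with hK
  have hKm : Measurable K := by fun_prop
  have hKi : ∫⁻ v, K v = ENNReal.ofReal ((4 * π ^ 2) ^ ((Module.finrank ℝ W : ℝ) / 2)) := by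
    rw [lintegral_const_mul _ (by fun_prop), gauss_lint (by positivity), ← ENNReal.ofReal_mul hk0, hk,
      ← Real.mul_rpow (by positivity) (by positivity)]
    congr 2; field_simp
  have e4 : ∀ y : W × W, ‖∫ x, Φ (x, y)‖ₑ = ‖G y.1‖ₑ * ‖G y.2‖ₑ * K (y.1 - y.2) := by
    intro y
    simp only [hΦ]
    simp_rw [← mul_assoc]
    rw [integral_mul_const, integral_mul_const, gauss_ft hb]
    simp only [enorm_mul, RCLike.enorm_conj]
    rw [← ofReal_norm (E := ℂ), Complex.norm_real, Real.norm_of_nonneg (by positivity), ENNReal.ofReal_mul hk0]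
    simp only [hK]
    rw [show -‖y.1 - y.2‖ ^ 2 / (4 * b) = -(1/(4*b)) * ‖y.1 - y.2‖ ^ 2 by ring]
    ring
  have hGm : AEMeasurable (fun x => ‖G x‖ₑ) := hG.1.enorm
  calc ‖∫ y : W × W, ∫ x, Φ (x, y)‖ₑ ≤ ∫⁻ y : W × W, ‖∫ x, Φ (x, y)‖ₑ := enorm_integral_le_lintegral_enorm _
    _ = ∫⁻ y : W × W, ‖G y.1‖ₑ * ‖G y.2‖ₑ * K (y.1 - y.2) := by simp_rw [e4]
    _ ≤ ∫⁻ y : W × W, 2⁻¹ * (‖G y.1‖ₑ ^ 2 * K (y.1 - y.2) + ‖G y.2‖ₑ ^ 2 * K (y.1 - y.2)) := by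
        apply lintegral_mono; intro y
        simp only
        rw [← add_mul, ← mul_assoc (2⁻¹ : ℝ≥0∞)]
        refine mul_le_mul' ?_ le_rfl
        have : 2 * (‖G y.1‖ₑ * ‖G y.2‖ₑ) ≤ ‖G y.1‖ₑ ^ 2 + ‖G y.2‖ₑ ^ 2 := by
          simp only [enorm_eq_nnnorm]
          norm_cast
          rw [← mul_assoc]
          exact two_mul_le_add_sq _ _
        calc ‖G y.1‖ₑ * ‖G y.2‖ₑ = 2⁻¹ * (2 * (‖G y.1‖ₑ * ‖G y.2‖ₑ)) := by
              rw [← mul_assoc, ENNReal.inv_mul_cancel (by simp) (by simp), one_mul]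
          _ ≤ _ := by gcongr
    _ = 2⁻¹ * ((∫⁻ y : W × W, ‖G y.1‖ₑ ^ 2 * K (y.1 - y.2)) + ∫⁻ y : W × W, ‖G y.2‖ₑ ^ 2 * K (y.1 - y.2)) := by
        rw [lintegral_const_mul' _ _ (by simp), lintegral_add_left']
        refine AEMeasurable.mul ?_ (hKm.comp (measurable_fst.sub measurable_snd)).aemeasurable
        exact ((hGm.pow_const 2).comp_quasiMeasurePreserving (Measure.quasiMeasurePreserving_fst))
    _ = 2⁻¹ * ((∫⁻ v, K v) * (∫⁻ ξ, ‖G ξ‖ₑ ^ 2) + (∫⁻ v, K v) * (∫⁻ ξ, ‖G ξ‖ₑ ^ 2)) := by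
        have hsw : ∫⁻ y : W × W, ‖G y.2‖ₑ ^ 2 * K (y.1 - y.2) = ∫⁻ y : W × W, ‖G y.1‖ₑ ^ 2 * K (y.1 - y.2) := by
          rw [Measure.volume_eq_prod, ← (Measure.measurePreserving_swap (μ := (volume : Measure W)) (ν := (volume : Measure W))).lintegral_comp_emb
            MeasurableEquiv.prodComm.measurableEmbedding]
          congr 1; ext y
          simp only [Prod.snd_swap, Prod.fst_swap, hK]
          rw [norm_sub_rev]
        have h1 : ∫⁻ y : W × W, ‖G y.1‖ₑ ^ 2 * K (y.1 - y.2) = (∫⁻ v, K v) * (∫⁻ ξ, ‖G ξ‖ₑ ^ 2) := by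
          rw [Measure.volume_eq_prod, lintegral_prod]
          · rw [← lintegral_const_mul'' _ (hGm.pow_const 2)]
            congr 1; ext x
            simp only
            rw [lintegral_const_mul _ (by fun_prop), lintegral_sub_left_eq_self K x, mul_comm]
          · refine AEMeasurable.mul ?_ (hKm.comp (measurable_fst.sub measurable_snd)).aemeasurable
            exact ((hGm.pow_const 2).comp_quasiMeasurePreserving (Measure.quasiMeasurePreserving_fst))
        rw [hsw, h1]
    _ = _ := by
        rw [← two_mul, ← mul_assoc, ENNReal.inv_mul_cancel (by simp) (by simp), one_mul, hKi]

theorem bessel (G : W → ℂ) (hG : Integrable G) :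
    ∫⁻ x : W, ‖∫ ξ, Complex.exp (Complex.I * ((⟪x, ξ⟫ : ℝ) : ℂ)) * G ξ‖ₑ ^ 2 ≤
    ENNReal.ofReal ((4 * π ^ 2) ^ ((Module.finrank ℝ W : ℝ) / 2)) * ∫⁻ ξ, ‖G ξ‖ₑ ^ 2 := by
  have hc := continuous_ch0 G hG
  set Gh : W → ℂ := fun x => ∫ ξ, Complex.exp (Complex.I * ((⟪x, ξ⟫ : ℝ) : ℂ)) * G ξ with hGh
  have hm : ∀ n : ℕ, Measurable (fun x : W => ENNReal.ofReal (Real.exp (-(1/((n:ℝ)+1)) * ‖x‖ ^ 2)) * ‖Gh x‖ₑ ^ 2) := by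
    intro n
    have := hc.measurable
    fun_prop
  have hlim : ∀ x : W, Filter.liminf (fun n : ℕ => ENNReal.ofReal (Real.exp (-(1/((n:ℝ)+1)) * ‖x‖ ^ 2)) * ‖Gh x‖ₑ ^ 2) Filter.atTop = ‖Gh x‖ₑ ^ 2 := by
    intro x
    apply Filter.Tendsto.liminf_eq
    have h1 : Filter.Tendsto (fun n : ℕ => Real.exp (-(1/((n:ℝ)+1)) * ‖x‖ ^ 2)) Filter.atTop (nhds (Real.exp (-0 * ‖x‖^2))) :=
      (Real.continuous_exp.tendsto _).comp ((tendsto_one_div_add_atTop_nhds_zero_nat.neg).mul_const _)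
    have h2 := ENNReal.Tendsto.mul_const (b := ‖Gh x‖ₑ ^ 2) (ENNReal.tendsto_ofReal h1) (Or.inr (by simp))
    simpa using h2
  calc ∫⁻ x : W, ‖Gh x‖ₑ ^ 2 = ∫⁻ x : W, Filter.liminf (fun n : ℕ => ENNReal.ofReal (Real.exp (-(1/((n:ℝ)+1)) * ‖x‖ ^ 2)) * ‖Gh x‖ₑ ^ 2) Filter.atTop := by
        simp_rw [hlim]
    _ ≤ Filter.liminf (fun n : ℕ => ∫⁻ x : W, ENNReal.ofReal (Real.exp (-(1/((n:ℝ)+1)) * ‖x‖ ^ 2)) * ‖Gh x‖ₑ ^ 2) Filter.atTop := lintegral_liminf_le hm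
    _ ≤ Filter.liminf (fun n : ℕ => ENNReal.ofReal ((4 * π ^ 2) ^ ((Module.finrank ℝ W : ℝ) / 2)) * ∫⁻ ξ, ‖G ξ‖ₑ ^ 2) Filter.atTop := by
        refine Filter.liminf_le_liminf (Filter.Eventually.of_forall fun n => ?_)
        exact bessel_b G hG (by positivity)
    _ = _ := by simp
end bessel

def ch (G : ℝ × V2 → ℂ) (p : ℝ × V2) : ℂ :=
  ∫ q : ℝ × V2, Complex.exp (Complex.I * ((p.1 * q.1 + ⟪p.2, q.2⟫ : ℝ) : ℂ)) * G q

def cB2 : ℝ := (4 * π ^ 2) ^ ((Module.finrank ℝ V2 : ℝ) / 2)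
def cB3 : ℝ := (4 * π ^ 2) ^ ((Module.finrank ℝ (WithLp 2 (ℝ × V2)) : ℝ) / 2)

lemma continuous_ch (G : ℝ × V2 → ℂ) (hG : Integrable G) : Continuous (ch G) := by
  apply continuous_of_dominated (bound := fun ξ => ‖G ξ‖)
  · intro x
    exact (Continuous.aestronglyMeasurable (by fun_prop)).mul hG.1
  · intro x; filter_upwards with ξ
    rw [norm_mul, norm_cexp_I_mul, one_mul]
  · exact hG.norm
  · filter_upwards with ξ
    fun_prop

theorem bessel3 (G : ℝ × V2 → ℂ) (hG : Integrable G) :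
    ∫⁻ p, ‖ch G p‖ₑ ^ 2 ≤ ENNReal.ofReal cB3 * ∫⁻ q, ‖G q‖ₑ ^ 2 := by
  have mp := WithLp.volume_preserving_ofLp ℝ V2
  have emb : MeasurableEmbedding (WithLp.ofLp : WithLp 2 (ℝ × V2) → ℝ × V2) :=
    (MeasurableEquiv.toLp 2 (ℝ × V2)).symm.measurableEmbedding
  have h := bessel (W := WithLp 2 (ℝ × V2)) (fun z => G z.ofLp) ((mp.integrable_comp_emb emb).2 hG)
  rw [← mp.lintegral_comp_emb emb, ← mp.lintegral_comp_emb emb]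
  refine le_trans (le_of_eq ?_) h
  congr 1; ext z
  unfold ch
  rw [← mp.integral_comp emb]
  congr 3; ext y
  rw [WithLp.prod_inner_apply]
  simp [mul_comm]

lemma cs_lint {α : Type*} [MeasurableSpace α] {μ : Measure α} {f g : α → ℝ≥0∞}
    (hf : AEMeasurable f μ) (hg : AEMeasurable g μ) :
    (∫⁻ a, f a * g a ∂μ) ^ 2 ≤ (∫⁻ a, f a ^ 2 ∂μ) * (∫⁻ a, g a ^ 2 ∂μ) := by
  have h := ENNReal.lintegral_mul_le_Lp_mul_Lq μ (p := 2) (q := 2) ⟨by norm_num, by norm_num, by norm_num⟩ hf hg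
  calc (∫⁻ a, f a * g a ∂μ) ^ 2 ≤ ((∫⁻ a, f a ^ (2:ℝ) ∂μ) ^ (1/(2:ℝ)) * (∫⁻ a, g a ^ (2:ℝ) ∂μ) ^ (1/(2:ℝ))) ^ 2 := by
        gcongr; exact h
    _ = _ := by
        rw [mul_pow, ← ENNReal.rpow_natCast, ← ENNReal.rpow_natCast, ← ENNReal.rpow_mul, ← ENNReal.rpow_mul]
        norm_num

def Jw (θ : ℝ) (q : ℝ × V2) : ℝ := (1 + |(|q.1| - ‖q.2‖)|) ^ θ

def Xn (θ : ℝ) (G : ℝ × V2 → ℂ) : ℝ≥0∞ := ∫⁻ q, (ENNReal.ofReal (Jw θ q) * ‖G q‖ₑ) ^ 2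

def kth (θ : ℝ) : ℝ≥0∞ := ∫⁻ r : ℝ, ENNReal.ofReal ((1 + |r|) ^ (-(2*θ)))

lemma Jw_pos (θ : ℝ) (q : ℝ × V2) : 0 < Jw θ q := by unfold Jw; positivity

lemma one_le_Jw {θ : ℝ} (h : 0 ≤ θ) (q : ℝ × V2) : 1 ≤ Jw θ q := by
  unfold Jw; apply Real.one_le_rpow _ h
  have := abs_nonneg (|q.1| - ‖q.2‖); linarith

lemma measurable_Jw (θ : ℝ) : Measurable (Jw θ) := by unfold Jw; fun_prop

lemma kth_lt_top {θ : ℝ} (hθ : 1/2 < θ) : kth θ < ⊤ := by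
  have h : Integrable (fun r : ℝ => (1 + ‖r‖) ^ (-(2*θ))) := by
    apply integrable_one_add_norm
    simp; linarith
  unfold kth
  have := h.lintegral_lt_top
  simpa using this

lemma lint_sq_le_Xn {θ : ℝ} (hθ : 0 ≤ θ) (G : ℝ × V2 → ℂ) : ∫⁻ q, ‖G q‖ₑ ^ 2 ≤ Xn θ G := by
  apply lintegral_mono; intro q
  simp only
  gcongr
  refine le_mul_of_one_le_left (by simp) ?_
  rw [ENNReal.one_le_ofReal]; exact one_le_Jw hθ q

lemma kJ (θ : ℝ) (hθ : 0 < θ) (ξ : V2) : ∫⁻ τ : ℝ, ENNReal.ofReal (Jw (-θ) (τ, ξ)) ^ 2 ≤ 2 * kth θ := by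
  have h : ∀ τ : ℝ, ENNReal.ofReal (Jw (-θ) (τ, ξ)) ^ 2 ≤
      ENNReal.ofReal ((1 + |τ - ‖ξ‖|) ^ (-(2*θ))) + ENNReal.ofReal ((1 + |τ + ‖ξ‖|) ^ (-(2*θ))) := by
    intro τ
    have e : ENNReal.ofReal (Jw (-θ) (τ, ξ)) ^ 2 = ENNReal.ofReal ((1 + |(|τ| - ‖ξ‖)|) ^ (-(2*θ))) := by
      rw [← ENNReal.ofReal_pow (Jw_pos _ _).le]
      unfold Jw
      rw [← Real.rpow_natCast, ← Real.rpow_mul (by positivity)]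
      congr 2; push_cast; ring
    rw [e]
    rcases le_total 0 τ with h0 | h0
    · rw [abs_of_nonneg h0]; exact le_self_add
    · rw [abs_of_nonpos h0, show -τ - ‖ξ‖ = -(τ + ‖ξ‖) by ring, abs_neg]; exact le_add_self
  calc _ ≤ ∫⁻ τ : ℝ, (ENNReal.ofReal ((1 + |τ - ‖ξ‖|) ^ (-(2*θ))) + ENNReal.ofReal ((1 + |τ + ‖ξ‖|) ^ (-(2*θ)))) :=
        lintegral_mono h
    _ = kth θ + kth θ := by
        rw [lintegral_add_left (by fun_prop)]
        congr 1
        · exact lintegral_sub_right_eq_self (fun r : ℝ => ENNReal.ofReal ((1 + |r|) ^ (-(2*θ)))) ‖ξ‖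
        · exact lintegral_add_right_eq_self (fun r : ℝ => ENNReal.ofReal ((1 + |r|) ^ (-(2*θ)))) ‖ξ‖
    _ = _ := by rw [two_mul]

theorem energy {θ : ℝ} (hθ : 1/2 < θ) (G : ℝ × V2 → ℂ) (hG : Integrable G) (t : ℝ) :
    ∫⁻ x : V2, ‖ch G (t, x)‖ₑ ^ 2 ≤ ENNReal.ofReal cB2 * (2 * kth θ) * Xn θ G := by
  have hG' : Integrable G (volume.prod volume) := hG
  have hE : Integrable (fun q : ℝ × V2 => Complex.exp (Complex.I * ((t * q.1 : ℝ) : ℂ)) * G q) (volume.prod volume) := by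
    refine hG'.mono ((Continuous.aestronglyMeasurable (by fun_prop)).mul hG.1) ?_
    filter_upwards with q
    rw [norm_mul, norm_cexp_I_mul, one_mul]
  have e1 : ∀ x : V2, ch G (t, x) = ∫ ξ : V2, Complex.exp (Complex.I * ((⟪x, ξ⟫ : ℝ) : ℂ)) *
      ∫ τ : ℝ, Complex.exp (Complex.I * ((t * τ : ℝ) : ℂ)) * G (τ, ξ) := by
    intro x
    unfold ch
    rw [Measure.volume_eq_prod, integral_prod_symm]
    · congr 1; ext ξ
      rw [← integral_const_mul]
      congr 1; ext τ
      simp only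
      rw [← mul_assoc, ← Complex.exp_add]
      congr 2; push_cast; ring
    · refine hG'.mono ((Continuous.aestronglyMeasurable (by fun_prop)).mul hG.1) ?_
      filter_upwards with q
      rw [norm_mul, norm_cexp_I_mul, one_mul]
  simp_rw [e1]
  refine (bessel _ hE.integral_prod_right).trans ?_
  rw [mul_assoc]
  refine mul_le_mul' le_rfl ?_
  have hm : AEMeasurable (fun q : ℝ × V2 => (ENNReal.ofReal (Jw θ q) * ‖G q‖ₑ) ^ 2) (volume.prod volume) :=
    (((measurable_Jw θ).ennreal_ofReal.aemeasurable).mul hG'.1.enorm).pow_const 2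
  unfold Xn
  rw [Measure.volume_eq_prod, lintegral_prod_symm _ hm]
  rw [← lintegral_const_mul' _ _ (ENNReal.mul_ne_top (by simp) (kth_lt_top hθ).ne)]
  apply lintegral_mono_ae
  have hsl := hG'.prod_left_ae
  filter_upwards [hsl] with ξ hξ
  calc ‖∫ τ : ℝ, Complex.exp (Complex.I * ((t * τ : ℝ) : ℂ)) * G (τ, ξ)‖ₑ ^ 2
      ≤ (∫⁻ τ : ℝ, ENNReal.ofReal (Jw (-θ) (τ, ξ)) * (ENNReal.ofReal (Jw θ (τ, ξ)) * ‖G (τ, ξ)‖ₑ)) ^ 2 := by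
        gcongr
        refine (enorm_integral_le_lintegral_enorm _).trans (le_of_eq ?_)
        congr 1; ext τ
        rw [enorm_mul, ← ofReal_norm, norm_cexp_I_mul, ← mul_assoc, ← ENNReal.ofReal_mul (Jw_pos _ _).le]
        congr 2
        unfold Jw
        rw [← Real.rpow_add (by positivity)]; simp
    _ ≤ _ := by
        refine (cs_lint ?_ ?_).trans ?_
        · have := measurable_Jw (-θ); fun_prop
        · have := measurable_Jw θ
          refine AEMeasurable.mul (by fun_prop) hξ.1.enorm
        · exact mul_le_mul' (kJ θ (by linarith) ξ) le_rfl

def cT (θ : ℝ) : ℝ≥0∞ := ENNReal.ofReal cB2 * (2 * kth θ) + ENNReal.ofReal cB3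

lemma cT_lt_top {θ : ℝ} (hθ : 1/2 < θ) : cT θ < ⊤ := by
  unfold cT
  have := kth_lt_top hθ
  exact ENNReal.add_lt_top.2 ⟨ENNReal.mul_lt_top (by simp) (ENNReal.mul_lt_top (by simp) this), by simp⟩

theorem T1 {θ pt : ℝ} (hθ : 1/2 < θ) (hpt : 2 < pt) (f : ℝ × V2 → ℂ) (M : ℝ → ℝ≥0∞) (hM : Measurable M)
    (hf : ∀ p, ‖f p‖ₑ ≤ M p.1) (G : ℝ × V2 → ℂ) (hG : Integrable G) :
    ∫⁻ p, (‖f p‖ₑ * ‖ch G p‖ₑ) ^ 2 ≤ (∫⁻ t, M t ^ pt) ^ (2 / pt) * (cT θ * Xn θ G) := by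
  have hc := (continuous_ch G hG).measurable
  set n : ℝ → ℝ≥0∞ := fun t => ∫⁻ x : V2, ‖ch G (t, x)‖ₑ ^ 2 with hn
  have hnm : Measurable n := by
    apply Measurable.lintegral_prod_right' (f := fun p : ℝ × V2 => ‖ch G p‖ₑ ^ 2)
    fun_prop
  have hn1 : ∀ t, n t ≤ cT θ * Xn θ G := fun t => (energy hθ G hG t).trans
    (mul_le_mul' le_self_add le_rfl)
  have hn2 : ∫⁻ t, n t ≤ cT θ * Xn θ G := by
    have : ∫⁻ t, n t = ∫⁻ p, ‖ch G p‖ₑ ^ 2 := by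
      rw [Measure.volume_eq_prod, lintegral_prod]
      fun_prop
    rw [this]
    exact (bessel3 G hG).trans (mul_le_mul' le_add_self (lint_sq_le_Xn (by linarith) G))
  have ha : 0 ≤ 2 / pt := by positivity
  have ha1 : 2 / pt ≤ 1 := by rw [div_le_one (by linarith)]; linarith
  set Y := cT θ * Xn θ G with hY
  calc ∫⁻ p, (‖f p‖ₑ * ‖ch G p‖ₑ) ^ 2 ≤ ∫⁻ p : ℝ × V2, M p.1 ^ 2 * ‖ch G p‖ₑ ^ 2 := by
        apply lintegral_mono; intro p; simp only; rw [mul_pow]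
        gcongr; exact hf p
    _ = ∫⁻ t, M t ^ 2 * n t := by
        rw [Measure.volume_eq_prod, lintegral_prod]
        · congr 1; ext t
          simp only
          rw [lintegral_const_mul]
          fun_prop
        · fun_prop
    _ ≤ ∫⁻ t, ((M t ^ pt) ^ (2 / pt) * n t ^ (1 - 2 / pt)) * Y ^ (2 / pt) := by
        apply lintegral_mono; intro t
        simp only
        rw [← ENNReal.rpow_mul, mul_div_cancel₀ _ (by linarith)]
        have : n t = n t ^ (1 - 2 / pt) * n t ^ (2 / pt) := by
          rw [← ENNReal.rpow_add_of_nonneg _ _ (by linarith) ha]; simp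
        rw [mul_assoc]
        refine mul_le_mul' (by simp) ?_
        conv_lhs => rw [this]
        gcongr
        exact hn1 t
    _ = (∫⁻ t, (M t ^ pt) ^ (2 / pt) * n t ^ (1 - 2 / pt)) * Y ^ (2 / pt) := by
        rw [lintegral_mul_const]; fun_prop
    _ ≤ ((∫⁻ t, M t ^ pt) ^ (2 / pt) * Y ^ (1 - 2 / pt)) * Y ^ (2 / pt) := by
        refine mul_le_mul' ?_ le_rfl
        refine (ENNReal.lintegral_mul_norm_pow_le (f := fun t => M t ^ pt) (g := n) (by fun_prop) hnm.aemeasurable ha (by linarith) (by ring)).trans ?_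
        gcongr
        
    _ = _ := by
        rw [mul_assoc, ← ENNReal.rpow_add_of_nonneg _ _ (by linarith) ha]; simp

lemma exists_rot (ξ : V2) : ∃ R : V2 ≃ₗᵢ[ℝ] V2, R ξ = ‖ξ‖ • EuclideanSpace.single (0 : Fin 2) (1:ℝ) := by
  refine ⟨(ℝ ∙ (ξ - ‖ξ‖ • EuclideanSpace.single (0 : Fin 2) (1:ℝ)))ᗮ.reflection, ?_⟩
  apply Submodule.reflection_sub
  rw [norm_smul]; simp

lemma ellipse_aux (m σ : ℝ) (x : V2)
    (h : ‖x‖ + ‖m • EuclideanSpace.single (0 : Fin 2) (1:ℝ) - x‖ ≤ σ) :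
    |x 0| ≤ σ ∧ m ^ 2 + 4 * x 1 ^ 2 ≤ σ ^ 2 := by
  have h0 : |x 0| ≤ ‖x‖ := by
    have := EuclideanSpace.norm_eq x
    have h2 : ‖x‖ ^ 2 = x 0 ^ 2 + x 1 ^ 2 := by rw [EuclideanSpace.norm_sq_eq]; simp
    exact abs_le_of_sq_le_sq (by nlinarith [sq_nonneg (x 1)]) (norm_nonneg _)
  constructor
  · exact h0.trans (le_trans (le_add_of_nonneg_right (norm_nonneg _)) h)
  · set z : V2 := !₂[m - x 0, x 1] with hz
    have hzn : ‖m • EuclideanSpace.single (0 : Fin 2) (1:ℝ) - x‖ = ‖z‖ := by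
      rw [EuclideanSpace.norm_eq, EuclideanSpace.norm_eq]
      simp [hz]
    have h2 : ‖x + z‖ ^ 2 = m ^ 2 + 4 * x 1 ^ 2 := by
      rw [EuclideanSpace.norm_sq_eq]; simp [hz]; ring
    rw [hzn] at h
    rw [← h2]
    exact pow_le_pow_left₀ (norm_nonneg _) ((norm_add_le _ _).trans h) 2

lemma vol_rect (a b : ℝ) : volume {x : V2 | |x 0| ≤ a ∧ |x 1| ≤ b} ≤ ENNReal.ofReal (2 * a) * ENNReal.ofReal (2 * b) := by
  have mp := EuclideanSpace.volume_preserving_symm_measurableEquiv_toLp (Fin 2)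
  have h : {x : V2 | |x 0| ≤ a ∧ |x 1| ≤ b} = (MeasurableEquiv.toLp 2 (Fin 2 → ℝ)).symm ⁻¹' (Set.Icc ![-a, -b] ![a, b]) := by
    ext x
    simp only [Set.mem_ofPred_eq, Set.mem_preimage, Set.mem_Icc, Pi.le_def, Fin.forall_fin_two]
    simp [abs_le]
    tauto
  rw [h, mp.measure_preimage_equiv, Real.volume_Icc_pi]
  simp [Fin.prod_univ_two, two_mul]

lemma vol_ellipse (ξ : V2) (σ : ℝ) (hσ : ‖ξ‖ ≤ σ) :
    volume {x : V2 | ‖x‖ + ‖ξ - x‖ ≤ σ} ≤ ENNReal.ofReal (2 * σ * √(σ ^ 2 - ‖ξ‖ ^ 2)) := by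
  obtain ⟨R, hR⟩ := exists_rot ξ
  have hσ0 : 0 ≤ σ := (norm_nonneg _).trans hσ
  have hsub : {x : V2 | ‖x‖ + ‖ξ - x‖ ≤ σ} ⊆ R ⁻¹' {x : V2 | |x 0| ≤ σ ∧ |x 1| ≤ √(σ ^ 2 - ‖ξ‖ ^ 2) / 2} := by
    intro x hx
    have hx' : ‖R x‖ + ‖‖ξ‖ • EuclideanSpace.single (0 : Fin 2) (1:ℝ) - R x‖ ≤ σ := by
      rw [← hR, ← map_sub, R.norm_map, R.norm_map]; exact hx
    obtain ⟨h1, h2⟩ := ellipse_aux _ _ _ hx'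
    refine ⟨h1, ?_⟩
    rw [le_div_iff₀ (by norm_num)]
    apply Real.le_sqrt_of_sq_le
    rw [mul_pow, sq_abs]; linarith
  refine (measure_mono hsub).trans ?_
  rw [R.measurePreserving.measure_preimage_emb R.toHomeomorph.measurableEmbedding]
  refine (vol_rect _ _).trans (le_of_eq ?_)
  rw [← ENNReal.ofReal_mul (by positivity)]
  congr 1; ring

def phi3 (ξ : V2) (y : V2 × V2) : ℝ := ‖y.1‖ + ‖y.2‖ + ‖ξ - y.1 - y.2‖

lemma phi3_ge (ξ : V2) (y : V2 × V2) : ‖ξ‖ ≤ phi3 ξ y := by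
  unfold phi3
  calc ‖ξ‖ = ‖y.1 + y.2 + (ξ - y.1 - y.2)‖ := by congr 1; abel
    _ ≤ _ := norm_add₃_le

lemma vol_S (ξ : V2) (σ : ℝ) (hσ : 0 ≤ σ) :
    volume {y : V2 × V2 | phi3 ξ y ≤ σ} ≤ ENNReal.ofReal (8 * σ ^ 3 * (σ - ‖ξ‖)) := by
  by_cases h : ‖ξ‖ ≤ σ
  · have hsub : {y : V2 × V2 | phi3 ξ y ≤ σ} ⊆ {x : V2 | ‖x‖ + ‖ξ - x‖ ≤ σ} ×ˢ {x : V2 | ‖x‖ + ‖ξ - x‖ ≤ σ} := by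
      intro y hy
      simp only [Set.mem_ofPred_eq, phi3] at hy
      constructor
      · simp only [Set.mem_ofPred_eq]
        have : ‖ξ - y.1‖ ≤ ‖y.2‖ + ‖ξ - y.1 - y.2‖ := by
          calc ‖ξ - y.1‖ = ‖y.2 + (ξ - y.1 - y.2)‖ := by congr 1; abel
            _ ≤ _ := norm_add_le _ _
        linarith
      · simp only [Set.mem_ofPred_eq]
        have : ‖ξ - y.2‖ ≤ ‖y.1‖ + ‖ξ - y.1 - y.2‖ := by
          calc ‖ξ - y.2‖ = ‖y.1 + (ξ - y.1 - y.2)‖ := by congr 1; abel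
            _ ≤ _ := norm_add_le _ _
        linarith
    refine (measure_mono hsub).trans ?_
    rw [Measure.volume_eq_prod, Measure.prod_prod]
    refine (mul_le_mul' (vol_ellipse ξ σ h) (vol_ellipse ξ σ h)).trans ?_
    rw [← ENNReal.ofReal_mul (by positivity)]
    apply ENNReal.ofReal_le_ofReal
    have h1 : 0 ≤ σ ^ 2 - ‖ξ‖ ^ 2 := by nlinarith [norm_nonneg ξ]
    have h2 := Real.mul_self_sqrt h1
    calc 2 * σ * √(σ ^ 2 - ‖ξ‖ ^ 2) * (2 * σ * √(σ ^ 2 - ‖ξ‖ ^ 2)) = 4 * σ ^ 2 * ((σ - ‖ξ‖) * (σ + ‖ξ‖)) := by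
          rw [show 2 * σ * √(σ ^ 2 - ‖ξ‖ ^ 2) * (2 * σ * √(σ ^ 2 - ‖ξ‖ ^ 2)) = 4 * σ ^ 2 * (√(σ ^ 2 - ‖ξ‖ ^ 2) * √(σ ^ 2 - ‖ξ‖ ^ 2)) by ring, h2]; ring
      _ ≤ 4 * σ ^ 2 * ((σ - ‖ξ‖) * (2 * σ)) := by
          gcongr
          · linarith
      _ = _ := by ring
  · have : {y : V2 × V2 | phi3 ξ y ≤ σ} = ∅ := by
      ext y
      simp only [Set.mem_ofPred_eq, Set.mem_empty_iff_false, iff_false, not_le]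
      have := phi3_ge ξ y
      linarith
    rw [this]; simp

open scoped Pointwise in
lemma vol_shell (ξ : V2) (σ : ℝ) (hσ : 0 ≤ σ + 1) :
    volume {y : V2 × V2 | σ < phi3 ξ y ∧ phi3 ξ y ≤ σ + 1} ≤ ENNReal.ofReal (32 * (σ + 1) ^ 3) := by
  have hV' := vol_S ξ (σ + 1) hσ
  by_cases h : ‖ξ‖ ≤ σ
  · set t : ℝ := (σ - ‖ξ‖) / (σ + 1 - ‖ξ‖) with ht
    have hd : 0 < σ + 1 - ‖ξ‖ := by linarith
    have ht0 : 0 ≤ t := div_nonneg (by linarith) hd.le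
    have ht1 : t ≤ 1 := by rw [ht, div_le_one hd]; linarith
    have htm : t * (σ + 1 - ‖ξ‖) = σ - ‖ξ‖ := by rw [ht]; field_simp
    have hsub : t • {y : V2 × V2 | phi3 ξ y ≤ σ + 1} ⊆ {y : V2 × V2 | phi3 ξ y ≤ σ} := by
      rintro _ ⟨y, hy, rfl⟩
      simp only [Set.mem_ofPred_eq, phi3] at hy ⊢
      have h1 : ‖ξ - t • y.1 - t • y.2‖ ≤ (1 - t) * ‖ξ‖ + t * ‖ξ - y.1 - y.2‖ := by
        calc ‖ξ - t • y.1 - t • y.2‖ = ‖(1 - t) • ξ + t • (ξ - y.1 - y.2)‖ := by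
              congr 1; module
          _ ≤ _ := by
              refine (norm_add_le _ _).trans ?_
              rw [norm_smul, norm_smul, Real.norm_of_nonneg ht0, Real.norm_of_nonneg (by linarith)]
      simp only [Prod.smul_fst, Prod.smul_snd, norm_smul, Real.norm_of_nonneg ht0]
      nlinarith
    have hge : ENNReal.ofReal (t ^ 4) * volume {y : V2 × V2 | phi3 ξ y ≤ σ + 1} ≤ volume {y : V2 × V2 | phi3 ξ y ≤ σ} := by
      haveI : (volume : Measure (V2 × V2)).IsAddHaarMeasure := Measure.prod.instIsAddHaarMeasure volume volume
      have := measure_mono (μ := volume) hsub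
      rw [Measure.addHaar_smul, abs_of_nonneg (by positivity)] at this
      simpa using this
    have hmeas : MeasurableSet {y : V2 × V2 | phi3 ξ y ≤ σ} := by
      apply measurableSet_le _ measurable_const
      unfold phi3; fun_prop
    have hfin : volume {y : V2 × V2 | phi3 ξ y ≤ σ} ≠ ⊤ := by
      by_cases h0 : 0 ≤ σ
      · exact ((vol_S ξ σ h0).trans_lt (by simp)).ne
      · linarith [norm_nonneg ξ]
    have hset : {y : V2 × V2 | σ < phi3 ξ y ∧ phi3 ξ y ≤ σ + 1} = {y : V2 × V2 | phi3 ξ y ≤ σ + 1} \ {y : V2 × V2 | phi3 ξ y ≤ σ} := by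
      ext y; simp; tauto
    rw [hset, measure_sdiff (fun y hy => by simp only [Set.mem_ofPred_eq] at hy ⊢; linarith) hmeas.nullMeasurableSet hfin]
    set V := volume {y : V2 × V2 | phi3 ξ y ≤ σ + 1} with hV
    have hVf : V ≠ ⊤ := (hV'.trans_lt (by simp)).ne
    calc V - volume {y : V2 × V2 | phi3 ξ y ≤ σ} ≤ V - ENNReal.ofReal (t ^ 4) * V := tsub_le_tsub_left hge _
      _ = ENNReal.ofReal (1 - t ^ 4) * V := by
          rw [ENNReal.ofReal_sub _ (by positivity), ENNReal.sub_mul (fun _ _ => hVf)]; simp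
      _ ≤ ENNReal.ofReal (4 * (1 - t)) * ENNReal.ofReal (8 * (σ + 1) ^ 3 * (σ + 1 - ‖ξ‖)) := by
          gcongr
          nlinarith [sq_nonneg (1 - t), sq_nonneg (t^2 - 1), mul_nonneg (sq_nonneg (1-t)) (sq_nonneg (t+1))]
      _ = _ := by
          rw [← ENNReal.ofReal_mul (by linarith)]
          congr 1
          rw [show 4 * (1 - t) * (8 * (σ + 1) ^ 3 * (σ + 1 - ‖ξ‖)) = 32 * (σ + 1) ^ 3 * ((σ + 1 - ‖ξ‖) - t * (σ + 1 - ‖ξ‖)) by ring, htm]; ring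
  · refine (measure_mono (fun y hy => hy.2)).trans (hV'.trans ?_)
    apply ENNReal.ofReal_le_ofReal
    have h3 : 0 ≤ (σ + 1) ^ 3 := by positivity
    nlinarith

lemma vol_box (ξ : V2) (σ N : ℝ) (hN : 1 ≤ N) :
    volume {y : V2 × V2 | (‖y.1‖ ≤ N ∧ ‖y.2‖ ≤ N ∧ ‖ξ - y.1 - y.2‖ ≤ N) ∧ (σ < phi3 ξ y ∧ phi3 ξ y ≤ σ + 1)} ≤
      ENNReal.ofReal (2048 * N ^ 3) := by
  rcases Set.eq_empty_or_nonempty {y : V2 × V2 | (‖y.1‖ ≤ N ∧ ‖y.2‖ ≤ N ∧ ‖ξ - y.1 - y.2‖ ≤ N) ∧ (σ < phi3 ξ y ∧ phi3 ξ y ≤ σ + 1)} with h | ⟨y, hy⟩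
  · rw [h]; simp
  · have h0 : 0 ≤ phi3 ξ y := by unfold phi3; positivity
    have h1 : phi3 ξ y ≤ 3 * N := by unfold phi3; linarith [hy.1.1, hy.1.2.1, hy.1.2.2]
    refine (measure_mono (fun y hy => hy.2)).trans ((vol_shell ξ σ (by linarith [hy.2.2])).trans ?_)
    apply ENNReal.ofReal_le_ofReal
    have : σ + 1 ≤ 4 * N := by linarith [hy.2.1]
    calc 32 * (σ + 1) ^ 3 ≤ 32 * (4 * N) ^ 3 := by
          gcongr; linarith [hy.2.2]
      _ = _ := by ring

instance instHaarP : (volume : Measure (ℝ × V2)).IsAddHaarMeasure := Measure.prod.instIsAddHaarMeasure volume volume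

def kk (θ r : ℝ) : ℝ≥0∞ := ENNReal.ofReal ((1 + |r|) ^ (-(2*θ)))

lemma measurable_kk (θ : ℝ) : Measurable (kk θ) := by unfold kk; fun_prop

lemma kk_near {θ : ℝ} (hθ : 0 < θ) {x r : ℝ} (h : |x - r| ≤ 1) :
    kk θ x ≤ ENNReal.ofReal (2 ^ (2*θ)) * kk θ r := by
  unfold kk
  rw [← ENNReal.ofReal_mul (by positivity)]
  apply ENNReal.ofReal_le_ofReal
  have h1 : (1 + |r|) / 2 ≤ 1 + |x| := by
    have h2 : |r| ≤ |x| + |x - r| := by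
      have := abs_sub_abs_le_abs_sub r x
      rw [abs_sub_comm] at this; linarith
    have := abs_nonneg x
    linarith
  calc (1 + |x|) ^ (-(2*θ)) ≤ ((1 + |r|) / 2) ^ (-(2*θ)) :=
        Real.rpow_le_rpow_of_nonpos (by positivity) h1 (by linarith)
    _ = _ := by
        rw [Real.div_rpow (by positivity) (by norm_num), Real.rpow_neg (by norm_num : (0:ℝ) ≤ 2)]
        field_simp

def bx (N : ℝ) (ξ : V2) : ℝ≥0∞ := Set.indicator {z : V2 | ‖z‖ ≤ N} 1 ξ

lemma bx_of_le {N : ℝ} {ξ : V2} (h : ‖ξ‖ ≤ N) : bx N ξ = 1 :=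
  Set.indicator_of_mem (s := {z : V2 | ‖z‖ ≤ N}) h _

lemma bx_ne {N : ℝ} {ξ : V2} (h : bx N ξ ≠ 0) : ‖ξ‖ ≤ N := by
  by_contra h'
  exact h (Set.indicator_of_notMem (s := {z : V2 | ‖z‖ ≤ N}) h' _)

lemma measurable_bx (N : ℝ) : Measurable (bx N) :=
  measurable_one.indicator (measurableSet_le (by fun_prop) measurable_const)

lemma box_int {θ : ℝ} (hθ : 0 < θ) (ξ : V2) (ρ N : ℝ) (hN : 1 ≤ N) :
    ∫⁻ y : V2 × V2, bx N y.1 * bx N y.2 * bx N (ξ - y.1 - y.2) * kk θ (phi3 ξ y - ρ) ≤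
      ENNReal.ofReal (2 ^ (2*θ)) * kth θ * ENNReal.ofReal (2048 * N ^ 3) := by
  set B : Set (V2 × V2) := {y | ‖y.1‖ ≤ N ∧ ‖y.2‖ ≤ N ∧ ‖ξ - y.1 - y.2‖ ≤ N} with hB
  set S : ℝ → Set (V2 × V2) := fun r => {y : V2 × V2 | (‖y.1‖ ≤ N ∧ ‖y.2‖ ≤ N ∧ ‖ξ - y.1 - y.2‖ ≤ N) ∧ (ρ + r < phi3 ξ y ∧ phi3 ξ y ≤ ρ + r + 1)} with hS
  have mphi : Measurable (phi3 ξ) := by unfold phi3; fun_prop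
  have mT : MeasurableSet {z : (V2 × V2) × ℝ | z.1 ∈ S z.2} := by
    simp only [hS, Set.mem_ofPred_eq]
    have h3 : Measurable (fun z : (V2 × V2) × ℝ => phi3 ξ z.1) := mphi.comp measurable_fst
    have a1 : MeasurableSet {z : (V2 × V2) × ℝ | ‖z.1.1‖ ≤ N} := measurableSet_le (by fun_prop) measurable_const
    have a2 : MeasurableSet {z : (V2 × V2) × ℝ | ‖z.1.2‖ ≤ N} := measurableSet_le (by fun_prop) measurable_const
    have a3 : MeasurableSet {z : (V2 × V2) × ℝ | ‖ξ - z.1.1 - z.1.2‖ ≤ N} := measurableSet_le (by fun_prop) measurable_const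
    have a4 : MeasurableSet {z : (V2 × V2) × ℝ | ρ + z.2 < phi3 ξ z.1} := measurableSet_lt (by fun_prop) h3
    have a5 : MeasurableSet {z : (V2 × V2) × ℝ | phi3 ξ z.1 ≤ ρ + z.2 + 1} := measurableSet_le h3 (by fun_prop)
    exact (a1.inter (a2.inter a3)).inter (a4.inter a5)
  have key : ∀ y : V2 × V2, bx N y.1 * bx N y.2 * bx N (ξ - y.1 - y.2) * kk θ (phi3 ξ y - ρ) ≤
      ∫⁻ r : ℝ, ENNReal.ofReal (2 ^ (2*θ)) * kk θ r * (S r).indicator 1 y := by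
    intro y
    by_cases hy : y ∈ B
    · have h1 : bx N y.1 * bx N y.2 * bx N (ξ - y.1 - y.2) = 1 := by
        rw [bx_of_le hy.1, bx_of_le hy.2.1, bx_of_le hy.2.2]; simp
      rw [h1, one_mul]
      set x := phi3 ξ y - ρ with hx
      calc kk θ x = ∫⁻ r in Set.Ico (x - 1) x, kk θ x := by
            rw [lintegral_const]; simp
        _ ≤ ∫⁻ r in Set.Ico (x - 1) x, ENNReal.ofReal (2 ^ (2*θ)) * kk θ r * (S r).indicator 1 y := by
            apply setLIntegral_mono' measurableSet_Ico
            intro r hr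
            have : y ∈ S r := ⟨hy, by linarith [hr.2], by linarith [hr.1]⟩
            rw [Set.indicator_of_mem this, Pi.one_apply, mul_one]
            apply kk_near hθ
            rw [abs_le]; constructor <;> linarith [hr.1, hr.2]
        _ ≤ _ := setLIntegral_le_lintegral _ _
    · have h1 : bx N y.1 * bx N y.2 * bx N (ξ - y.1 - y.2) = 0 := by
        by_contra h
        apply hy
        simp only [mul_eq_zero, not_or] at h
        exact ⟨bx_ne h.1.1, bx_ne h.1.2, bx_ne h.2⟩
      rw [h1, zero_mul]; exact zero_le
  refine (lintegral_mono key).trans ?_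
  rw [lintegral_lintegral_swap]
  · calc ∫⁻ r : ℝ, ∫⁻ y, ENNReal.ofReal (2 ^ (2*θ)) * kk θ r * (S r).indicator 1 y
        ≤ ∫⁻ r : ℝ, ENNReal.ofReal (2 ^ (2*θ)) * kk θ r * ENNReal.ofReal (2048 * N ^ 3) := by
          apply lintegral_mono; intro r
          have mS : MeasurableSet (S r) := measurable_prodMk_right mT
          simp only
          rw [lintegral_const_mul _ (measurable_one.indicator mS), lintegral_indicator_one mS]
          gcongr
          exact vol_box ξ (ρ + r) N hN
      _ = _ := by
          rw [lintegral_mul_const _ ((measurable_kk θ).const_mul _), lintegral_const_mul _ (measurable_kk θ)]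
          rfl
  · apply Measurable.aemeasurable
    apply Measurable.mul
    · exact ((measurable_kk θ).comp measurable_snd).const_mul _
    · exact (measurable_one (β := (V2 × V2) × ℝ) (α := ℝ≥0∞)).indicator mT

lemma lint_shear (ς : ℝ) (f : ℝ × V2 → ℝ≥0∞) (hf : Measurable f) :
    ∫⁻ a, f a = ∫⁻ a : ℝ × V2, f (a.1 + ς * ‖a.2‖, a.2) := by
  rw [Measure.volume_eq_prod, lintegral_prod_symm _ hf.aemeasurable, lintegral_prod_symm _ (Measurable.aemeasurable (by fun_prop))]
  apply lintegral_congr; intro y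
  exact (lintegral_add_right_eq_self (fun α => f (α, y)) (ς * ‖y‖)).symm

def Wf (θ ς N : ℝ) (a : ℝ × V2) : ℝ≥0∞ := kk θ (a.1 - ς * ‖a.2‖) * bx N a.2

lemma measurable_Wf (θ ς N : ℝ) : Measurable (Wf θ ς N) := by
  unfold Wf
  exact ((measurable_kk θ).comp (by fun_prop)).mul ((measurable_bx N).comp measurable_snd)

lemma swap4 {k : ℝ → ℝ≥0∞} (mk : Measurable k) (Φ : ℝ → ℝ → V2 → V2 → ℝ≥0∞)
    (mΦ : Measurable (fun v : (ℝ × ℝ) × (V2 × V2) => Φ v.1.1 v.1.2 v.2.1 v.2.2)) :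
    ∫⁻ a : ℝ × V2, ∫⁻ c : ℝ × V2, k a.1 * k c.1 * Φ a.1 c.1 a.2 c.2
      = ∫⁻ α : ℝ, ∫⁻ β : ℝ, k α * k β * ∫⁻ y : V2 × V2, Φ α β y.1 y.2 := by
  have m2 : Measurable (fun v : (ℝ × V2) × (ℝ × V2) => k v.1.1 * k v.2.1 * Φ v.1.1 v.2.1 v.1.2 v.2.2) :=
    ((mk.comp (measurable_fst.comp measurable_fst)).mul (mk.comp (measurable_fst.comp measurable_snd))).mul (mΦ.comp (show Measurable (fun v : (ℝ × V2) × (ℝ × V2) => ((v.1.1, v.2.1), (v.1.2, v.2.2))) by fun_prop))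
  rw [Measure.volume_eq_prod, lintegral_prod _ (m2.lintegral_prod_right').aemeasurable]
  apply lintegral_congr; intro α
  have : ∀ y : V2, ∫⁻ c : ℝ × V2, k α * k c.1 * Φ α c.1 y c.2 ∂(volume.prod volume) =
      ∫⁻ β : ℝ, ∫⁻ z : V2, k α * k β * Φ α β y z := by
    intro y
    rw [lintegral_prod]
    exact (m2.comp (show Measurable (fun c : ℝ × V2 => ((α, y), c)) by fun_prop)).aemeasurable
  simp only [this]
  have m3 : Measurable (fun v : (V2 × ℝ) × V2 => k α * k v.1.2 * Φ α v.1.2 v.1.1 v.2) :=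
    m2.comp (show Measurable (fun v : (V2 × ℝ) × V2 => ((α, v.1.1), (v.1.2, v.2))) by fun_prop)
  rw [lintegral_lintegral_swap m3.lintegral_prod_right'.aemeasurable]
  apply lintegral_congr; intro β
  have m4 : Measurable (fun v : V2 × V2 => Φ α β v.1 v.2) := mΦ.comp (measurable_prodMk_left (x := (α, β)))
  rw [← lintegral_const_mul _ m4, Measure.volume_eq_prod, lintegral_prod _ (m4.const_mul _).aemeasurable]

lemma W3 {θ : ℝ} (hθ : 0 < θ) (ς N : ℝ) (hς : ς = 1 ∨ ς = -1) (hN : 1 ≤ N) (q : ℝ × V2) :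
    ∫⁻ a, ∫⁻ c, Wf θ ς N a * Wf θ ς N c * Wf θ ς N (q - a - c) ≤
      kth θ * kth θ * (ENNReal.ofReal (2 ^ (2*θ)) * kth θ * ENNReal.ofReal (2048 * N ^ 3)) := by
  have mW := measurable_Wf θ ς N
  have mk := measurable_kk θ
  have mb := measurable_bx N
  have m1 : Measurable (fun z : (ℝ × V2) × (ℝ × V2) => Wf θ ς N z.1 * Wf θ ς N z.2 * Wf θ ς N (q - z.1 - z.2)) := by
    have := mW.comp (measurable_fst : Measurable (fun z : (ℝ × V2) × (ℝ × V2) => z.1))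
    have := mW.comp (measurable_snd : Measurable (fun z : (ℝ × V2) × (ℝ × V2) => z.2))
    have := mW.comp (show Measurable (fun z : (ℝ × V2) × (ℝ × V2) => q - z.1 - z.2) by fun_prop)
    fun_prop
  have e1 : ∫⁻ a, ∫⁻ c, Wf θ ς N a * Wf θ ς N c * Wf θ ς N (q - a - c) =
      ∫⁻ a : ℝ × V2, ∫⁻ c : ℝ × V2, kk θ a.1 * kk θ c.1 * (bx N a.2 * bx N c.2 * bx N (q.2 - a.2 - c.2) * kk θ (phi3 q.2 (a.2, c.2) - ς * (q.1 - a.1 - c.1))) := by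
    rw [lint_shear ς _ m1.lintegral_prod_right']
    apply lintegral_congr; intro a
    simp only
    have m1a : Measurable (fun c => Wf θ ς N (a.1 + ς * ‖a.2‖, a.2) * Wf θ ς N c * Wf θ ς N (q - (a.1 + ς * ‖a.2‖, a.2) - c)) := by
      have := mW.comp (show Measurable (fun c => q - (a.1 + ς * ‖a.2‖, a.2) - c) by fun_prop)
      exact (mW.const_mul _).mul this
    rw [lint_shear ς _ m1a]
    apply lintegral_congr; intro c
    simp only [Wf, Prod.snd_sub, Prod.fst_sub, add_sub_cancel_right]
    have : kk θ (q.1 - (a.1 + ς * ‖a.2‖) - (c.1 + ς * ‖c.2‖) - ς * ‖q.2 - a.2 - c.2‖) = kk θ (phi3 q.2 (a.2, c.2) - ς * (q.1 - a.1 - c.1)) := by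
      unfold kk phi3
      congr 3
      rcases hς with rfl | rfl
      · rw [← abs_neg]; congr 1; ring
      · congr 1; ring
    rw [this]; ring
  rw [e1]
  set Φ : ℝ → ℝ → V2 → V2 → ℝ≥0∞ := fun α β y z => bx N y * bx N z * bx N (q.2 - y - z) * kk θ (phi3 q.2 (y, z) - ς * (q.1 - α - β)) with hΦ
  have mΦ : Measurable (fun v : (ℝ × ℝ) × (V2 × V2) => Φ v.1.1 v.1.2 v.2.1 v.2.2) := by
    simp only [hΦ]
    have mphi : Measurable (fun v : (ℝ × ℝ) × (V2 × V2) => phi3 q.2 (v.2.1, v.2.2)) := by unfold phi3; fun_prop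
    refine Measurable.mul (Measurable.mul (Measurable.mul (mb.comp (by fun_prop)) (mb.comp (by fun_prop))) (mb.comp (by fun_prop))) (mk.comp (mphi.sub (by fun_prop)))
  calc ∫⁻ a : ℝ × V2, ∫⁻ c : ℝ × V2, kk θ a.1 * kk θ c.1 * Φ a.1 c.1 a.2 c.2
      = ∫⁻ α : ℝ, ∫⁻ β : ℝ, kk θ α * kk θ β * ∫⁻ y : V2 × V2, Φ α β y.1 y.2 := swap4 mk Φ mΦ
    _ ≤ ∫⁻ α : ℝ, ∫⁻ β : ℝ, kk θ α * kk θ β * (ENNReal.ofReal (2 ^ (2*θ)) * kth θ * ENNReal.ofReal (2048 * N ^ 3)) := by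
        gcongr with α β
        exact box_int hθ _ _ N hN
    _ = _ := by
        have : ∀ α, ∫⁻ β : ℝ, kk θ α * kk θ β * (ENNReal.ofReal (2 ^ (2*θ)) * kth θ * ENNReal.ofReal (2048 * N ^ 3)) = kk θ α * (kth θ * (ENNReal.ofReal (2 ^ (2*θ)) * kth θ * ENNReal.ofReal (2048 * N ^ 3))) := by
          intro α
          rw [lintegral_mul_const _ (mk.const_mul _), lintegral_const_mul _ mk, mul_assoc]; rfl
        simp only [this]
        rw [lintegral_mul_const _ mk, ← mul_assoc]; rfl

open scoped Convolution in
lemma ch_conv (F G : ℝ × V2 → ℂ) (hF : Integrable F) (hG : Integrable G) (p : ℝ × V2) :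
    ch (F ⋆[ContinuousLinearMap.mul ℂ ℂ] G) p = ch F p * ch G p := by
  have hE : ∀ G : ℝ × V2 → ℂ, Integrable G → Integrable (fun q : ℝ × V2 => Complex.exp (Complex.I * ((p.1 * q.1 + ⟪p.2, q.2⟫ : ℝ) : ℂ)) * G q) := by
    intro G hG
    refine hG.mono ((Continuous.aestronglyMeasurable (by fun_prop)).mul hG.1) ?_
    filter_upwards with q
    rw [norm_mul, norm_cexp_I_mul, one_mul]
  have h := integral_convolution (ContinuousLinearMap.mul ℂ ℂ) (hE F hF) (hE G hG) (μ := volume) (ν := volume)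
  simp only [ContinuousLinearMap.mul_apply'] at h
  unfold ch
  rw [← h]
  apply integral_congr_ae
  filter_upwards with q
  simp only [convolution, ContinuousLinearMap.mul_apply']
  rw [← integral_const_mul]
  apply integral_congr_ae
  filter_upwards with a
  rw [show Complex.exp (Complex.I * ((p.1 * q.1 + ⟪p.2, q.2⟫ : ℝ) : ℂ)) = Complex.exp (Complex.I * ((p.1 * a.1 + ⟪p.2, a.2⟫ : ℝ) : ℂ)) * Complex.exp (Complex.I * ((p.1 * (q - a).1 + ⟪p.2, (q - a).2⟫ : ℝ) : ℂ)) by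
    rw [← Complex.exp_add]
    congr 1
    rw [← mul_add, ← Complex.ofReal_add]
    congr 2
    rw [Prod.snd_sub, Prod.fst_sub, inner_sub_right]; ring]
  ring

def cL6 (θ : ℝ) : ℝ≥0∞ := ENNReal.ofReal cB3 * (kth θ * kth θ * (ENNReal.ofReal (2 ^ (2*θ)) * kth θ * ENNReal.ofReal 2048))

lemma cL6_lt_top {θ : ℝ} (hθ : 1/2 < θ) : cL6 θ < ⊤ := by
  have := kth_lt_top hθ
  unfold cL6
  exact ENNReal.mul_lt_top (by simp) (ENNReal.mul_lt_top (ENNReal.mul_lt_top this this) (ENNReal.mul_lt_top (ENNReal.mul_lt_top (by simp) this) (by simp)))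

open scoped Convolution in
theorem L6 {θ : ℝ} (hθ : 1/2 < θ) (ς N : ℝ) (hς : ς = 1 ∨ ς = -1) (hN : 1 ≤ N)
    (G : ℝ × V2 → ℂ) (hm : Measurable G) (hG : Integrable G)
    (hsupp : ∀ q, G q ≠ 0 → 0 ≤ ς * q.1 ∧ ‖q.2‖ ≤ N) :
    ∫⁻ p, ‖ch G p‖ₑ ^ 6 ≤ cL6 θ * ENNReal.ofReal (N ^ 3) * Xn θ G ^ 3 := by
  set μ3 := (G ⋆[ContinuousLinearMap.mul ℂ ℂ] (G ⋆[ContinuousLinearMap.mul ℂ ℂ] G)) with hμ3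
  have hGG : Integrable (G ⋆[ContinuousLinearMap.mul ℂ ℂ] G) := hG.integrable_convolution _ hG
  have hGGG : Integrable μ3 := hG.integrable_convolution _ hGG
  set H : ℝ × V2 → ℝ≥0∞ := fun a => ENNReal.ofReal (Jw θ a) * ‖G a‖ₑ with hH
  have mH : Measurable H := ((measurable_Jw θ).ennreal_ofReal).mul hm.enorm
  set D : ℝ≥0∞ := kth θ * kth θ * (ENNReal.ofReal (2 ^ (2*θ)) * kth θ * ENNReal.ofReal (2048 * N ^ 3)) with hD
  have hg : ∀ a, ‖G a‖ₑ ≤ (Wf θ ς N a) ^ (1/2:ℝ) * H a := by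
    intro a
    by_cases h0 : G a = 0
    · rw [h0]; simp
    · obtain ⟨h1, h2⟩ := hsupp a h0
      have hW : Wf θ ς N a = ENNReal.ofReal (Jw (-θ) a) ^ (2:ℝ) := by
        unfold Wf
        rw [bx_of_le h2, mul_one]
        unfold kk Jw
        rw [ENNReal.ofReal_rpow_of_nonneg (by positivity) (by norm_num), ← Real.rpow_mul (by positivity)]
        congr 2
        · rcases hς with rfl | rfl
          · rw [abs_of_nonneg (by linarith : 0 ≤ a.1), one_mul]
          · rw [abs_of_nonpos (by linarith : a.1 ≤ 0), ← abs_neg]; congr 2; ring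
        · ring
      rw [hW, ← ENNReal.rpow_mul, hH]
      simp only
      rw [show (2:ℝ) * (1/2) = 1 by norm_num, ENNReal.rpow_one, ← mul_assoc, ← ENNReal.ofReal_mul (Jw_pos _ _).le]
      have : Jw (-θ) a * Jw θ a = 1 := by
        unfold Jw
        rw [← Real.rpow_add (by positivity)]; simp
      rw [this]; simp
  have mW := measurable_Wf θ ς N
  have pt : ∀ q, ‖μ3 q‖ₑ ^ 2 ≤ D * ∫⁻ a, ∫⁻ c, H a ^ 2 * H c ^ 2 * H (q - a - c) ^ 2 := by
    intro q
    have h1 : ‖μ3 q‖ₑ ≤ ∫⁻ a, ∫⁻ c, ‖G a‖ₑ * ‖G c‖ₑ * ‖G (q - a - c)‖ₑ := by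
      rw [hμ3, convolution_def]
      refine (enorm_integral_le_lintegral_enorm _).trans ?_
      apply lintegral_mono; intro a
      simp only [ContinuousLinearMap.mul_apply', enorm_mul]
      rw [convolution_def]
      refine (mul_le_mul_right (enorm_integral_le_lintegral_enorm _) _).trans ?_
      rw [← lintegral_const_mul' _ _ (by simp)]
      apply lintegral_mono; intro c
      simp only [ContinuousLinearMap.mul_apply', enorm_mul, mul_assoc, le_refl]
    have mg1 : Measurable (fun z : (ℝ × V2) × (ℝ × V2) => H z.1 * H z.2 * H (q - z.1 - z.2)) :=
      ((mH.comp (by fun_prop)).mul (mH.comp (by fun_prop))).mul (mH.comp (by fun_prop))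
    have mg2 : Measurable (fun z : (ℝ × V2) × (ℝ × V2) => Wf θ ς N z.1 * Wf θ ς N z.2 * Wf θ ς N (q - z.1 - z.2)) :=
      ((mW.comp (by fun_prop)).mul (mW.comp (by fun_prop))).mul (mW.comp (by fun_prop))
    have mg3 : Measurable (fun z : (ℝ × V2) × (ℝ × V2) => (Wf θ ς N z.1 * Wf θ ς N z.2 * Wf θ ς N (q - z.1 - z.2)) ^ (1/2:ℝ)) := mg2.pow_const _
    have h2 : ‖μ3 q‖ₑ ≤ ∫⁻ z : (ℝ × V2) × (ℝ × V2), (Wf θ ς N z.1 * Wf θ ς N z.2 * Wf θ ς N (q - z.1 - z.2)) ^ (1/2:ℝ) * (H z.1 * H z.2 * H (q - z.1 - z.2)) := by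
      rw [Measure.volume_eq_prod, lintegral_prod (fun z : (ℝ × V2) × (ℝ × V2) => (Wf θ ς N z.1 * Wf θ ς N z.2 * Wf θ ς N (q - z.1 - z.2)) ^ (1/2:ℝ) * (H z.1 * H z.2 * H (q - z.1 - z.2))) (mg3.mul mg1).aemeasurable]
      refine h1.trans ?_
      refine lintegral_mono fun a => lintegral_mono fun c => ?_
      refine (mul_le_mul' (mul_le_mul' (hg a) (hg c)) (hg (q - a - c))).trans (le_of_eq ?_)
      rw [ENNReal.mul_rpow_of_nonneg _ _ (by norm_num), ENNReal.mul_rpow_of_nonneg _ _ (by norm_num)]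
      ring
    calc ‖μ3 q‖ₑ ^ 2 ≤ _ := pow_le_pow_left₀ (by simp) h2 2
      _ ≤ _ := cs_lint mg3.aemeasurable mg1.aemeasurable
      _ ≤ _ := by
        refine mul_le_mul' ?_ (le_of_eq ?_)
        · refine le_trans (le_of_eq ?_) (W3 (by linarith : 0 < θ) ς N hς hN q)
          rw [Measure.volume_eq_prod, lintegral_prod _ (mg3.pow_const 2).aemeasurable]
          simp only [← ENNReal.rpow_natCast, ← ENNReal.rpow_mul]
          norm_num
        · rw [Measure.volume_eq_prod, lintegral_prod _ (mg1.pow_const 2).aemeasurable]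
          simp only [mul_pow]
  have hX : Xn θ G = ∫⁻ a, H a ^ 2 := rfl
  calc ∫⁻ p, ‖ch G p‖ₑ ^ 6 = ∫⁻ p, ‖ch μ3 p‖ₑ ^ 2 := by
        apply lintegral_congr; intro p
        rw [hμ3, ch_conv _ _ hG hGG, ch_conv _ _ hG hG, enorm_mul, enorm_mul]; ring
    _ ≤ ENNReal.ofReal cB3 * ∫⁻ q, ‖μ3 q‖ₑ ^ 2 := bessel3 _ hGGG
    _ ≤ ENNReal.ofReal cB3 * ∫⁻ q, D * ∫⁻ a, ∫⁻ c, H a ^ 2 * H c ^ 2 * H (q - a - c) ^ 2 := by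
        gcongr with q; exact pt q
    _ = ENNReal.ofReal cB3 * (D * Xn θ G ^ 3) := by
        congr 1
        have mH2 : Measurable (fun a => H a ^ 2) := mH.pow_const 2
        have m1 : Measurable (fun z : ((ℝ × V2) × (ℝ × V2)) × (ℝ × V2) => H z.1.2 ^ 2 * H z.2 ^ 2 * H (z.1.1 - z.1.2 - z.2) ^ 2) :=
          ((mH2.comp (by fun_prop)).mul (mH2.comp (by fun_prop))).mul (mH2.comp (show Measurable (fun z : ((ℝ × V2) × (ℝ × V2)) × (ℝ × V2) => (z.1.1 - z.1.2 - z.2)) by fun_prop))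
        have m2 := m1.lintegral_prod_right' (ν := volume)
        have m3 := m2.lintegral_prod_right' (ν := volume)
        rw [lintegral_const_mul _ m3, lintegral_lintegral_swap m2.aemeasurable]
        congr 1
        have : ∀ a, ∫⁻ q, ∫⁻ c, H a ^ 2 * H c ^ 2 * H (q - a - c) ^ 2 = H a ^ 2 * (Xn θ G * Xn θ G) := by
          intro a
          rw [lintegral_lintegral_swap]
          · have : ∀ c, ∫⁻ q, H a ^ 2 * H c ^ 2 * H (q - a - c) ^ 2 = H a ^ 2 * (H c ^ 2 * Xn θ G) := by
              intro c
              rw [lintegral_const_mul _ (show Measurable (fun q => H (q - a - c) ^ 2) from mH2.comp (show Measurable (fun q => q - a - c) by fun_prop)), mul_assoc, hX]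
              simp only [sub_sub]
              rw [lintegral_sub_right_eq_self (fun q => H q ^ 2) (a + c)]
            simp only [this]
            rw [lintegral_const_mul _ (mH2.mul_const _), lintegral_mul_const _ mH2, ← hX]
          · exact (m1.comp (show Measurable (fun v : (ℝ × V2) × (ℝ × V2) => ((v.1, a), v.2)) by fun_prop)).aemeasurable
        simp only [this]
        rw [lintegral_mul_const _ mH2, ← hX]; ring
    _ = _ := by
        rw [hD, cL6, ENNReal.ofReal_mul (by norm_num)]; ring

def cE (θ : ℝ) : ℝ≥0∞ := ENNReal.ofReal cB2 * (2 * kth θ)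

lemma cE_lt_top {θ : ℝ} (hθ : 1/2 < θ) : cE θ < ⊤ :=
  ENNReal.mul_lt_top (by simp) (ENNReal.mul_lt_top (by simp) (kth_lt_top hθ))

lemma holder3 {α : Type*} [MeasurableSpace α] {μ : Measure α} {f g : α → ℝ≥0∞} (hf : Measurable f) (hg : Measurable g)
    {q : ℝ} (hq : 3 < q) :
    ∫⁻ x, (f x * g x) ^ 2 ∂μ ≤ (∫⁻ x, f x ^ q ∂μ) ^ (2/q) * (∫⁻ x, g x ^ 2 ∂μ) ^ (1 - 3/q) * (∫⁻ x, g x ^ 6 ∂μ) ^ (1/q) := by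
  have h3 : 3 / q < 1 := by rw [div_lt_one (by linarith)]; exact hq
  have h := ENNReal.lintegral_prod_norm_pow_le (μ := μ) (Finset.univ : Finset (Fin 3))
    (f := ![fun x => f x ^ q, fun x => g x ^ 2, fun x => g x ^ 6])
    (by
      intro i _
      fin_cases i
      · exact (hf.pow_const q).aemeasurable
      · exact (hg.pow_const 2).aemeasurable
      · exact (hg.pow_const 6).aemeasurable)
    (p := ![2/q, 1 - 3/q, 1/q])
    (by simp [Fin.sum_univ_three]; ring)
    (by
      intro i _
      fin_cases i
      · simp; positivity
      · simp; linarith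
      · simp; linarith)
  simp only [Fin.prod_univ_three, Matrix.cons_val_zero, Matrix.cons_val_one, Matrix.cons_val] at h
  refine le_trans (le_of_eq ?_) h
  apply lintegral_congr; intro x
  rw [mul_pow, mul_assoc, ← ENNReal.rpow_mul, mul_div_cancel₀ _ (by linarith : q ≠ 0)]
  congr 1
  · norm_num
  · simp only [← ENNReal.rpow_natCast]
    rw [← ENNReal.rpow_mul, ← ENNReal.rpow_mul, ← ENNReal.rpow_add_of_nonneg _ _ (by push_cast; linarith) (by positivity)]
    congr 1
    push_cast; field_simp; ring

def Qn (p q : ℝ) (f : ℝ × V2 → ℝ≥0∞) : ℝ≥0∞ := (∫⁻ t : ℝ, (∫⁻ x : V2, f (t, x) ^ q) ^ (p/q)) ^ (2/p)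

lemma T2p {θ p q : ℝ} (hθ : 1/2 < θ) (hq : 3 < q) (hp : 0 < p) (hpq : 2/p + 1/q = 1)
    (ς N : ℝ) (hς : ς = 1 ∨ ς = -1) (hN : 1 ≤ N)
    (f : ℝ × V2 → ℝ≥0∞) (hf : Measurable f)
    (G : ℝ × V2 → ℂ) (hm : Measurable G) (hG : Integrable G)
    (hsupp : ∀ q, G q ≠ 0 → 0 ≤ ς * q.1 ∧ ‖q.2‖ ≤ N) :
    ∫⁻ z, (f z * ‖ch G z‖ₑ) ^ 2 ≤ Qn p q f * (cE θ ^ (1 - 3/q) * cL6 θ ^ (1/q) * ENNReal.ofReal N ^ (3/q) * Xn θ G) := by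
  have hq0 : 0 < q := by linarith
  have h3 : 3 / q < 1 := by rw [div_lt_one (by linarith)]; exact hq
  have mc : Measurable (fun z => ‖ch G z‖ₑ) := (continuous_ch G hG).measurable.enorm
  have mcs : ∀ t, Measurable (fun x => ‖ch G (t, x)‖ₑ) := fun t => mc.comp measurable_prodMk_left
  have mfs : ∀ t, Measurable (fun x => f (t, x)) := fun t => hf.comp measurable_prodMk_left
  set A : ℝ → ℝ≥0∞ := fun t => ∫⁻ x : V2, f (t, x) ^ q with hA
  set B : ℝ → ℝ≥0∞ := fun t => ∫⁻ x : V2, ‖ch G (t, x)‖ₑ ^ 6 with hB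
  have mA : Measurable A := (hf.pow_const q).lintegral_prod_right'
  have mB : Measurable B := (mc.pow_const 6).lintegral_prod_right'
  have hBint : ∫⁻ t, B t ≤ cL6 θ * ENNReal.ofReal (N ^ 3) * Xn θ G ^ 3 := by
    refine le_trans (le_of_eq ?_) (L6 hθ ς N hς hN G hm hG hsupp)
    rw [Measure.volume_eq_prod, lintegral_prod _ (mc.pow_const 6).aemeasurable]
  calc ∫⁻ z, (f z * ‖ch G z‖ₑ) ^ 2 = ∫⁻ t, ∫⁻ x, (f (t, x) * ‖ch G (t, x)‖ₑ) ^ 2 := by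
        rw [Measure.volume_eq_prod, lintegral_prod (fun z => (f z * ‖ch G z‖ₑ) ^ 2) ((hf.mul mc).pow_const 2).aemeasurable]
    _ ≤ ∫⁻ t, (cE θ * Xn θ G) ^ (1 - 3/q) * ((A t ^ (p/q)) ^ (2/p) * B t ^ (1/q)) := by
        apply lintegral_mono; intro t
        refine (holder3 (mfs t) (mcs t) hq).trans ?_
        have := energy hθ G hG t
        calc A t ^ (2/q) * (∫⁻ x, ‖ch G (t, x)‖ₑ ^ 2) ^ (1 - 3/q) * B t ^ (1/q)
            ≤ A t ^ (2/q) * (cE θ * Xn θ G) ^ (1 - 3/q) * B t ^ (1/q) := by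
              gcongr
              exact this
          _ = _ := by
              simp only
              rw [← ENNReal.rpow_mul, show p / q * (2/p) = 2/q by field_simp]; ring
    _ = (cE θ * Xn θ G) ^ (1 - 3/q) * ∫⁻ t, ((A t ^ (p/q)) ^ (2/p) * B t ^ (1/q)) := by
        rw [lintegral_const_mul]
        exact ((mA.pow_const _).pow_const _).mul (mB.pow_const _)
    _ ≤ (cE θ * Xn θ G) ^ (1 - 3/q) * ((∫⁻ t, A t ^ (p/q)) ^ (2/p) * (∫⁻ t, B t) ^ (1/q)) := by
        gcongr
        exact ENNReal.lintegral_mul_norm_pow_le (mA.pow_const _).aemeasurable mB.aemeasurable (by positivity) (by positivity) hpq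
    _ ≤ (cE θ * Xn θ G) ^ (1 - 3/q) * (Qn p q f * (cL6 θ * ENNReal.ofReal (N ^ 3) * Xn θ G ^ 3) ^ (1/q)) := by
        gcongr
        exact le_refl _
    _ = _ := by
        rw [ENNReal.mul_rpow_of_nonneg _ _ (by linarith : 0 ≤ 1 - 3/q), ENNReal.mul_rpow_of_nonneg _ _ (by positivity : 0 ≤ 1/q),
          ENNReal.mul_rpow_of_nonneg _ _ (by positivity : 0 ≤ 1/q), ENNReal.ofReal_pow (by linarith)]
        have e : ∀ y : ℝ≥0∞, (y ^ 3) ^ (1/q) = y ^ (3/q) := by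
          intro y
          rw [← ENNReal.rpow_natCast, ← ENNReal.rpow_mul]; congr 1; push_cast; ring
        rw [e, e]
        have e2 : Xn θ G ^ (1 - 3/q) * Xn θ G ^ (3/q) = Xn θ G := by
          rw [← ENNReal.rpow_add_of_nonneg _ _ (by linarith) (by positivity)]; simp
        calc _ = Qn p q f * (cE θ ^ (1 - 3/q) * cL6 θ ^ (1/q) * ENNReal.ofReal N ^ (3/q) * (Xn θ G ^ (1 - 3/q) * Xn θ G ^ (3/q))) := by ring
          _ = _ := by rw [e2]

def idx (q : ℝ × V2) : ℕ × Bool := (Nat.log 2 ⌊1 + ‖q.2‖⌋₊, decide (0 ≤ q.1))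

lemma measurable_idx : Measurable idx := by
  unfold idx
  apply Measurable.prodMk
  · have h1 : Measurable (fun q : ℝ × V2 => ⌊1 + ‖q.2‖⌋₊) := Nat.measurable_floor.comp (by fun_prop)
    exact (measurable_of_countable (fun n => Nat.log 2 n)).comp h1
  · apply measurable_to_bool
    have : (fun q : ℝ × V2 => decide (0 ≤ q.1)) ⁻¹' {true} = {q | 0 ≤ q.1} := by ext; simp
    rw [this]
    exact measurableSet_le measurable_const measurable_fst

lemma idx_spec (q : ℝ × V2) : (2:ℝ) ^ (idx q).1 ≤ 1 + ‖q.2‖ ∧ 1 + ‖q.2‖ < 2 ^ ((idx q).1 + 1) := by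
  have h1 : 1 ≤ 1 + ‖q.2‖ := by linarith [norm_nonneg q.2]
  have h2 : ⌊1 + ‖q.2‖⌋₊ ≠ 0 := by
    have := Nat.one_le_floor_iff _ |>.2 h1
    omega
  constructor
  · have := Nat.pow_log_le_self 2 h2
    calc (2:ℝ) ^ (idx q).1 = ((2 ^ (Nat.log 2 ⌊1 + ‖q.2‖⌋₊) : ℕ) : ℝ) := by simp [idx]
      _ ≤ (⌊1 + ‖q.2‖⌋₊ : ℝ) := by exact_mod_cast this
      _ ≤ _ := Nat.floor_le (by linarith)
  · have := Nat.lt_pow_succ_log_self (b := 2) (by norm_num) ⌊1 + ‖q.2‖⌋₊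
    have h3 := (Nat.floor_lt (by linarith)).1 this
    simpa [idx] using h3

def Yn (s1 θ : ℝ) (G : ℝ × V2 → ℂ) : ℝ≥0∞ :=
  ∫⁻ q, (ENNReal.ofReal ((1 + ‖q.2‖) ^ s1) * (ENNReal.ofReal (Jw θ q) * ‖G q‖ₑ)) ^ 2

lemma ch_pieces (G : ℝ × V2 → ℂ) (hG : Integrable G) (z : ℝ × V2) :
    ‖ch G z‖ₑ ≤ ∑' i : ℕ × Bool, ‖ch ((idx ⁻¹' {i}).indicator G) z‖ₑ := by
  have hm : ∀ i : ℕ × Bool, MeasurableSet (idx ⁻¹' {i}) := fun i => measurable_idx (measurableSet_singleton i)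
  have hu : (⋃ i : ℕ × Bool, idx ⁻¹' {i}) = Set.univ := by ext; simp
  have hd : Pairwise (Function.onFun Disjoint (fun i : ℕ × Bool => idx ⁻¹' {i})) := by
    intro i j hij
    exact Disjoint.preimage _ (by simpa using hij)
  have hE : Integrable (fun q : ℝ × V2 => Complex.exp (Complex.I * ((z.1 * q.1 + ⟪z.2, q.2⟫ : ℝ) : ℂ)) * G q) := by
    refine hG.mono ((Continuous.aestronglyMeasurable (by fun_prop)).mul hG.1) ?_
    filter_upwards with q
    rw [norm_mul, norm_cexp_I_mul, one_mul]
  have h := integral_iUnion hm hd (f := fun q : ℝ × V2 => Complex.exp (Complex.I * ((z.1 * q.1 + ⟪z.2, q.2⟫ : ℝ) : ℂ)) * G q) hE.integrableOn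
  rw [hu, setIntegral_univ] at h
  unfold ch
  rw [h]
  refine enorm_tsum_le_tsum_enorm.trans (le_of_eq ?_)
  congr 1; ext i; congr 1
  rw [← integral_indicator (hm i)]
  congr 1; ext q
  by_cases hq : q ∈ idx ⁻¹' {i}
  · simp [Set.indicator_of_mem hq]
  · simp [Set.indicator_of_notMem hq]

lemma cs_tsum {ι : Type*} (a b : ι → ℝ≥0∞) : (∑' i, a i * b i) ^ 2 ≤ (∑' i, a i ^ 2) * (∑' i, b i ^ 2) := by
  let _ : MeasurableSpace ι := ⊤
  have h := cs_lint (μ := (Measure.count : Measure ι)) (f := a) (g := b) (measurable_from_top.aemeasurable) (measurable_from_top.aemeasurable)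
  simpa only [lintegral_count] using h

theorem T2 {θ p q s1 : ℝ} (hθ : 1/2 < θ) (hq : 3 < q) (hp : 0 < p) (hpq : 2/p + 1/q = 1) (hs1 : 3 / (2 * q) < s1) :
    ∃ C : ℝ≥0∞, C ≠ ⊤ ∧ ∀ (f : ℝ × V2 → ℝ≥0∞) (_ : Measurable f)
      (G : ℝ × V2 → ℂ) (_ : Measurable G) (_ : Integrable G),
      ∫⁻ z, (f z * ‖ch G z‖ₑ) ^ 2 ≤ C * Qn p q f * Yn s1 θ G := by
  have hq0 : 0 < q := by linarith
  have h3 : 3 / q < 1 := by rw [div_lt_one (by linarith)]; exact hq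
  set κ : ℝ := s1 - 3 / (2*q) with hκ
  have hκ0 : 0 < κ := by rw [hκ]; linarith
  set a : ℕ × Bool → ℝ≥0∞ := fun i => ENNReal.ofReal ((2:ℝ) ^ (-κ)) ^ i.1 with ha
  set b : ℕ × Bool → ℝ≥0∞ := fun i => ENNReal.ofReal ((2:ℝ) ^ κ) ^ i.1 with hb
  set K : ℝ≥0∞ := ∑' i, a i ^ 2 with hK
  set D : ℝ≥0∞ := cE θ ^ (1 - 3/q) * cL6 θ ^ (1/q) * ENNReal.ofReal 2 ^ (3/q) with hD
  have hab : ∀ i, a i * b i = 1 := by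
    intro i
    simp only [ha, hb]
    rw [← mul_pow, ← ENNReal.ofReal_mul (by positivity), ← Real.rpow_add (by norm_num)]; simp
  have hKf : K ≠ ⊤ := by
    rw [hK, ENNReal.tsum_prod (f := fun j (_ : Bool) => (ENNReal.ofReal ((2:ℝ) ^ (-κ)) ^ j) ^ 2)]
    simp only [tsum_fintype, Finset.sum_const, Finset.card_univ, Fintype.card_bool]
    simp only [nsmul_eq_mul]
    rw [ENNReal.tsum_mul_left]
    refine ENNReal.mul_ne_top (by simp) ?_
    simp only [← pow_mul, mul_comm _ 2]
    simp only [pow_mul]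
    rw [ENNReal.tsum_geometric]
    simp only [ne_eq, ENNReal.inv_eq_top, tsub_eq_zero_iff_le, not_le]
    apply pow_lt_one₀ (by simp) _ (by norm_num)
    rw [ENNReal.ofReal_lt_one]
    exact Real.rpow_lt_one_of_one_lt_of_neg (by norm_num) (by linarith)
  have hDf : D ≠ ⊤ := by
    refine ENNReal.mul_ne_top (ENNReal.mul_ne_top ?_ ?_) ?_
    · exact ENNReal.rpow_ne_top_of_nonneg (by linarith) (cE_lt_top hθ).ne
    · exact ENNReal.rpow_ne_top_of_nonneg (by positivity) (cL6_lt_top hθ).ne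
    · exact ENNReal.rpow_ne_top_of_nonneg (by positivity) (by simp)
  refine ⟨K * D, ENNReal.mul_ne_top hKf hDf, ?_⟩
  intro f hf G hm hG
  have hms : ∀ i : ℕ × Bool, MeasurableSet (idx ⁻¹' {i}) := fun i => measurable_idx (measurableSet_singleton i)
  have hu : (⋃ i : ℕ × Bool, idx ⁻¹' {i}) = Set.univ := by ext; simp
  have hd : Pairwise (Function.onFun Disjoint (fun i : ℕ × Bool => idx ⁻¹' {i})) := by
    intro i j hij
    exact Disjoint.preimage _ (by simpa using hij)
  set Gi : ℕ × Bool → ℝ × V2 → ℂ := fun i => (idx ⁻¹' {i}).indicator G with hGi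
  have hGii : ∀ i, Integrable (Gi i) := fun i => hG.indicator (hms i)
  have mc : ∀ i, Measurable (fun z => ‖ch (Gi i) z‖ₑ) := fun i => (continuous_ch _ (hGii i)).measurable.enorm
  have pt : ∀ z, (f z * ‖ch G z‖ₑ) ^ 2 ≤ K * ∑' i, b i ^ 2 * (f z * ‖ch (Gi i) z‖ₑ) ^ 2 := by
    intro z
    calc (f z * ‖ch G z‖ₑ) ^ 2 ≤ (f z * ∑' i, ‖ch (Gi i) z‖ₑ) ^ 2 := by
          gcongr; exact ch_pieces G hG z
      _ = (∑' i, a i * (b i * (f z * ‖ch (Gi i) z‖ₑ))) ^ 2 := by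
          rw [← ENNReal.tsum_mul_left]
          congr 2; ext i
          rw [← mul_assoc (a i), hab, one_mul]
      _ ≤ _ := by
          refine (cs_tsum _ _).trans (le_of_eq ?_)
          simp only [mul_pow, hK]
  calc ∫⁻ z, (f z * ‖ch G z‖ₑ) ^ 2 ≤ ∫⁻ z, K * ∑' i, b i ^ 2 * (f z * ‖ch (Gi i) z‖ₑ) ^ 2 := lintegral_mono pt
    _ = K * ∑' i, b i ^ 2 * ∫⁻ z, (f z * ‖ch (Gi i) z‖ₑ) ^ 2 := by
        rw [lintegral_const_mul' _ _ hKf, lintegral_tsum]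
        · congr 2; ext i
          rw [lintegral_const_mul]
          exact (hf.mul (mc i)).pow_const 2
        · intro i
          exact (((hf.mul (mc i)).pow_const 2).const_mul _).aemeasurable
    _ ≤ K * ∑' i, D * Qn p q f * ∫⁻ y in idx ⁻¹' {i}, (ENNReal.ofReal ((1 + ‖y.2‖) ^ s1) * (ENNReal.ofReal (Jw θ y) * ‖G y‖ₑ)) ^ 2 := by
        refine mul_le_mul_right (ENNReal.tsum_le_tsum fun i => ?_) _
        have hN : (1:ℝ) ≤ 2 ^ (i.1 + 1) := one_le_pow₀ (by norm_num)
        have hb2 := T2p hθ hq hp hpq (if i.2 then 1 else -1) (2 ^ (i.1 + 1)) (by split_ifs <;> simp) hN f hf (Gi i) (hm.indicator (hms i)) (hGii i) (by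
          intro y hy
          have hyi : idx y = i := by
            by_contra h
            exact hy (Set.indicator_of_notMem (by simpa using h) _)
          constructor
          · rw [← hyi]
            simp only [idx, decide_eq_true_eq]
            split_ifs with h
            · linarith
            · push Not at h; linarith
          · have := (idx_spec y).2
            rw [hyi] at this; linarith)
        have hX : Xn θ (Gi i) = ∫⁻ y in idx ⁻¹' {i}, (ENNReal.ofReal (Jw θ y) * ‖G y‖ₑ) ^ 2 := by
          rw [Xn, ← lintegral_indicator (hms i)]
          apply lintegral_congr; intro y
          by_cases hq : y ∈ idx ⁻¹' {i}
          · simp [hGi, Set.indicator_of_mem hq]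
          · simp [hGi, Set.indicator_of_notMem hq]
        calc _ ≤ b i ^ 2 * _ := mul_le_mul_right hb2 _
          _ = D * Qn p q f * (ENNReal.ofReal ((2:ℝ) ^ (s1 * i.1)) ^ 2 * Xn θ (Gi i)) := by
              have e1 : b i ^ 2 * ENNReal.ofReal ((2:ℝ) ^ (i.1 + 1)) ^ (3/q) = ENNReal.ofReal 2 ^ (3/q) * ENNReal.ofReal ((2:ℝ) ^ (s1 * i.1)) ^ 2 := by
                simp only [hb]
                rw [← ENNReal.ofReal_pow (by positivity), ← ENNReal.ofReal_pow (by positivity), ← ENNReal.ofReal_pow (by positivity),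
                  ENNReal.ofReal_rpow_of_nonneg (by positivity) (by positivity), ENNReal.ofReal_rpow_of_nonneg (by positivity) (by positivity),
                  ← ENNReal.ofReal_mul (by positivity), ← ENNReal.ofReal_mul (by positivity)]
                congr 1
                simp only [← Real.rpow_natCast, ← Real.rpow_mul (by norm_num : (0:ℝ) ≤ 2), ← Real.rpow_add (by norm_num : (0:ℝ) < 2)]
                congr 1
                rw [hκ]; push_cast; field_simp; ring
              rw [hD]
              calc _ = Qn p q f * (cE θ ^ (1 - 3/q) * cL6 θ ^ (1/q) * (b i ^ 2 * ENNReal.ofReal ((2:ℝ) ^ (i.1 + 1)) ^ (3/q)) * Xn θ (Gi i)) := by ring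
                _ = _ := by rw [e1]; ring
          _ ≤ _ := by
              gcongr
              rw [hX, ← lintegral_const_mul' _ _ (by simp)]
              apply setLIntegral_mono' (hms i)
              intro y hy
              rw [← mul_pow]
              gcongr
              have hyi : idx y = i := hy
              have := (idx_spec y).1
              rw [hyi] at this
              rw [mul_comm, Real.rpow_mul (by norm_num), Real.rpow_natCast]
              have hs0 : 0 < s1 := lt_trans (by positivity) hs1
              gcongr
    _ = K * D * Qn p q f * Yn s1 θ G := by
        rw [ENNReal.tsum_mul_left, ← lintegral_iUnion hms hd, hu, setLIntegral_univ]
        rw [Yn]; ring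

open scoped FourierTransform in
lemma inv_gen {W : Type*} [NormedAddCommGroup W] [InnerProductSpace ℝ W] [FiniteDimensional ℝ W] [MeasurableSpace W] [BorelSpace W]
    (g : SchwartzMap W ℂ) : ∃ h : SchwartzMap W ℂ,
      (∀ ξ, h ξ = ∫ x, Complex.exp (-Complex.I * ((⟪x, ξ⟫ : ℝ) : ℂ)) * g x) ∧
      ∀ x, g x = ((((2 * π) ^ (Module.finrank ℝ W))⁻¹ : ℝ) : ℂ) * ∫ ξ, Complex.exp (Complex.I * ((⟪x, ξ⟫ : ℝ) : ℂ)) * h ξ := by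
  have h2 : (2 * π)⁻¹ ≠ 0 := by positivity
  refine ⟨SchwartzMap.compCLMOfContinuousLinearEquiv ℝ (ContinuousLinearEquiv.smulLeft (Units.mk0 (2 * π)⁻¹ h2)) (𝓕 g), ?_, ?_⟩
  · intro ξ
    change 𝓕 (g : W → ℂ) ((2 * π)⁻¹ • ξ) = _
    rw [Real.fourier_eq']
    congr 1; ext x
    rw [smul_eq_mul, inner_smul_right]
    congr 2
    push_cast
    have : (π : ℂ) ≠ 0 := by exact_mod_cast Real.pi_ne_zero
    field_simp
  · intro x
    have h1 : 𝓕⁻ (𝓕 (g : W → ℂ)) x = g x := by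
      rw [Continuous.fourierInv_fourier_eq g.continuous g.integrable (𝓕 g).integrable]
    rw [← h1, Real.fourierInv_eq']
    have h3 := Measure.integral_comp_smul (volume : Measure W) (fun v => Complex.exp ((↑(2 * π * ⟪v, x⟫) * Complex.I)) • 𝓕 (g : W → ℂ) v) (2 * π)⁻¹
    have h4 : ∀ ξ, Complex.exp (Complex.I * ((⟪x, ξ⟫ : ℝ) : ℂ)) * (SchwartzMap.compCLMOfContinuousLinearEquiv ℝ (ContinuousLinearEquiv.smulLeft (Units.mk0 (2 * π)⁻¹ h2)) (𝓕 g)) ξ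
        = Complex.exp ((↑(2 * π * ⟪(2 * π)⁻¹ • ξ, x⟫) * Complex.I)) • 𝓕 (g : W → ℂ) ((2 * π)⁻¹ • ξ) := by
      intro ξ
      rw [smul_eq_mul, inner_smul_left, real_inner_comm]
      congr 2
      simp
      have : (π : ℂ) ≠ 0 := by exact_mod_cast Real.pi_ne_zero
      field_simp
    simp only [h4]
    rw [h3]
    rw [inv_pow, inv_inv, abs_of_nonneg (by positivity), Complex.real_smul, ← mul_assoc, ← Complex.ofReal_mul, inv_mul_cancel₀ (by positivity)]
    simp

lemma inv2 (g : SchwartzMap V2 ℂ) : ∃ h : SchwartzMap V2 ℂ, (∀ ξ, h ξ = ft2 g ξ) ∧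
    ∀ x, g x = ift2 h x := by
  obtain ⟨h, h1, h2⟩ := inv_gen g
  refine ⟨h, h1, ?_⟩
  intro x
  rw [h2 x, ift2]; simp

lemma inv3 (g : SchwartzMap (ℝ × V2) ℂ) : ∃ h : SchwartzMap (ℝ × V2) ℂ, (∀ q, h q = ftST g q.1 q.2) ∧
    ∀ x, g x = ((((2 * π) ^ 3)⁻¹ : ℝ) : ℂ) * ch h x := by
  have mp := WithLp.volume_preserving_ofLp ℝ V2
  have emb : MeasurableEmbedding (WithLp.ofLp : WithLp 2 (ℝ × V2) → ℝ × V2) :=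
    (MeasurableEquiv.toLp 2 (ℝ × V2)).symm.measurableEmbedding
  let L := WithLp.prodContinuousLinearEquiv 2 ℝ ℝ V2
  obtain ⟨h, h1, h2⟩ := inv_gen (SchwartzMap.compCLMOfContinuousLinearEquiv ℝ L g)
  refine ⟨SchwartzMap.compCLMOfContinuousLinearEquiv ℝ L.symm h, ?_, ?_⟩
  · intro q
    change h (L.symm q) = _
    rw [h1, ftST, ← mp.integral_comp emb]
    congr 1; ext z
    rw [WithLp.prod_inner_apply]
    simp [L, mul_comm]
  · intro x
    have := h2 (L.symm x)
    change g (L (L.symm x)) = _ at this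
    rw [L.apply_symm_apply] at this
    rw [this, ch, ← mp.integral_comp emb]
    congr 1
    · have hf : Module.finrank ℝ (WithLp 2 (ℝ × V2)) = 3 := by
        rw [LinearEquiv.finrank_eq L.toLinearEquiv, Module.finrank_prod]; simp
      rw [hf]
    · congr 1; ext z
      rw [WithLp.prod_inner_apply]
      simp [L, mul_comm]

def nuS (s : ℝ) : Measure V2 := volume.withDensity (fun h => ENNReal.ofReal (‖h‖ ^ (-2 - s)))

instance instSigNu (s : ℝ) : SigmaFinite (nuS s) := by unfold nuS; infer_instance

lemma nu_lint (s : ℝ) {g : V2 → ℝ≥0∞} (hg : Measurable g) :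
    ∫⁻ h, g h ∂(nuS s) = ∫⁻ h, ENNReal.ofReal (‖h‖ ^ (-2 - s)) * g h := by
  unfold nuS
  rw [lintegral_withDensity_eq_lintegral_mul _ (by fun_prop) hg]; rfl

lemma nu_min {s a : ℝ} (hs : 0 < s) (ha : s < a) : ∫⁻ h, ENNReal.ofReal (min (‖h‖ ^ a) 1) ∂(nuS s) < ⊤ := by
  rw [nu_lint s (by fun_prop)]
  have h1 : Integrable (fun h : V2 => (fun r : ℝ => r ^ (-2 - s) * min (r ^ a) 1) ‖h‖) := by
    refine (integrable_fun_norm_addHaar volume (f := fun r : ℝ => r ^ (-2 - s) * min (r ^ a) 1)).2 ?_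
    rw [← Set.Ioc_union_Ioi_eq_Ioi (zero_le_one (α := ℝ))]
    apply IntegrableOn.union
    · have : IntegrableOn (fun r : ℝ => r ^ (a - 1 - s)) (Set.Ioc 0 1) :=
        (intervalIntegrable_iff_integrableOn_Ioc_of_le zero_le_one).1 (intervalIntegral.intervalIntegrable_rpow' (by linarith))
      refine this.congr_fun ?_ measurableSet_Ioc
      intro r hr
      have h3 : r ^ a ≤ 1 := Real.rpow_le_one hr.1.le hr.2 (by linarith)
      simp only [finrank_euclideanSpace, Fintype.card_fin, smul_eq_mul, min_eq_left h3]
      rw [← Real.rpow_add hr.1, Nat.succ_sub_one, pow_one]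
      nth_rw 2 [← Real.rpow_one r]
      rw [← Real.rpow_add hr.1]
      congr 1; ring
    · have : IntegrableOn (fun r : ℝ => r ^ (- 1 - s)) (Set.Ioi 1) :=
        integrableOn_Ioi_rpow_of_lt (by linarith) one_pos
      refine this.congr_fun ?_ measurableSet_Ioi
      intro r hr
      have hr : 1 < r := hr
      have hr0 : 0 < r := by linarith
      have h3 : 1 ≤ r ^ a := Real.one_le_rpow hr.le (by linarith)
      simp only [finrank_euclideanSpace, Fintype.card_fin, smul_eq_mul, min_eq_right h3, mul_one]
      rw [Nat.succ_sub_one, pow_one, ← Real.rpow_one_add' hr0.le (by linarith)]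
      congr 1; ring
  refine lt_of_le_of_lt (le_of_eq ?_) h1.lintegral_lt_top
  congr 1; ext h
  rw [ENNReal.ofReal_mul (by positivity)]

lemma nu_scal (s : ℝ) {Φ : ℝ → ℝ≥0∞} (hΦ : Measurable Φ) {ξ : V2} (hξ : ξ ≠ 0) :
    ∫⁻ h, Φ ⟪h, ξ⟫ ∂(nuS s) = ENNReal.ofReal (‖ξ‖ ^ s) * ∫⁻ h, Φ (h 0) ∂(nuS s) := by
  have hm : Measurable fun h : V2 => Φ (h 0) := hΦ.comp (by fun_prop)
  rw [nu_lint s (show Measurable (fun h : V2 => Φ ⟪h, ξ⟫) from hΦ.comp (by fun_prop)), nu_lint s hm]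
  have hc : 0 < ‖ξ‖ := norm_pos_iff.2 hξ
  obtain ⟨R, hR⟩ := exists_rot ξ
  have e1 : ∀ h : V2, ENNReal.ofReal (‖h‖ ^ (-2 - s)) * Φ ⟪h, ξ⟫ =
      (fun h : V2 => ENNReal.ofReal (‖h‖ ^ (-2 - s)) * Φ (‖ξ‖ * h 0)) (R h) := by
    intro h
    simp only [R.norm_map]
    rw [← R.inner_map_map h ξ, hR, inner_smul_right]
    simp [EuclideanSpace.inner_single_right]
  simp_rw [e1]
  rw [R.measurePreserving.lintegral_comp (f := (fun h : V2 => ENNReal.ofReal (‖h‖ ^ (-2 - s)) * Φ (‖ξ‖ * h 0)))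
    (Measurable.mul (by fun_prop) (hΦ.comp (by fun_prop)))]
  have e2 : ∀ h : V2, ENNReal.ofReal (‖h‖ ^ (-2 - s)) * Φ (‖ξ‖ * h 0) =
      (fun h : V2 => ENNReal.ofReal (‖ξ‖ ^ (2 + s)) * (ENNReal.ofReal (‖h‖ ^ (-2 - s)) * Φ (h 0))) (‖ξ‖ • h) := by
    intro h
    simp only [norm_smul, norm_norm]
    rw [← mul_assoc, ← ENNReal.ofReal_mul (by positivity), Real.mul_rpow hc.le (norm_nonneg _), ← mul_assoc,
      ← Real.rpow_add hc]
    simp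
  simp_rw [e2]
  have hm2 : Measurable (fun h : V2 => ENNReal.ofReal (‖ξ‖ ^ (2 + s)) * (ENNReal.ofReal (‖h‖ ^ (-2 - s)) * Φ (h 0))) :=
    Measurable.mul (by fun_prop) (Measurable.mul (by fun_prop) hm)
  rw [← lintegral_map hm2 (by fun_prop), Measure.map_addHaar_smul _ hc.ne', lintegral_smul_measure, lintegral_const_mul _ (show Measurable fun h : V2 => ENNReal.ofReal (‖h‖ ^ (-2 - s)) * Φ (h 0) from Measurable.mul (by fun_prop) hm), smul_eq_mul, ← mul_assoc, ← ENNReal.ofReal_mul (by positivity)]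
  congr 2
  rw [abs_of_nonneg (by positivity), Real.rpow_add hc]
  simp
  field_simp

lemma nu_map (s : ℝ) {ξ : V2} (hξ : ξ ≠ 0) :
    (nuS s).map (fun h => ⟪h, ξ⟫) = ENNReal.ofReal (‖ξ‖ ^ s) • (nuS s).map (fun h : V2 => h 0) := by
  refine Measure.ext_of_lintegral _ fun f hf => ?_
  rw [lintegral_map hf (by fun_prop), lintegral_smul_measure, lintegral_map hf (by fun_prop), nu_scal s hf hξ, smul_eq_mul]

def e1 (r : ℝ) : ℂ := 1 - Complex.exp (Complex.I * (r : ℂ))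

@[fun_prop] lemma continuous_e1 : Continuous e1 := by unfold e1; fun_prop

lemma norm_e1_le (r : ℝ) : ‖e1 r‖ ≤ |r| := by
  unfold e1; rw [← norm_neg, neg_sub]; exact Real.norm_exp_I_mul_ofReal_sub_one_le
lemma norm_e1_le2 (r : ℝ) : ‖e1 r‖ ≤ 2 := by
  unfold e1; refine (norm_sub_le _ _).trans ?_
  rw [norm_cexp_I_mul]; norm_num

def cS (s : ℝ) : ℂ := ∫ h, e1 (h 0) ∂(nuS s)
def aS (s : ℝ) : ℝ≥0∞ := ∫⁻ h, ‖e1 (h 0)‖ₑ ∂(nuS s)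

lemma abs_coord_le (h : V2) : |h 0| ≤ ‖h‖ := by
  have := PiLp.norm_apply_le h 0
  simpa using this

lemma aS_lt_top {s : ℝ} (hs : 0 < s) (hs1 : s < 1) : aS s < ⊤ := by
  have h := nu_min hs hs1
  refine lt_of_le_of_lt (b := ∫⁻ h, 2 * ENNReal.ofReal (min (‖h‖ ^ (1:ℝ)) 1) ∂(nuS s)) ?_ ?_
  · apply lintegral_mono; intro h
    simp only
    have e : 2 * ENNReal.ofReal (min (‖h‖ ^ (1:ℝ)) 1) = ENNReal.ofReal (2 * min (‖h‖ ^ (1:ℝ)) 1) := by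
      rw [ENNReal.ofReal_mul (by norm_num)]; simp
    rw [← ofReal_norm, e]
    apply ENNReal.ofReal_le_ofReal
    have h1 := norm_e1_le (h 0)
    have h2 := norm_e1_le2 (h 0)
    have h3 := abs_coord_le h
    rw [Real.rpow_one]
    rcases min_choice ‖h‖ 1 with h4 | h4 <;> rw [h4]
    · have := norm_nonneg h; linarith
    · linarith
  · rw [lintegral_const_mul _ (by fun_prop)]
    exact ENNReal.mul_lt_top (by simp) h

lemma nu_e1_lint {s : ℝ} (hs : 0 < s) (ξ : V2) : ∫⁻ h, ‖e1 ⟪h, ξ⟫‖ₑ ∂(nuS s) = ENNReal.ofReal (‖ξ‖ ^ s) * aS s := by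
  by_cases hξ : ξ = 0
  · simp [hξ, e1, Real.zero_rpow hs.ne']
  · exact nu_scal s (Φ := fun r => ‖e1 r‖ₑ) (by fun_prop) hξ

lemma nu_e1_int {s : ℝ} (hs : 0 < s) (ξ : V2) : ∫ h, e1 ⟪h, ξ⟫ ∂(nuS s) = ((‖ξ‖ ^ s : ℝ) : ℂ) * cS s := by
  by_cases hξ : ξ = 0
  · simp [hξ, e1, Real.zero_rpow hs.ne']
  · have h := integral_map (μ := nuS s) (φ := fun h : V2 => ⟪h, ξ⟫) (f := e1) (by fun_prop) continuous_e1.aestronglyMeasurable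
    rw [← h, nu_map s hξ, integral_smul_measure, integral_map (by fun_prop) continuous_e1.aestronglyMeasurable, cS,
      ENNReal.toReal_ofReal (by positivity)]
    rfl

lemma cS_ne_zero {s : ℝ} (hs : 0 < s) (hs1 : s < 1) : cS s ≠ 0 := by
  intro h0
  have hi : Integrable (fun h : V2 => e1 (h 0)) (nuS s) :=
    ⟨Continuous.aestronglyMeasurable (by fun_prop), aS_lt_top hs hs1⟩
  have h1 : ∫ h, (e1 (h 0)).re ∂(nuS s) = 0 := by
    have := integral_re hi
    simp only [RCLike.re_eq_complex_re] at this
    rw [this]; change (cS s).re = 0; rw [h0]; rfl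
  have hre : ∀ r : ℝ, (e1 r).re = 1 - Real.cos r := by
    intro r; unfold e1; rw [mul_comm, Complex.sub_re, Complex.exp_ofReal_mul_I_re]; rfl
  simp only [hre] at h1
  rw [integral_eq_zero_iff_of_nonneg (fun h => by simp [Real.cos_le_one]) (by simpa [hre] using hi.re)] at h1
  have h2 : ∀ᵐ h : V2, ENNReal.ofReal (‖h‖ ^ (-2 - s)) ≠ 0 → (1 - Real.cos (h 0)) = 0 :=
    (ae_withDensity_iff (by fun_prop)).1 h1
  have h3 : ∀ᵐ h : V2, ¬ (h 0 ∈ Set.Ioo (0:ℝ) 1) := by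
    filter_upwards [h2] with h hh hm
    have hn : 0 < ‖h‖ := by
      have := abs_coord_le h; rw [abs_of_pos hm.1] at this; linarith [hm.1]
    have := hh (by simp; positivity)
    have h4 : Real.cos (h 0) < 1 := by
      rw [← Real.cos_zero]
      apply Real.cos_lt_cos_of_nonneg_of_le_pi_div_two le_rfl _ hm.1
      have := Real.pi_gt_three; linarith [hm.2]
    linarith
  have h4 : volume {h : V2 | h 0 ∈ Set.Ioo (0:ℝ) 1} = 0 := by
    simpa [ae_iff] using h3
  have ho : IsOpen {h : V2 | h 0 ∈ Set.Ioo (0:ℝ) 1} := isOpen_Ioo.preimage (by fun_prop)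
  rw [ho.measure_eq_zero_iff volume] at h4
  have : EuclideanSpace.single (0 : Fin 2) (1/2:ℝ) ∈ {h : V2 | h 0 ∈ Set.Ioo (0:ℝ) 1} := by
    simp; norm_num
  rw [h4] at this; exact this

@[fun_prop] lemma measurable_e1 : Measurable e1 := continuous_e1.measurable

def Es (s : ℝ) (u : ℝ × V2 → ℂ) (p : ℝ × V2) : ℂ := ∫ h, (u p - u (p.1, p.2 + h)) ∂(nuS s)

lemma Eabs {Y : Type*} [MeasurableSpace Y] {μ : Measure Y} [SFinite μ] {s : ℝ} (hs : 0 < s) (hs1 : s < 1)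
    {ζ : Y → V2} (hζ : Measurable ζ) {G : Y → ℂ} (hG : Integrable G μ)
    (hGs : Integrable (fun y => ((‖ζ y‖ ^ s : ℝ) : ℂ) * G y) μ) (x : V2) :
    Integrable (fun h => (∫ y, Complex.exp (Complex.I * ((⟪x, ζ y⟫ : ℝ) : ℂ)) * G y ∂μ) -
      ∫ y, Complex.exp (Complex.I * ((⟪x + h, ζ y⟫ : ℝ) : ℂ)) * G y ∂μ) (nuS s) ∧
    ∫ h, ((∫ y, Complex.exp (Complex.I * ((⟪x, ζ y⟫ : ℝ) : ℂ)) * G y ∂μ) -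
      ∫ y, Complex.exp (Complex.I * ((⟪x + h, ζ y⟫ : ℝ) : ℂ)) * G y ∂μ) ∂(nuS s) =
      cS s * ∫ y, Complex.exp (Complex.I * ((⟪x, ζ y⟫ : ℝ) : ℂ)) * (((‖ζ y‖ ^ s : ℝ) : ℂ) * G y) ∂μ := by
  let H : V2 × Y → ℂ := fun z => e1 ⟪z.1, ζ z.2⟫ * (Complex.exp (Complex.I * ((⟪x, ζ z.2⟫ : ℝ) : ℂ)) * G z.2)
  have hm1 : AEStronglyMeasurable (fun z : V2 × Y => e1 ⟪z.1, ζ z.2⟫) ((nuS s).prod μ) :=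
    (continuous_e1.measurable.comp (by fun_prop)).aestronglyMeasurable
  have hm2 : AEStronglyMeasurable (fun z : V2 × Y => Complex.exp (Complex.I * ((⟪x, ζ z.2⟫ : ℝ) : ℂ))) ((nuS s).prod μ) :=
    Measurable.aestronglyMeasurable (by fun_prop)
  have hHm : AEStronglyMeasurable H ((nuS s).prod μ) := hm1.mul (hm2.mul hG.1.comp_snd)
  have hH : Integrable H ((nuS s).prod μ) := by
    refine ⟨hHm, ?_⟩
    unfold HasFiniteIntegral
    rw [lintegral_prod_symm _ hHm.enorm]
    have e : ∀ y, ∫⁻ h, ‖H (h, y)‖ₑ ∂(nuS s) = aS s * ‖((‖ζ y‖ ^ s : ℝ) : ℂ) * G y‖ₑ := by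
      intro y
      simp only [H, enorm_mul]
      rw [lintegral_mul_const _ (by fun_prop), nu_e1_lint hs]
      have e1' : ‖Complex.exp (Complex.I * ((⟪x, ζ y⟫ : ℝ) : ℂ))‖ₑ = 1 := by
        rw [← ofReal_norm, norm_cexp_I_mul]; simp
      have e2 : ‖((‖ζ y‖ ^ s : ℝ) : ℂ)‖ₑ = ENNReal.ofReal (‖ζ y‖ ^ s) := by
        rw [← ofReal_norm, Complex.norm_real, Real.norm_of_nonneg (by positivity)]
      rw [e1', e2]; ring
    simp_rw [e]
    rw [lintegral_const_mul'' _ hGs.1.enorm]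
    exact ENNReal.mul_lt_top (aS_lt_top hs hs1) hGs.2
  have hx : ∀ x' : V2, Integrable (fun y => Complex.exp (Complex.I * ((⟪x', ζ y⟫ : ℝ) : ℂ)) * G y) μ := by
    intro x'
    refine hG.mono ((Measurable.aestronglyMeasurable (by fun_prop)).mul hG.1) ?_
    filter_upwards with y; rw [norm_mul, norm_cexp_I_mul, one_mul]
  have hd : ∀ h, (∫ y, Complex.exp (Complex.I * ((⟪x, ζ y⟫ : ℝ) : ℂ)) * G y ∂μ) -
      ∫ y, Complex.exp (Complex.I * ((⟪x + h, ζ y⟫ : ℝ) : ℂ)) * G y ∂μ = ∫ y, H (h, y) ∂μ := by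
    intro h
    rw [← integral_sub (hx _) (hx _)]
    congr 1; ext y
    simp only [H, e1]
    rw [inner_add_left, Complex.ofReal_add, mul_add, Complex.exp_add]; ring
  simp_rw [hd]
  refine ⟨hH.integral_prod_left, ?_⟩
  rw [integral_integral_swap (f := fun h y => H (h, y)) hH, ← integral_const_mul]
  congr 1; ext y
  simp only [H]
  rw [integral_mul_const, nu_e1_int hs]; ring

lemma Es_ch {s : ℝ} (hs : 0 < s) (hs1 : s < 1) {G : ℝ × V2 → ℂ} (hG : Integrable G)
    (hGs : Integrable (fun q => ((‖q.2‖ ^ s : ℝ) : ℂ) * G q)) (p : ℝ × V2) :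
    Integrable (fun h => ch G p - ch G (p.1, p.2 + h)) (nuS s) ∧
    Es s (ch G) p = cS s * ch (fun q => ((‖q.2‖ ^ s : ℝ) : ℂ) * G q) p := by
  have hG' : Integrable (fun q : ℝ × V2 => Complex.exp (Complex.I * ((p.1 * q.1 : ℝ) : ℂ)) * G q) := by
    refine hG.mono ((Continuous.aestronglyMeasurable (by fun_prop)).mul hG.1) ?_
    filter_upwards with y; rw [norm_mul, norm_cexp_I_mul, one_mul]
  have hGs' : Integrable (fun q : ℝ × V2 => ((‖q.2‖ ^ s : ℝ) : ℂ) * (Complex.exp (Complex.I * ((p.1 * q.1 : ℝ) : ℂ)) * G q)) := by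
    refine hGs.mono ((Measurable.aestronglyMeasurable (by fun_prop)).mul hG'.1) ?_
    filter_upwards with y; simp only [norm_mul, norm_cexp_I_mul, one_mul]; rfl
  have e : ∀ x, ch G (p.1, x) = ∫ q : ℝ × V2, Complex.exp (Complex.I * ((⟪x, q.2⟫ : ℝ) : ℂ)) * (Complex.exp (Complex.I * ((p.1 * q.1 : ℝ) : ℂ)) * G q) := by
    intro x; unfold ch; congr 1; ext q
    rw [Complex.ofReal_add, mul_add, Complex.exp_add]; ring
  have h := Eabs hs hs1 (ζ := fun q : ℝ × V2 => q.2) measurable_snd hG' hGs' p.2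
  simp only [← e] at h
  refine ⟨h.1, ?_⟩
  unfold Es
  refine h.2.trans ?_
  congr 1; unfold ch; congr 1; ext q
  rw [Complex.ofReal_add, mul_add, Complex.exp_add]; ring

lemma schw_pow_int {E : Type*} [NormedAddCommGroup E] [NormedSpace ℝ E] [FiniteDimensional ℝ E] [MeasurableSpace E] [BorelSpace E]
    (μ : Measure E) [μ.IsAddHaarMeasure]
    (g : SchwartzMap E ℂ) {N : E → ℝ} (hN : Measurable N) (h0 : ∀ e, 0 ≤ N e) (hN2 : ∀ e, N e ≤ ‖e‖) {s : ℝ} (hs : 0 ≤ s) (hs1 : s ≤ 1) :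
    Integrable (fun e => ((N e ^ s : ℝ) : ℂ) * g e) μ := by
  refine ((g.integrable_pow_mul μ 0).add (g.integrable_pow_mul μ 1)).mono ((Measurable.aestronglyMeasurable (by fun_prop)).mul g.continuous.aestronglyMeasurable) ?_
  filter_upwards with e
  rw [norm_mul, Complex.norm_real, Real.norm_of_nonneg (Real.rpow_nonneg (h0 e) s)]
  simp only [Pi.add_apply, pow_zero, one_mul, pow_one]
  rw [Real.norm_of_nonneg (by positivity), ← one_add_mul]
  gcongr
  calc N e ^ s ≤ (1 + ‖e‖) ^ s := Real.rpow_le_rpow (h0 e) (by linarith [hN2 e]) hs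
    _ ≤ (1 + ‖e‖) ^ (1:ℝ) := Real.rpow_le_rpow_of_exponent_le (by linarith [norm_nonneg e]) hs1
    _ = _ := Real.rpow_one _

lemma slice (A : SchwartzMap (ℝ × V2) ℂ) (t : ℝ) : ∃ a : SchwartzMap V2 ℂ, ∀ x, a x = A (t, x) := by
  have hg : (fun x : V2 => ((0:ℝ), x)).HasTemperateGrowth := by
    have := (ContinuousLinearMap.inr ℝ ℝ V2).hasTemperateGrowth
    exact this
  have hl : AntilipschitzWith 1 (fun x : V2 => ((0:ℝ), x)) := by
    apply AntilipschitzWith.of_le_mul_dist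
    intro x y; simp [Prod.dist_eq]
  refine ⟨SchwartzMap.compCLMOfAntilipschitz ℝ hg hl (SchwartzMap.compSubConstCLM ℝ ((-t, 0) : ℝ × V2) A), ?_⟩
  intro x
  simp [SchwartzMap.compCLMOfAntilipschitz_apply]

lemma Es_A {s : ℝ} (hs : 0 < s) (hs1 : s < 1) (A : SchwartzMap (ℝ × V2) ℂ) (p : ℝ × V2) :
    Integrable (fun h => A p - A (p.1, p.2 + h)) (nuS s) ∧ Es s A p = cS s * DxA s A p := by
  obtain ⟨a, ha⟩ := slice A p.1
  obtain ⟨b, hb1, hb2⟩ := inv2 a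
  have hbs := schw_pow_int volume b (N := fun e => ‖e‖) (by fun_prop) (fun _ => norm_nonneg _) (fun _ => le_rfl) hs.le hs1.le
  have h := Eabs hs hs1 (ζ := fun q : V2 => q) measurable_id b.integrable hbs p.2
  have e : ∀ h, A p - A (p.1, p.2 + h) = ((((2 * π) ^ 2)⁻¹ : ℝ) : ℂ) * ((∫ y, Complex.exp (Complex.I * ((⟪p.2, y⟫ : ℝ) : ℂ)) * b y) -
      ∫ y, Complex.exp (Complex.I * ((⟪p.2 + h, y⟫ : ℝ) : ℂ)) * b y) := by
    intro h
    rw [mul_sub]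
    have e1 := hb2 p.2
    have e2 := hb2 (p.2 + h)
    rw [ha, ift2] at e1 e2
    rw [← e1, ← e2]
  unfold Es
  simp_rw [e]
  refine ⟨h.1.const_mul _, ?_⟩
  rw [integral_const_mul, h.2, DxA, ift2]
  have e3 : (fun y => A (p.1, y)) = a := by ext y; rw [ha]
  rw [e3]
  simp_rw [← hb1]
  ring

lemma diff_int (u : SchwartzMap (ℝ × V2) ℂ) (z v : ℝ × V2) :
    ‖u z - u (z + v)‖ₑ ≤ ∫⁻ r in Set.Ioc (0:ℝ) 1, ‖fderiv ℝ u (z + r • v)‖ₑ * ‖v‖ₑ := by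
  have hc : Continuous (fderiv ℝ u) := (u.smooth 1).continuous_fderiv (by norm_num)
  have hd : ∀ r ∈ Set.uIcc (0:ℝ) 1, HasDerivAt (fun r : ℝ => u (z + r • v)) (fderiv ℝ u (z + r • v) v) r := by
    intro r _
    have h1 : HasDerivAt (fun r : ℝ => z + r • v) v r := by
      simpa using ((hasDerivAt_id r).smul_const v).const_add z
    exact (u.differentiableAt.hasFDerivAt).comp_hasDerivAt r h1
  have h := intervalIntegral.integral_eq_sub_of_hasDerivAt hd (Continuous.intervalIntegrable (by fun_prop) _ _)
  simp only [one_smul, zero_smul, add_zero] at h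
  rw [← enorm_neg, neg_sub, ← h, intervalIntegral.integral_of_le zero_le_one]
  refine (enorm_integral_le_lintegral_enorm _).trans ?_
  exact lintegral_mono fun r => ContinuousLinearMap.le_opENorm _ _

lemma diff_L1 (u : SchwartzMap (ℝ × V2) ℂ) : ∃ C : ℝ≥0∞, C < ⊤ ∧ ∀ h : V2,
    ∫⁻ z : ℝ × V2, ‖u z - u (z.1, z.2 + h)‖ₑ ≤ C * ENNReal.ofReal (min (‖h‖ ^ (1:ℝ)) 1) := by
  have hc : Continuous (fderiv ℝ u) := (u.smooth 1).continuous_fderiv (by norm_num)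
  refine ⟨2 * (∫⁻ z, ‖u z‖ₑ) + ∫⁻ z, ‖fderiv ℝ u z‖ₑ, ?_, ?_⟩
  · have h1 := u.integrable (μ := volume).2
    have h2 := (SchwartzMap.fderivCLM ℝ (ℝ × V2) ℂ u).integrable (μ := volume).2
    refine ENNReal.add_lt_top.2 ⟨ENNReal.mul_lt_top (by simp) h1, ?_⟩
    exact h2
  · intro h
    have e : ∀ z : ℝ × V2, (z.1, z.2 + h) = z + ((0:ℝ), h) := by intro z; ext <;> simp
    simp_rw [e]
    have b1 : ∫⁻ z : ℝ × V2, ‖u z - u (z + ((0:ℝ), h))‖ₑ ≤ 2 * ∫⁻ z, ‖u z‖ₑ := by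
      calc _ ≤ ∫⁻ z : ℝ × V2, (‖u z‖ₑ + ‖u (z + ((0:ℝ), h))‖ₑ) := lintegral_mono fun z => enorm_sub_le
        _ = _ := by
          rw [lintegral_add_left (by fun_prop), lintegral_add_right_eq_self (fun z => ‖u z‖ₑ), two_mul]
    have b2 : ∫⁻ z : ℝ × V2, ‖u z - u (z + ((0:ℝ), h))‖ₑ ≤ (∫⁻ z, ‖fderiv ℝ u z‖ₑ) * ENNReal.ofReal ‖h‖ := by
      calc _ ≤ ∫⁻ z : ℝ × V2, ∫⁻ r in Set.Ioc (0:ℝ) 1, ‖fderiv ℝ u (z + r • ((0:ℝ), h))‖ₑ * ‖((0:ℝ), h)‖ₑ :=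
            lintegral_mono fun z => diff_int u z _
        _ = ∫⁻ r in Set.Ioc (0:ℝ) 1, ∫⁻ z : ℝ × V2, ‖fderiv ℝ u (z + r • ((0:ℝ), h))‖ₑ * ‖((0:ℝ), h)‖ₑ := by
            rw [lintegral_lintegral_swap]
            exact ((show Continuous (fun z : (ℝ × V2) × ℝ => ‖fderiv ℝ u (z.1 + z.2 • ((0:ℝ), h))‖ₑ) by fun_prop).measurable.mul_const _).aemeasurable
        _ = ∫⁻ r in Set.Ioc (0:ℝ) 1, (∫⁻ z, ‖fderiv ℝ u z‖ₑ) * ENNReal.ofReal ‖h‖ := by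
            congr 1; ext r
            rw [lintegral_mul_const _ (Continuous.measurable (by fun_prop)), lintegral_add_right_eq_self (fun z => ‖fderiv ℝ u z‖ₑ)]
            congr 1
            rw [← ofReal_norm]; simp [Prod.norm_def]
        _ = _ := by simp
    rcases min_choice (‖h‖ ^ (1:ℝ)) 1 with h4 | h4 <;> rw [h4]
    · rw [Real.rpow_one]
      refine b2.trans ?_
      gcongr; exact le_add_self
    · rw [ENNReal.ofReal_one, mul_one]
      exact b1.trans le_self_add

lemma Es_int {s : ℝ} (hs : 0 < s) (hs1 : s < 1) (u : SchwartzMap (ℝ × V2) ℂ) :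
    Integrable (fun z : (ℝ × V2) × V2 => u z.1 - u (z.1.1, z.1.2 + z.2)) ((volume : Measure (ℝ × V2)).prod (nuS s)) := by
  have hc : Continuous (fun z : (ℝ × V2) × V2 => u z.1 - u (z.1.1, z.1.2 + z.2)) := by fun_prop
  refine ⟨hc.aestronglyMeasurable, ?_⟩
  unfold HasFiniteIntegral
  rw [lintegral_prod_symm _ hc.aestronglyMeasurable.enorm]
  obtain ⟨C, hC, h⟩ := diff_L1 u
  refine (lintegral_mono h).trans_lt ?_
  rw [lintegral_const_mul _ (by fun_prop)]
  exact ENNReal.mul_lt_top hC (nu_min hs hs1)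

lemma ftST_eq_ch (u : ℝ × V2 → ℂ) (q : ℝ × V2) : ftST u q.1 q.2 = ch u (-q) := by
  unfold ftST ch
  congr 1; ext p
  congr 2
  simp only [Prod.fst_neg, Prod.snd_neg, inner_neg_left, real_inner_comm p.2 q.2]
  push_cast; ring

lemma ftST_Es {s : ℝ} (hs : 0 < s) (hs1 : s < 1) (u : SchwartzMap (ℝ × V2) ℂ) (q : ℝ × V2) :
    ftST (Es s u) q.1 q.2 = cS s * (((‖q.2‖ ^ s : ℝ) : ℂ) * ftST u q.1 q.2) := by
  have hi := Es_int hs hs1 u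
  have hi' : Integrable (fun z : (ℝ × V2) × V2 => Complex.exp (-Complex.I * ((z.1.1 * q.1 + ⟪z.1.2, q.2⟫ : ℝ) : ℂ)) * (u z.1 - u (z.1.1, z.1.2 + z.2))) ((volume : Measure (ℝ × V2)).prod (nuS s)) := by
    refine hi.mono ((Continuous.aestronglyMeasurable (by fun_prop)).mul hi.1) ?_
    filter_upwards with z
    rw [norm_mul, neg_mul, ← mul_neg, ← Complex.ofReal_neg, norm_cexp_I_mul, one_mul]
  unfold Es
  conv_lhs => unfold ftST
  simp_rw [← integral_const_mul]
  rw [integral_integral_swap (f := fun (p : ℝ × V2) (h : V2) => Complex.exp (-Complex.I * ((p.1 * q.1 + ⟪p.2, q.2⟫ : ℝ) : ℂ)) * (u p - u (p.1, p.2 + h))) hi']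
  have key : ∀ h : V2, ∫ p : ℝ × V2, Complex.exp (-Complex.I * ((p.1 * q.1 + ⟪p.2, q.2⟫ : ℝ) : ℂ)) * (u p - u (p.1, p.2 + h))
      = e1 ⟪h, q.2⟫ * ftST u q.1 q.2 := by
    intro h
    have i1 : Integrable (fun p : ℝ × V2 => Complex.exp (-Complex.I * ((p.1 * q.1 + ⟪p.2, q.2⟫ : ℝ) : ℂ)) * u p) := by
      refine u.integrable.mono (Continuous.aestronglyMeasurable (by fun_prop)) ?_
      filter_upwards with z
      rw [norm_mul, neg_mul, ← mul_neg, ← Complex.ofReal_neg, norm_cexp_I_mul, one_mul]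
    have e2 : ∀ p : ℝ × V2, Complex.exp (-Complex.I * ((p.1 * q.1 + ⟪p.2, q.2⟫ : ℝ) : ℂ)) * u (p.1, p.2 + h) =
        (fun p : ℝ × V2 => Complex.exp (Complex.I * ((⟪h, q.2⟫ : ℝ) : ℂ)) * (Complex.exp (-Complex.I * ((p.1 * q.1 + ⟪p.2, q.2⟫ : ℝ) : ℂ)) * u p)) (p + ((0:ℝ), h)) := by
      intro p
      have e : p + ((0:ℝ), h) = (p.1, p.2 + h) := by ext <;> simp
      simp only [e]
      rw [← mul_assoc, ← Complex.exp_add]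
      congr 2
      rw [inner_add_left]; push_cast; ring
    have i2 : Integrable (fun p : ℝ × V2 => Complex.exp (-Complex.I * ((p.1 * q.1 + ⟪p.2, q.2⟫ : ℝ) : ℂ)) * u (p.1, p.2 + h)) := by
      simp_rw [e2]
      exact (i1.const_mul _).comp_add_right _
    simp_rw [mul_sub]
    rw [integral_sub i1 i2]
    simp_rw [e2]
    rw [integral_add_right_eq_self (fun p : ℝ × V2 => Complex.exp (Complex.I * ((⟪h, q.2⟫ : ℝ) : ℂ)) * (Complex.exp (-Complex.I * ((p.1 * q.1 + ⟪p.2, q.2⟫ : ℝ) : ℂ)) * u p)), integral_const_mul, e1, ftST]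
    ring
  simp_rw [key]
  rw [integral_mul_const, nu_e1_int hs]; ring

lemma planch_ft (v : ℝ × V2 → ℂ) (hv : Integrable v) :
    ∫⁻ q : ℝ × V2, ‖ftST v q.1 q.2‖ₑ ^ 2 ≤ ENNReal.ofReal cB3 * ∫⁻ p, ‖v p‖ₑ ^ 2 := by
  simp_rw [ftST_eq_ch]
  rw [lintegral_neg_eq_self (fun q => ‖ch v q‖ₑ ^ 2)]
  exact bessel3 v hv

lemma lowerE {s : ℝ} (hs : 0 < s) (hs1 : s < 1) (u : SchwartzMap (ℝ × V2) ℂ) :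
    ‖cS s‖ₑ ^ 2 * ∫⁻ q : ℝ × V2, (ENNReal.ofReal (‖q.2‖ ^ s) * ‖ftST u q.1 q.2‖ₑ) ^ 2 ≤ ENNReal.ofReal cB3 * ∫⁻ p, ‖Es s u p‖ₑ ^ 2 := by
  have h := planch_ft (Es s u) (Es_int hs hs1 u).integral_prod_left
  refine le_trans (le_of_eq ?_) h
  rw [← lintegral_const_mul' _ _ (by simp)]
  congr 1; ext q
  rw [ftST_Es hs hs1, enorm_mul, enorm_mul, ← mul_pow]
  congr 3
  rw [← ofReal_norm, Complex.norm_real, Real.norm_of_nonneg (by positivity)]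

def Gk (r : ℝ) (y : V2) : ℝ := (4 * π * r)⁻¹ * Real.exp (-(1 / (4 * r)) * ‖y‖ ^ 2)

@[fun_prop] lemma measurable_Gk : Measurable (fun z : ℝ × V2 => Gk z.1 z.2) := by unfold Gk; fun_prop
lemma continuous_Gk (r : ℝ) : Continuous (Gk r) := by unfold Gk; fun_prop

lemma Gk_nonneg {r : ℝ} (hr : 0 < r) (y : V2) : 0 ≤ Gk r y := by unfold Gk; positivity

lemma Gk_integrable {r : ℝ} (hr : 0 < r) : Integrable (Gk r) := by
  have := (gauss_int (W := V2) (b := 1 / (4 * r)) (by positivity)).re.const_mul (4 * π * r)⁻¹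
  exact this

lemma Gk_int {r : ℝ} (hr : 0 < r) : ∫ y, Gk r y = 1 := by
  unfold Gk
  rw [integral_const_mul, GaussianFourier.integral_rexp_neg_mul_sq_norm (by positivity)]
  simp
  field_simp

lemma Gk_ft {r : ℝ} (hr : 0 < r) (ξ : V2) :
    ∫ y, ((Gk r y : ℝ) : ℂ) * Complex.exp (Complex.I * ((⟪ξ, y⟫ : ℝ) : ℂ)) = ((Real.exp (-(‖ξ‖ ^ 2 * r)) : ℝ) : ℂ) := by
  unfold Gk
  simp_rw [Complex.ofReal_mul, mul_assoc]
  rw [integral_const_mul, gauss_ft (by positivity), ← Complex.ofReal_mul]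
  congr 1
  have : (-‖ξ‖ ^ 2 / (4 * (1 / (4 * r)))) = -(‖ξ‖ ^ 2 * r) := by field_simp
  rw [this]
  simp
  field_simp

def Ak (r : ℝ) (y : V2) : ℝ := √((4 * π * r)⁻¹) * Real.exp (-(1 / (8 * r)) * ‖y‖ ^ 2)

lemma Ak_sq {r : ℝ} (hr : 0 < r) (y : V2) : Ak r y * Ak r y = Gk r y := by
  unfold Ak Gk
  rw [mul_mul_mul_comm, Real.mul_self_sqrt (by positivity), ← Real.exp_add]
  congr 2; field_simp; ring

lemma Ak_cross {r : ℝ} (hr : 0 < r) (y h : V2) :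
    Ak r y * Ak r (y - h) = Real.exp (-(‖h‖ ^ 2 / (16 * r))) * Gk r (y - (1/2:ℝ) • h) := by
  unfold Ak Gk
  rw [mul_mul_mul_comm, Real.mul_self_sqrt (by positivity), ← Real.exp_add, mul_left_comm, ← Real.exp_add]
  congr 2
  have h1 : ‖y - h‖ ^ 2 = ‖y‖ ^ 2 - 2 * ⟪y, h⟫ + ‖h‖ ^ 2 := norm_sub_sq_real y h
  have h2 : ‖y - (1/2:ℝ) • h‖ ^ 2 = ‖y‖ ^ 2 - ⟪y, h⟫ + ‖h‖ ^ 2 / 4 := by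
    rw [norm_sub_sq_real, inner_smul_right, norm_smul, mul_pow]; norm_num; ring
  rw [h1, h2]; field_simp; ring

lemma Gk_diff2 {r : ℝ} (hr : 0 < r) (h : V2) : ∫⁻ y, ‖Gk r y - Gk r (y - h)‖ₑ ≤ 2 := by
  have hl : ∫⁻ y, ‖Gk r y‖ₑ = 1 := by
    simp_rw [fun y => Real.enorm_of_nonneg (Gk_nonneg hr y)]
    rw [← ofReal_integral_eq_lintegral_ofReal (Gk_integrable hr) (Filter.Eventually.of_forall (Gk_nonneg hr)), Gk_int hr]; simp
  have hc := continuous_Gk r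
  calc _ ≤ ∫⁻ y, (‖Gk r y‖ₑ + ‖Gk r (y - h)‖ₑ) := lintegral_mono fun z => enorm_sub_le
    _ = _ := by
      rw [lintegral_add_left (by fun_prop), lintegral_sub_right_eq_self (fun z => ‖Gk r z‖ₑ), hl]; norm_num

lemma Gk_diff1 {r : ℝ} (hr : 0 < r) (h : V2) :
    ∫⁻ y, ‖Gk r y - Gk r (y - h)‖ₑ ≤ ENNReal.ofReal (‖h‖ * r ^ (-(1/2) : ℝ)) := by
  have hA : Continuous (Ak r) := by unfold Ak; fun_prop
  have hi0 := Gk_integrable hr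
  have hi1 := hi0.comp_sub_right h
  have hi2 := hi0.comp_sub_right ((1/2:ℝ) • h)
  set E := Real.exp (-(‖h‖ ^ 2 / (16 * r))) with hE
  have hE1 : 1 - ‖h‖ ^ 2 / (16 * r) ≤ E := by
    have := Real.add_one_le_exp (-(‖h‖ ^ 2 / (16 * r))); rw [hE]; linarith
  have hE2 : E ≤ 1 := by rw [hE]; apply Real.exp_le_one_iff.2; simp; positivity
  have sq1 : ∀ σ : ℝ, ∫⁻ y, ‖Ak r y + σ * Ak r (y - h)‖ₑ ^ 2 = ENNReal.ofReal (1 + σ ^ 2 + 2 * σ * E) := by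
    intro σ
    have e : ∀ y, (Ak r y + σ * Ak r (y - h)) ^ 2 = Gk r y + σ ^ 2 * Gk r (y - h) + 2 * σ * E * Gk r (y - (1/2:ℝ) • h) := by
      intro y
      have := Ak_cross hr y h
      have a1 := Ak_sq hr y
      have a2 := Ak_sq hr (y - h)
      rw [← a1, ← a2]
      rw [mul_assoc _ E, ← this]; ring
    have e' : ∀ y, ‖Ak r y + σ * Ak r (y - h)‖ₑ ^ 2 = ENNReal.ofReal ((Ak r y + σ * Ak r (y - h)) ^ 2) := by
      intro y
      rw [← ofReal_norm, ← ENNReal.ofReal_pow (norm_nonneg _), Real.norm_eq_abs, sq_abs]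
    have i3 : Integrable (fun y => (Ak r y + σ * Ak r (y - h)) ^ 2) := by
      simp_rw [e]; exact (hi0.add (hi1.const_mul _)).add (hi2.const_mul _)
    simp_rw [e']
    rw [← ofReal_integral_eq_lintegral_ofReal i3 (Filter.Eventually.of_forall fun y => sq_nonneg _)]
    congr 1
    simp_rw [e]
    rw [integral_add (f := fun y => Gk r y + σ ^ 2 * Gk r (y - h)) (hi0.add (hi1.const_mul _)) (hi2.const_mul _), integral_add hi0 (hi1.const_mul _), integral_const_mul, integral_const_mul,
      integral_sub_right_eq_self (Gk r), integral_sub_right_eq_self (Gk r), Gk_int hr]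
    ring
  have cs := cs_lint (μ := (volume : Measure V2)) (f := fun y => ‖Ak r y + (-1) * Ak r (y - h)‖ₑ) (g := fun y => ‖Ak r y + 1 * Ak r (y - h)‖ₑ)
    (by fun_prop) (by fun_prop)
  rw [sq1, sq1] at cs
  have e4 : ∀ y, ‖Ak r y + (-1) * Ak r (y - h)‖ₑ * ‖Ak r y + 1 * Ak r (y - h)‖ₑ = ‖Gk r y - Gk r (y - h)‖ₑ := by
    intro y; rw [← enorm_mul, ← Ak_sq hr, ← Ak_sq hr]; congr 1; ring
  simp_rw [e4] at cs
  rw [← ENNReal.pow_le_pow_left_iff (n := 2) (by norm_num)]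
  refine cs.trans ?_
  rw [← ENNReal.ofReal_pow (by positivity), ← ENNReal.ofReal_mul (by nlinarith)]
  apply ENNReal.ofReal_le_ofReal
  rw [mul_pow, ← Real.rpow_natCast (r ^ (-(1/2) : ℝ)), ← Real.rpow_mul hr.le]
  norm_num
  rw [Real.rpow_neg_one]
  have : ‖h‖ ^ 2 / (16 * r) = ‖h‖ ^ 2 * r⁻¹ / 16 := by field_simp
  rw [this] at hE1
  have hp : 0 ≤ ‖h‖ ^ 2 * r⁻¹ := by positivity
  nlinarith

def Kk (s : ℝ) (h y : V2) : ℝ≥0∞ := ∫⁻ r in Set.Ioi (0:ℝ), ENNReal.ofReal (r ^ (s / 2 - 1)) * ‖Gk r y - Gk r (y - h)‖ₑ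

lemma measurable_GG (s : ℝ) (h : V2) : Measurable (fun z : V2 × ℝ => ENNReal.ofReal (z.2 ^ (s / 2 - 1)) * ‖Gk z.2 z.1 - Gk z.2 (z.1 - h)‖ₑ) := by
  have h1 : Measurable (fun z : V2 × ℝ => Gk z.2 z.1) := measurable_Gk.comp (f := fun z : V2 × ℝ => (z.2, z.1)) (by fun_prop)
  have h2 : Measurable (fun z : V2 × ℝ => Gk z.2 (z.1 - h)) := measurable_Gk.comp (f := fun z : V2 × ℝ => (z.2, z.1 - h)) (by fun_prop)
  fun_prop

lemma measurable_Kk (s : ℝ) (h : V2) : Measurable (Kk s h) := (measurable_GG s h).lintegral_prod_right'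

lemma Kk_int {s : ℝ} (hs : 0 < s) (hs1 : s < 1) (h : V2) :
    ∫⁻ y, Kk s h y ≤ ENNReal.ofReal (4 / s + 2 / (1 - s)) * ENNReal.ofReal (‖h‖ ^ s) := by
  by_cases hh : h = 0
  · simp [hh, Kk]
  have H : 0 < ‖h‖ := norm_pos_iff.2 hh
  unfold Kk
  rw [lintegral_lintegral_swap (measurable_GG s h).aemeasurable]
  have hcr : ∀ r : ℝ, ∫⁻ y, ENNReal.ofReal (r ^ (s / 2 - 1)) * ‖Gk r y - Gk r (y - h)‖ₑ = ENNReal.ofReal (r ^ (s / 2 - 1)) * ∫⁻ y, ‖Gk r y - Gk r (y - h)‖ₑ := by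
    intro r
    have := continuous_Gk r
    rw [lintegral_const_mul _ (by fun_prop)]
  simp_rw [hcr]
  rw [← Set.Ioc_union_Ioi_eq_Ioi (show (0:ℝ) ≤ ‖h‖ ^ 2 by positivity)]
  refine (lintegral_union_le _ _ _).trans ?_
  have p1 : ∫⁻ r in Set.Ioc (0:ℝ) (‖h‖ ^ 2), ENNReal.ofReal (r ^ (s / 2 - 1)) * ∫⁻ y, ‖Gk r y - Gk r (y - h)‖ₑ ≤ ENNReal.ofReal (4 / s * ‖h‖ ^ s) := by
    calc _ ≤ ∫⁻ r in Set.Ioc (0:ℝ) (‖h‖ ^ 2), ENNReal.ofReal (2 * r ^ (s / 2 - 1)) := by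
          apply setLIntegral_mono (by fun_prop)
          intro r hr
          rw [mul_comm (2:ℝ), ENNReal.ofReal_mul (Real.rpow_nonneg hr.1.le _)]
          gcongr
          simpa using Gk_diff2 hr.1 h
      _ = _ := by
        rw [← ofReal_integral_eq_lintegral_ofReal]
        · rw [← intervalIntegral.integral_of_le (by positivity), intervalIntegral.integral_const_mul, integral_rpow (Or.inl (by linarith))]
          congr 1
          rw [← Real.rpow_natCast, ← Real.rpow_mul H.le, Real.zero_rpow (by linarith)]
          rw [show ((2:ℕ):ℝ) * (s / 2 - 1 + 1) = s by push_cast; ring, show s / 2 - 1 + 1 = s / 2 by ring]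
          field_simp; ring
        · exact ((intervalIntegrable_iff_integrableOn_Ioc_of_le (by positivity)).1 (intervalIntegral.intervalIntegrable_rpow' (by linarith))).const_mul _
        · filter_upwards [ae_restrict_mem measurableSet_Ioc] with r hr
          have := hr.1
          simp; positivity
  have p2 : ∫⁻ r in Set.Ioi (‖h‖ ^ 2), ENNReal.ofReal (r ^ (s / 2 - 1)) * ∫⁻ y, ‖Gk r y - Gk r (y - h)‖ₑ ≤ ENNReal.ofReal (2 / (1 - s) * ‖h‖ ^ s) := by
    calc _ ≤ ∫⁻ r in Set.Ioi (‖h‖ ^ 2), ENNReal.ofReal (‖h‖ * r ^ (s / 2 - 3 / 2)) := by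
          apply setLIntegral_mono (by fun_prop)
          intro r hr
          have hr0 : 0 < r := lt_trans (by positivity) hr
          rw [show s / 2 - 3 / 2 = s / 2 - 1 + (-(1/2)) by ring, Real.rpow_add hr0, mul_left_comm, ENNReal.ofReal_mul (by positivity)]
          gcongr
          exact Gk_diff1 hr0 h
      _ = _ := by
        rw [← ofReal_integral_eq_lintegral_ofReal]
        · rw [integral_const_mul, integral_Ioi_rpow_of_lt (by linarith) (by positivity)]
          congr 1
          rw [← Real.rpow_natCast, ← Real.rpow_mul H.le]
          rw [show ((2:ℕ):ℝ) * (s / 2 - 3 / 2 + 1) = s - 1 by push_cast; ring, Real.rpow_sub_one H.ne']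
          have : (1 - s) ≠ 0 := by linarith
          rw [show s / 2 - 3 / 2 + 1 = -((1 - s) / 2) by ring]
          field_simp
        · exact (integrableOn_Ioi_rpow_of_lt (by linarith) (by positivity)).const_mul _
        · filter_upwards [ae_restrict_mem measurableSet_Ioi] with r hr
          have hr0 : 0 < r := lt_trans (by positivity) hr
          simp; positivity
  refine (add_le_add p1 p2).trans ?_
  have : 0 < 1 - s := by linarith
  rw [← ENNReal.ofReal_add (by positivity) (by positivity), ← ENNReal.ofReal_mul (by positivity)]
  apply le_of_eq; congr 1; ring

lemma young {q : ℝ} (hq : 1 < q) {K f : V2 → ℝ≥0∞} (hK : Measurable K) (hf : Measurable f) :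
    ∫⁻ x, (∫⁻ y, K y * f (x + y)) ^ q ≤ (∫⁻ y, K y) ^ q * ∫⁻ x, f x ^ q := by
  have hq0 : 0 < q := by linarith
  have h1 : ∀ x, (∫⁻ y, K y * f (x + y)) ^ q ≤ (∫⁻ y, K y) ^ (q - 1) * ∫⁻ y, K y * f (x + y) ^ q := by
    intro x
    have h := ENNReal.lintegral_mul_norm_pow_le (μ := (volume : Measure V2)) (f := K) (g := fun y => K y * f (x + y) ^ q) (p := 1 - 1/q) (q := 1/q)
      hK.aemeasurable (by fun_prop) (by rw [sub_nonneg, div_le_one hq0]; exact hq.le) (by positivity) (by ring)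
    have e : ∀ y, K y ^ (1 - 1/q) * (K y * f (x + y) ^ q) ^ (1/q) = K y * f (x + y) := by
      intro y
      rw [ENNReal.mul_rpow_of_nonneg _ _ (by positivity), ← ENNReal.rpow_mul, mul_one_div_cancel hq0.ne', ENNReal.rpow_one, ← mul_assoc,
        ← ENNReal.rpow_add_of_nonneg _ _ (by rw [sub_nonneg, div_le_one hq0]; exact hq.le) (by positivity)]
      simp
    simp_rw [e] at h
    calc _ ≤ ((∫⁻ y, K y) ^ (1 - 1/q) * (∫⁻ y, K y * f (x + y) ^ q) ^ (1/q)) ^ q := by gcongr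
      _ = _ := by
        rw [ENNReal.mul_rpow_of_nonneg _ _ hq0.le, ← ENNReal.rpow_mul, ← ENNReal.rpow_mul, one_div_mul_cancel hq0.ne', ENNReal.rpow_one]
        congr 2; field_simp
  calc _ ≤ ∫⁻ x, (∫⁻ y, K y) ^ (q - 1) * ∫⁻ y, K y * f (x + y) ^ q := lintegral_mono h1
    _ = (∫⁻ y, K y) ^ (q - 1) * ∫⁻ x, ∫⁻ y, K y * f (x + y) ^ q := by
      rw [lintegral_const_mul _ (Measurable.lintegral_prod_right' (f := fun z : V2 × V2 => K z.2 * f (z.1 + z.2) ^ q) (by fun_prop))]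
    _ = (∫⁻ y, K y) ^ (q - 1) * ∫⁻ y, K y * ∫⁻ x, f x ^ q := by
      rw [lintegral_lintegral_swap (by unfold Function.uncurry; fun_prop)]
      congr 2; ext y
      rw [lintegral_const_mul _ (by fun_prop), lintegral_add_right_eq_self (fun x => f x ^ q)]
    _ = _ := by
      rw [lintegral_mul_const _ hK, ← mul_assoc]
      congr 1
      nth_rw 2 [← ENNReal.rpow_one (∫⁻ y, K y)]
      rw [← ENNReal.rpow_add_of_nonneg _ _ (by linarith) (by norm_num)]
      congr 1; ring

lemma Gk_ft2 {r : ℝ} (hr : 0 < r) (h ξ : V2) :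
    ∫ y, ((Gk r y - Gk r (y - h) : ℝ) : ℂ) * Complex.exp (Complex.I * ((⟪ξ, y⟫ : ℝ) : ℂ)) = e1 ⟪h, ξ⟫ * ((Real.exp (-(‖ξ‖ ^ 2 * r)) : ℝ) : ℂ) := by
  have i0 : Integrable (fun y => ((Gk r y : ℝ) : ℂ) * Complex.exp (Complex.I * ((⟪ξ, y⟫ : ℝ) : ℂ))) := by
    have hc := continuous_Gk r
    refine (Gk_integrable hr).mono (Continuous.aestronglyMeasurable (by fun_prop)) ?_
    filter_upwards with y; rw [norm_mul, norm_cexp_I_mul, mul_one, Complex.norm_real]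
  have e : ∀ y, ((Gk r (y - h) : ℝ) : ℂ) * Complex.exp (Complex.I * ((⟪ξ, y⟫ : ℝ) : ℂ)) =
      (fun y => Complex.exp (Complex.I * ((⟪h, ξ⟫ : ℝ) : ℂ)) * (((Gk r y : ℝ) : ℂ) * Complex.exp (Complex.I * ((⟪ξ, y⟫ : ℝ) : ℂ)))) (y - h) := by
    intro y
    simp only
    rw [mul_left_comm, ← Complex.exp_add, ← mul_add, ← Complex.ofReal_add, real_inner_comm ξ h, ← inner_add_right]
    simp
  have i1 := (i0.const_mul (Complex.exp (Complex.I * ((⟪h, ξ⟫ : ℝ) : ℂ)))).comp_sub_right h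
  simp_rw [Complex.ofReal_sub, sub_mul, e]
  rw [integral_sub i0 i1, integral_sub_right_eq_self (fun y => Complex.exp (Complex.I * ((⟪h, ξ⟫ : ℝ) : ℂ)) * (((Gk r y : ℝ) : ℂ) * Complex.exp (Complex.I * ((⟪ξ, y⟫ : ℝ) : ℂ)))),
    integral_const_mul, Gk_ft hr, e1]
  ring

def F2 (B : V2 → ℂ) (x : V2) : ℂ := ∫ ξ, Complex.exp (Complex.I * ((⟪x, ξ⟫ : ℝ) : ℂ)) * B ξ

lemma heat_diff {r : ℝ} (hr : 0 < r) {B : V2 → ℂ} (hB : Integrable B) (h x : V2) :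
    ‖∫ ξ, Complex.exp (Complex.I * ((⟪x, ξ⟫ : ℝ) : ℂ)) * (e1 ⟪h, ξ⟫ * ((Real.exp (-(‖ξ‖ ^ 2 * r)) : ℝ) : ℂ) * B ξ)‖ₑ ≤
      ∫⁻ y, ‖Gk r y - Gk r (y - h)‖ₑ * ‖F2 B (x + y)‖ₑ := by
  have hκ : Integrable (fun y => ((Gk r y - Gk r (y - h) : ℝ) : ℂ)) :=
    ((Gk_integrable hr).sub ((Gk_integrable hr).comp_sub_right h)).ofReal
  have hH : Integrable (fun z : V2 × V2 => ((Gk r z.1 - Gk r (z.1 - h) : ℝ) : ℂ) * (Complex.exp (Complex.I * ((⟪x + z.1, z.2⟫ : ℝ) : ℂ)) * B z.2)) (volume.prod volume) := by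
    have h0 := hκ.mul_prod hB
    have hc := continuous_Gk r
    refine h0.mono ((Continuous.aestronglyMeasurable (by fun_prop)).mul ((Continuous.aestronglyMeasurable (by fun_prop)).mul hB.1.comp_snd)) ?_
    filter_upwards with z
    simp only [norm_mul, norm_cexp_I_mul, one_mul]; rfl
  have key : ∫ ξ, Complex.exp (Complex.I * ((⟪x, ξ⟫ : ℝ) : ℂ)) * (e1 ⟪h, ξ⟫ * ((Real.exp (-(‖ξ‖ ^ 2 * r)) : ℝ) : ℂ) * B ξ)
      = ∫ y, ((Gk r y - Gk r (y - h) : ℝ) : ℂ) * F2 B (x + y) := by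
    unfold F2
    simp_rw [← integral_const_mul]
    rw [integral_integral_swap (f := fun y ξ => ((Gk r y - Gk r (y - h) : ℝ) : ℂ) * (Complex.exp (Complex.I * ((⟪x + y, ξ⟫ : ℝ) : ℂ)) * B ξ)) hH]
    congr 1; ext ξ
    rw [← Gk_ft2 hr h ξ, ← integral_mul_const, ← integral_const_mul]
    congr 1; ext y
    rw [inner_add_left, real_inner_comm y ξ, Complex.ofReal_add, mul_add, Complex.exp_add]; ring
  rw [key]
  refine (enorm_integral_le_lintegral_enorm _).trans ?_
  refine lintegral_mono fun y => ?_
  simp only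
  rw [enorm_mul]
  apply le_of_eq; congr 1
  rw [← ofReal_norm, ← ofReal_norm, Complex.norm_real]

lemma repr_diff {s : ℝ} (hs : 0 < s) {b : V2 → ℂ} (hb : Integrable b)
    (hB : Integrable (fun ξ => ((‖ξ‖ ^ s : ℝ) : ℂ) * b ξ)) (h x : V2) :
    ENNReal.ofReal (Real.Gamma (s / 2)) * ‖F2 b x - F2 b (x + h)‖ₑ ≤
      ∫⁻ y, Kk s h y * ‖F2 (fun ξ => ((‖ξ‖ ^ s : ℝ) : ℂ) * b ξ) (x + y)‖ₑ := by
  set B : V2 → ℂ := (fun ξ => ((‖ξ‖ ^ s : ℝ) : ℂ) * b ξ) with hBdef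
  have hΓ : 0 < Real.Gamma (s / 2) := Real.Gamma_pos_of_pos (by linarith)
  have hx : ∀ x' : V2, Integrable (fun y => Complex.exp (Complex.I * ((⟪x', y⟫ : ℝ) : ℂ)) * b y) := by
    intro x'
    refine hb.mono ((Measurable.aestronglyMeasurable (by fun_prop)).mul hb.1) ?_
    filter_upwards with y; rw [norm_mul, norm_cexp_I_mul, one_mul]
  have e0 : F2 b x - F2 b (x + h) = ∫ ξ, Complex.exp (Complex.I * ((⟪x, ξ⟫ : ℝ) : ℂ)) * (e1 ⟪h, ξ⟫ * b ξ) := by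
    unfold F2
    rw [← integral_sub (hx _) (hx _)]
    congr 1; ext y
    simp only [e1]
    rw [inner_add_left, Complex.ofReal_add, mul_add, Complex.exp_add]; ring
  let H : ℝ × V2 → ℂ := fun z => ((z.1 ^ (s / 2 - 1) : ℝ) : ℂ) * (Complex.exp (Complex.I * ((⟪x, z.2⟫ : ℝ) : ℂ)) * (e1 ⟪h, z.2⟫ * ((Real.exp (-(‖z.2‖ ^ 2 * z.1)) : ℝ) : ℂ) * B z.2))
  have hae : ∀ᵐ ξ : V2, ξ ≠ 0 := by simp [ae_iff]
  have hgam : ∀ ξ : V2, ξ ≠ 0 → ∫ r in Set.Ioi (0:ℝ), r ^ (s / 2 - 1) * Real.exp (-(‖ξ‖ ^ 2 * r)) = Real.Gamma (s / 2) * (‖ξ‖ ^ s)⁻¹ := by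
    intro ξ hξ
    have hn : 0 < ‖ξ‖ := norm_pos_iff.2 hξ
    rw [Real.integral_rpow_mul_exp_neg_mul_Ioi (by linarith) (by positivity), mul_comm]
    congr 1
    rw [one_div, Real.inv_rpow (by positivity), ← Real.rpow_natCast, ← Real.rpow_mul hn.le]
    congr 2; push_cast; ring
  have hgi : ∀ ξ : V2, ξ ≠ 0 → IntegrableOn (fun r : ℝ => r ^ (s / 2 - 1) * Real.exp (-(‖ξ‖ ^ 2 * r))) (Set.Ioi 0) := by
    intro ξ hξ
    have hn : 0 < ‖ξ‖ := norm_pos_iff.2 hξ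
    by_contra hc
    have := hgam ξ hξ
    rw [integral_undef hc] at this
    have : 0 < Real.Gamma (s / 2) * (‖ξ‖ ^ s)⁻¹ := by positivity
    linarith
  have hBm : AEStronglyMeasurable B volume := hB.1
  have hHm : AEStronglyMeasurable H ((volume.restrict (Set.Ioi 0)).prod volume) := by
    have m1 : Measurable (fun z : ℝ × V2 => ((z.1 ^ (s / 2 - 1) : ℝ) : ℂ)) := by fun_prop
    have m2 : Measurable (fun z : ℝ × V2 => Complex.exp (Complex.I * ((⟪x, z.2⟫ : ℝ) : ℂ))) := by fun_prop
    have m3 : Measurable (fun z : ℝ × V2 => e1 ⟪h, z.2⟫ * ((Real.exp (-(‖z.2‖ ^ 2 * z.1)) : ℝ) : ℂ)) := by fun_prop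
    exact m1.aestronglyMeasurable.mul (m2.aestronglyMeasurable.mul (m3.aestronglyMeasurable.mul hBm.comp_snd))
  have hH : Integrable H ((volume.restrict (Set.Ioi 0)).prod volume) := by
    refine ⟨hHm, ?_⟩
    unfold HasFiniteIntegral
    rw [lintegral_prod_symm _ hHm.enorm]
    have e : ∀ᵐ ξ : V2, ∫⁻ r in Set.Ioi (0:ℝ), ‖H (r, ξ)‖ₑ ≤ ENNReal.ofReal (2 * Real.Gamma (s / 2)) * ‖b ξ‖ₑ := by
      filter_upwards [hae] with ξ hξ
      have hn : 0 < ‖ξ‖ := norm_pos_iff.2 hξ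
      have e2 : ∀ r ∈ Set.Ioi (0:ℝ), ‖H (r, ξ)‖ₑ = ENNReal.ofReal (r ^ (s / 2 - 1) * Real.exp (-(‖ξ‖ ^ 2 * r))) * ‖e1 ⟪h, ξ⟫ * B ξ‖ₑ := by
        intro r hr
        have hr : 0 < r := hr
        rw [← ofReal_norm, ← ofReal_norm, ← ENNReal.ofReal_mul (by positivity)]
        congr 1
        simp only [H, norm_mul, norm_cexp_I_mul, one_mul, Complex.norm_real]
        rw [Real.norm_of_nonneg (by positivity : 0 ≤ r ^ (s / 2 - 1)), Real.norm_of_nonneg (Real.exp_pos _).le]; ring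
      rw [setLIntegral_congr_fun measurableSet_Ioi e2, lintegral_mul_const _ (by fun_prop), ← ofReal_integral_eq_lintegral_ofReal (hgi ξ hξ), hgam ξ hξ,
        ← ofReal_norm, ← ofReal_norm, ← ENNReal.ofReal_mul (by positivity), ← ENNReal.ofReal_mul (by positivity)]
      · apply ENNReal.ofReal_le_ofReal
        rw [norm_mul, hBdef]
        simp only
        rw [norm_mul, Complex.norm_real, Real.norm_of_nonneg (by positivity)]
        have := norm_e1_le2 ⟪h, ξ⟫
        have h5 : (‖ξ‖ ^ s)⁻¹ * ‖ξ‖ ^ s = 1 := inv_mul_cancel₀ (by positivity)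
        calc Real.Gamma (s / 2) * (‖ξ‖ ^ s)⁻¹ * (‖e1 ⟪h, ξ⟫‖ * (‖ξ‖ ^ s * ‖b ξ‖)) = ((‖ξ‖ ^ s)⁻¹ * ‖ξ‖ ^ s) * (‖e1 ⟪h, ξ⟫‖ * (Real.Gamma (s / 2) * ‖b ξ‖)) := by ring
          _ ≤ 1 * (2 * (Real.Gamma (s / 2) * ‖b ξ‖)) := by rw [h5]; gcongr
          _ = _ := by ring
      · filter_upwards [ae_restrict_mem measurableSet_Ioi] with r hr
        have hr : 0 < r := hr
        simp only [Pi.zero_apply]; positivity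
    refine (lintegral_mono_ae e).trans_lt ?_
    rw [lintegral_const_mul'' _ hb.1.enorm]
    exact ENNReal.mul_lt_top ENNReal.ofReal_lt_top hb.2
  have e3 : ((Real.Gamma (s / 2) : ℝ) : ℂ) * (F2 b x - F2 b (x + h)) = ∫ r in Set.Ioi (0:ℝ), ∫ ξ, H (r, ξ) := by
    rw [integral_integral_swap (f := fun r ξ => H (r, ξ)) hH, e0, ← integral_const_mul]
    apply integral_congr_ae
    filter_upwards [hae] with ξ hξ
    have hn : 0 < ‖ξ‖ := norm_pos_iff.2 hξ
    have e4 : ∀ r, H (r, ξ) = ((r ^ (s / 2 - 1) * Real.exp (-(‖ξ‖ ^ 2 * r)) : ℝ) : ℂ) * (Complex.exp (Complex.I * ((⟪x, ξ⟫ : ℝ) : ℂ)) * (e1 ⟪h, ξ⟫ * B ξ)) := by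
      intro r; simp only [H]; rw [Complex.ofReal_mul]; ring
    simp_rw [e4]
    rw [integral_mul_const, integral_complex_ofReal, hgam ξ hξ, hBdef]
    simp only
    have h5 : (((‖ξ‖ ^ s)⁻¹ : ℝ) : ℂ) * ((‖ξ‖ ^ s : ℝ) : ℂ) = 1 := by
      rw [← Complex.ofReal_mul, inv_mul_cancel₀ (by positivity)]; simp
    rw [Complex.ofReal_mul]
    linear_combination (-(Real.Gamma (s / 2) : ℂ) * Complex.exp (Complex.I * ((⟪x, ξ⟫ : ℝ) : ℂ)) * e1 ⟪h, ξ⟫ * b ξ) * h5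
  have e5 : ENNReal.ofReal (Real.Gamma (s / 2)) * ‖F2 b x - F2 b (x + h)‖ₑ = ‖((Real.Gamma (s / 2) : ℝ) : ℂ) * (F2 b x - F2 b (x + h))‖ₑ := by
    rw [enorm_mul, ← ofReal_norm (((Real.Gamma (s / 2) : ℝ) : ℂ)), Complex.norm_real, Real.norm_of_nonneg hΓ.le]
  have hF : Continuous (F2 B) := by
    unfold F2; exact continuous_ch0 B hB
  rw [e5, e3]
  calc _ ≤ ∫⁻ r in Set.Ioi (0:ℝ), ‖∫ ξ, H (r, ξ)‖ₑ := enorm_integral_le_lintegral_enorm _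
    _ ≤ ∫⁻ r in Set.Ioi (0:ℝ), ∫⁻ y, ENNReal.ofReal (r ^ (s / 2 - 1)) * ‖Gk r y - Gk r (y - h)‖ₑ * ‖F2 B (x + y)‖ₑ := by
      apply setLIntegral_mono_ae' measurableSet_Ioi
      filter_upwards with r hr
      have hr : 0 < r := hr
      simp only [H]
      have hc := continuous_Gk r
      rw [integral_const_mul, enorm_mul]
      simp_rw [mul_assoc (ENNReal.ofReal (r ^ (s / 2 - 1)))]
      rw [lintegral_const_mul _ (by fun_prop)]
      refine mul_le_mul' (le_of_eq ?_) (heat_diff hr hB h x)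
      rw [← ofReal_norm, Complex.norm_real, Real.norm_of_nonneg (by positivity)]
    _ = ∫⁻ y, ∫⁻ r in Set.Ioi (0:ℝ), ENNReal.ofReal (r ^ (s / 2 - 1)) * ‖Gk r y - Gk r (y - h)‖ₑ * ‖F2 B (x + y)‖ₑ := by
      rw [lintegral_lintegral_swap]
      have := (measurable_GG s h).comp (measurable_swap (α := ℝ) (β := V2))
      have h2 : Measurable (fun z : ℝ × V2 => ‖F2 B (x + z.2)‖ₑ) := (show Continuous (fun z : ℝ × V2 => F2 B (x + z.2)) by fun_prop).measurable.enorm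
      exact (this.mul h2).aemeasurable
    _ = _ := by
      congr 1; ext y
      rw [lintegral_mul_const _ (show Measurable (fun r:ℝ => ENNReal.ofReal (r^(s/2-1)) * ‖Gk r y - Gk r (y-h)‖ₑ) from (measurable_GG s h).comp (measurable_prodMk_left (x := y)))]; rfl

theorem holder_lem {s : ℝ} (hs : 0 < s) (hs1 : s < 1) {q : ℝ} (hq : 1 < q) : ∃ C : ℝ≥0∞, C ≠ ⊤ ∧ ∀ (A : SchwartzMap (ℝ × V2) ℂ) (t : ℝ) (h : V2),
    ∫⁻ x, ‖A (t, x) - A (t, x + h)‖ₑ ^ q ≤ (C * ENNReal.ofReal (‖h‖ ^ s)) ^ q * ∫⁻ x, ‖DxA s A (t, x)‖ₑ ^ q := by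
  have hΓ : 0 < Real.Gamma (s / 2) := Real.Gamma_pos_of_pos (by linarith)
  have hΓ0 : ENNReal.ofReal (Real.Gamma (s / 2)) ≠ 0 := by simpa using hΓ
  refine ⟨(ENNReal.ofReal (Real.Gamma (s / 2)))⁻¹ * ENNReal.ofReal (4 / s + 2 / (1 - s)), ENNReal.mul_ne_top (by simpa using hΓ) (by simp), ?_⟩
  intro A t h
  obtain ⟨a, ha⟩ := slice A t
  obtain ⟨b, hb1, hb2⟩ := inv2 a
  have hbs := schw_pow_int volume b (N := fun e => ‖e‖) (by fun_prop) (fun _ => norm_nonneg _) (fun _ => le_rfl) hs.le hs1.le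
  set B : V2 → ℂ := (fun ξ => ((‖ξ‖ ^ s : ℝ) : ℂ) * b ξ) with hBdef
  have hF : Continuous (F2 B) := by
    unfold F2; exact continuous_ch0 B hbs
  set c : ℂ := ((((2 * π) ^ 2)⁻¹ : ℝ) : ℂ) with hc
  have eD : ∀ x, DxA s A (t, x) = c * F2 B x := by
    intro x
    rw [DxA, ift2]
    have e3 : (fun y => A (t, y)) = a := by ext y; rw [ha]
    simp only [e3]
    simp_rw [← hb1]; rfl
  have eA : ∀ x, A (t, x) = c * F2 b x := by
    intro x; rw [← ha, hb2, ift2]; rfl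
  have pw : ∀ x, ‖A (t, x) - A (t, x + h)‖ₑ ≤ (ENNReal.ofReal (Real.Gamma (s / 2)))⁻¹ * ∫⁻ y, Kk s h y * ‖DxA s A (t, x + y)‖ₑ := by
    intro x
    have h1 := repr_diff hs b.integrable hbs h x
    have e7 : ∀ y, Kk s h y * ‖DxA s A (t, x + y)‖ₑ = ‖c‖ₑ * (Kk s h y * ‖F2 B (x + y)‖ₑ) := by
      intro y; rw [eD, enorm_mul]; ring
    simp_rw [e7]
    rw [lintegral_const_mul' _ _ enorm_ne_top, eA, eA, ← mul_sub, enorm_mul]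
    calc _ = ‖c‖ₑ * ((ENNReal.ofReal (Real.Gamma (s / 2)))⁻¹ * (ENNReal.ofReal (Real.Gamma (s / 2)) * ‖F2 b x - F2 b (x + h)‖ₑ)) := by
          rw [← mul_assoc _ _ ‖F2 b x - F2 b (x + h)‖ₑ, ENNReal.inv_mul_cancel hΓ0 ENNReal.ofReal_ne_top, one_mul]
      _ ≤ ‖c‖ₑ * ((ENNReal.ofReal (Real.Gamma (s / 2)))⁻¹ * ∫⁻ y, Kk s h y * ‖F2 B (x + y)‖ₑ) := by gcongr
      _ = _ := by ring
  have hm : Measurable (fun x => DxA s A (t, x)) := by simp_rw [eD]; fun_prop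
  calc _ ≤ ∫⁻ x, ((ENNReal.ofReal (Real.Gamma (s / 2)))⁻¹ * ∫⁻ y, Kk s h y * ‖DxA s A (t, x + y)‖ₑ) ^ q :=
        lintegral_mono fun x => ENNReal.rpow_le_rpow (pw x) (by linarith)
    _ = (ENNReal.ofReal (Real.Gamma (s / 2)))⁻¹ ^ q * ∫⁻ x, (∫⁻ y, Kk s h y * ‖DxA s A (t, x + y)‖ₑ) ^ q := by
      simp_rw [ENNReal.mul_rpow_of_nonneg _ _ (show 0 ≤ q by linarith)]
      rw [lintegral_const_mul']
      exact ENNReal.rpow_ne_top_of_nonneg (by linarith) (by simpa using hΓ)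
    _ ≤ (ENNReal.ofReal (Real.Gamma (s / 2)))⁻¹ ^ q * ((ENNReal.ofReal (4 / s + 2 / (1 - s)) * ENNReal.ofReal (‖h‖ ^ s)) ^ q * ∫⁻ x, ‖DxA s A (t, x)‖ₑ ^ q) := by
      gcongr
      refine (young hq (measurable_Kk s h) (f := fun x => ‖DxA s A (t, x)‖ₑ) (by fun_prop)).trans ?_
      gcongr
      exact Kk_int hs hs1 h
    _ = _ := by
      rw [← mul_assoc, ← ENNReal.mul_rpow_of_nonneg _ _ (show 0 ≤ q by linarith), mul_assoc]

lemma exists_M (A : SchwartzMap (ℝ × V2) ℂ) : ∃ M : ℝ → ℝ≥0∞, Measurable M ∧ (∀ p : ℝ × V2, ‖A p‖ₑ ≤ M p.1) ∧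
    ∀ t, M t ≤ essSup (fun x : V2 => (‖A (t, x)‖₊ : ℝ≥0∞)) volume := by
  have hA := A.continuous
  refine ⟨fun t => ⨆ n, ‖A (t, TopologicalSpace.denseSeq V2 n)‖ₑ, ?_, ?_, ?_⟩
  · exact Measurable.iSup fun n => (show Continuous (fun t : ℝ => A (t, TopologicalSpace.denseSeq V2 n)) by fun_prop).measurable.enorm
  · rintro ⟨t, x⟩
    have hcl : IsClosed {y : V2 | ‖A (t, y)‖ₑ ≤ ⨆ n, ‖A (t, TopologicalSpace.denseSeq V2 n)‖ₑ} :=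
      isClosed_le (by fun_prop) continuous_const
    have hd := TopologicalSpace.denseRange_denseSeq V2
    have hsub : Set.range (TopologicalSpace.denseSeq V2) ⊆ {y : V2 | ‖A (t, y)‖ₑ ≤ ⨆ n, ‖A (t, TopologicalSpace.denseSeq V2 n)‖ₑ} := by
      rintro _ ⟨n, rfl⟩
      exact le_iSup (fun n => ‖A (t, TopologicalSpace.denseSeq V2 n)‖ₑ) n
    have := closure_minimal hsub hcl
    rw [hd.closure_range] at this
    exact this (Set.mem_univ x)
  · intro t
    apply iSup_le
    intro n
    by_contra hc
    push Not at hc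
    have hop : IsOpen {y : V2 | essSup (fun x : V2 => (‖A (t, x)‖₊ : ℝ≥0∞)) volume < ‖A (t, y)‖ₑ} :=
      isOpen_lt continuous_const (by fun_prop)
    have hpos := hop.measure_pos volume ⟨_, hc⟩
    have h0 := ENNReal.ae_le_essSup (μ := volume) (fun x : V2 => (‖A (t, x)‖₊ : ℝ≥0∞))
    rw [ae_iff] at h0
    simp only [not_le] at h0
    exact hpos.ne' h0

lemma Xn_bd {s θ : ℝ} {G H : ℝ × V2 → ℂ} (k : ℝ≥0∞) (hk : k ≠ ⊤)
    (h : ∀ q, ‖G q‖ₑ ≤ k * (ENNReal.ofReal ((1 + ‖q.2‖ ^ 2) ^ (s / 2)) * ‖H q‖ₑ)) :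
    Xn θ G ≤ k ^ 2 * ∫⁻ q : ℝ × V2, (ENNReal.ofReal (wgt s θ q.1 q.2) * ‖H q‖ₑ) ^ 2 := by
  unfold Xn
  rw [← lintegral_const_mul' _ _ (by finiteness)]
  refine lintegral_mono fun q => ?_
  simp only
  rw [← mul_pow]
  gcongr ?_ ^ 2
  calc _ ≤ ENNReal.ofReal (Jw θ q) * (k * (ENNReal.ofReal ((1 + ‖q.2‖ ^ 2) ^ (s / 2)) * ‖H q‖ₑ)) := by gcongr; exact h q
    _ = _ := by
      unfold wgt; rw [ENNReal.ofReal_mul (by positivity)]; unfold Jw; ring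

lemma Yn_bd {s s1 θ : ℝ} {G H : ℝ × V2 → ℂ} (k : ℝ≥0∞) (hk : k ≠ ⊤)
    (h : ∀ q, ENNReal.ofReal ((1 + ‖q.2‖) ^ s1) * ‖G q‖ₑ ≤ k * (ENNReal.ofReal ((1 + ‖q.2‖ ^ 2) ^ (s / 2)) * ‖H q‖ₑ)) :
    Yn s1 θ G ≤ k ^ 2 * ∫⁻ q : ℝ × V2, (ENNReal.ofReal (wgt s θ q.1 q.2) * ‖H q‖ₑ) ^ 2 := by
  unfold Yn
  rw [← lintegral_const_mul' _ _ (by finiteness)]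
  refine lintegral_mono fun q => ?_
  simp only
  rw [← mul_pow]
  gcongr ?_ ^ 2
  calc _ = ENNReal.ofReal (Jw θ q) * (ENNReal.ofReal ((1 + ‖q.2‖) ^ s1) * ‖G q‖ₑ) := by ring
    _ ≤ ENNReal.ofReal (Jw θ q) * (k * (ENNReal.ofReal ((1 + ‖q.2‖ ^ 2) ^ (s / 2)) * ‖H q‖ₑ)) := mul_le_mul' le_rfl (h q)
    _ = _ := by
      unfold wgt; rw [ENNReal.ofReal_mul (by positivity)]; unfold Jw; ring

lemma jap1 {s : ℝ} (hs : 0 < s) (x : ℝ) (hx : 0 ≤ x) : x ^ s ≤ (1 + x ^ 2) ^ (s / 2) := by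
  calc x ^ s = (x ^ 2) ^ (s / 2) := by
        rw [← Real.rpow_natCast, ← Real.rpow_mul hx]; congr 1; push_cast; ring
    _ ≤ _ := Real.rpow_le_rpow (by positivity) (by linarith) (by linarith)

lemma jap2 {s : ℝ} (hs : 0 < s) (hs1 : s < 1) (x : ℝ) (hx : 0 ≤ x) : (1 + x) ^ s ≤ 2 * (1 + x ^ 2) ^ (s / 2) := by
  calc (1 + x) ^ s = ((1 + x) ^ 2) ^ (s / 2) := by
        rw [← Real.rpow_natCast, ← Real.rpow_mul (by linarith)]; congr 1; push_cast; ring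
    _ ≤ (2 * (1 + x ^ 2)) ^ (s / 2) := Real.rpow_le_rpow (by positivity) (by nlinarith [sq_nonneg (x - 1)]) (by linarith)
    _ = 2 ^ (s / 2) * (1 + x ^ 2) ^ (s / 2) := Real.mul_rpow (by norm_num) (by positivity)
    _ ≤ 2 ^ (1:ℝ) * (1 + x ^ 2) ^ (s / 2) := by
      gcongr
      · norm_num
      · linarith
    _ = _ := by rw [Real.rpow_one]

lemma jap3 {s : ℝ} (hs : 0 < s) (hs1 : s < 1) (x : ℝ) (hx : 0 ≤ x) : (1 + x ^ 2) ^ (s / 2) ≤ 1 + x ^ s := by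
  have := Real.rpow_add_le_add_rpow (zero_le_one) (sq_nonneg x) (p := s / 2) (by linarith) (by linarith)
  refine this.trans (le_of_eq ?_)
  rw [Real.one_rpow, ← Real.rpow_natCast, ← Real.rpow_mul hx]; congr 2; push_cast; ring

lemma e1_del {δ : ℝ} (hδ : 0 ≤ δ) (hδ1 : δ ≤ 1) (h ξ : V2) : ‖e1 ⟪h, ξ⟫‖ ≤ 2 * (‖h‖ ^ δ * ‖ξ‖ ^ δ) := by
  rw [← Real.mul_rpow (norm_nonneg _) (norm_nonneg _)]
  have h1 := (norm_e1_le ⟪h, ξ⟫).trans (abs_real_inner_le_norm h ξ)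
  have h2 := norm_e1_le2 ⟪h, ξ⟫
  have h0 : 0 ≤ ‖h‖ * ‖ξ‖ := by positivity
  rcases le_total (‖h‖ * ‖ξ‖) 1 with h3 | h3
  · have : (‖h‖ * ‖ξ‖) ^ (1:ℝ) ≤ (‖h‖ * ‖ξ‖) ^ δ := by
      rcases h0.eq_or_lt with h4 | h4
      · rw [← h4, Real.zero_rpow one_ne_zero]; positivity
      · exact Real.rpow_le_rpow_of_exponent_ge h4 h3 hδ1
    rw [Real.rpow_one] at this; linarith
  · have := Real.one_le_rpow h3 hδ; linarith

lemma ch_diff {G : ℝ × V2 → ℂ} (hG : Integrable G) (p : ℝ × V2) (h : V2) :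
    ch G p - ch G (p.1, p.2 + h) = ch (fun q => e1 ⟪h, q.2⟫ * G q) p := by
  have hx : ∀ p : ℝ × V2, Integrable (fun q : ℝ × V2 => Complex.exp (Complex.I * ((p.1 * q.1 + ⟪p.2, q.2⟫ : ℝ) : ℂ)) * G q) := by
    intro p
    refine hG.mono ((Measurable.aestronglyMeasurable (by fun_prop)).mul hG.1) ?_
    filter_upwards with y; rw [norm_mul, norm_cexp_I_mul, one_mul]
  unfold ch
  rw [← integral_sub (hx _) (hx _)]
  congr 1; ext q
  simp only [e1]
  rw [inner_add_left, ← add_assoc, Complex.ofReal_add (p.1 * q.1 + ⟪p.2, q.2⟫), mul_add, Complex.exp_add]; ring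

lemma Qn_diff {s p q : ℝ} (hp : 0 < p) (hq : 0 < q) {A : SchwartzMap (ℝ × V2) ℂ} {C : ℝ≥0∞} (hC : C ≠ ⊤) {h : V2}
    (H : ∀ t : ℝ, ∫⁻ x, ‖A (t, x) - A (t, x + h)‖ₑ ^ q ≤ (C * ENNReal.ofReal (‖h‖ ^ s)) ^ q * ∫⁻ x, ‖DxA s A (t, x)‖ₑ ^ q) :
    Qn p q (fun z => ‖A z - A (z.1, z.2 + h)‖ₑ) ≤ (C * ENNReal.ofReal (‖h‖ ^ s)) ^ 2 * Qn p q (fun z => ‖DxA s A z‖ₑ) := by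
  unfold Qn
  set c := C * ENNReal.ofReal (‖h‖ ^ s) with hc
  have hct : c ≠ ⊤ := ENNReal.mul_ne_top hC ENNReal.ofReal_ne_top
  calc _ ≤ (∫⁻ t : ℝ, (c ^ q * ∫⁻ x, ‖DxA s A (t, x)‖ₑ ^ q) ^ (p / q)) ^ (2 / p) := by
        gcongr with t; exact H t
    _ = (c ^ p * ∫⁻ t : ℝ, (∫⁻ x, ‖DxA s A (t, x)‖ₑ ^ q) ^ (p / q)) ^ (2 / p) := by
        congr 1
        rw [← lintegral_const_mul' _ _ (ENNReal.rpow_ne_top_of_nonneg hp.le hct)]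
        congr 1; ext t
        rw [ENNReal.mul_rpow_of_nonneg _ _ (by positivity), ← ENNReal.rpow_mul]
        congr 2; field_simp
    _ = _ := by
        rw [ENNReal.mul_rpow_of_nonneg _ _ (by positivity), ← ENNReal.rpow_mul]
        congr 1
        rw [← ENNReal.rpow_natCast]; congr 1; push_cast; field_simp

lemma leib {s : ℝ} (hs : 0 < s) (hs1 : s < 1) (A w u : SchwartzMap (ℝ × V2) ℂ) (hu : ∀ p, u p = A p * w p) (p : ℝ × V2) :
    ‖Es s u p‖ₑ ≤ ‖A p‖ₑ * ‖Es s w p‖ₑ + ‖w p‖ₑ * ‖Es s A p‖ₑ +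
      ∫⁻ h, ‖A p - A (p.1, p.2 + h)‖ₑ * ‖w p - w (p.1, p.2 + h)‖ₑ ∂(nuS s) := by
  have iA := (Es_A hs hs1 A p).1
  have iw := (Es_A hs hs1 w p).1
  have iu := (Es_A hs hs1 u p).1
  have e : ∀ h, u p - u (p.1, p.2 + h) = A p * (w p - w (p.1, p.2 + h)) + w p * (A p - A (p.1, p.2 + h)) -
      (A p - A (p.1, p.2 + h)) * (w p - w (p.1, p.2 + h)) := by
    intro h; rw [hu, hu]; ring
  have i12 : Integrable (fun h => A p * (w p - w (p.1, p.2 + h)) + w p * (A p - A (p.1, p.2 + h))) (nuS s) :=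
    (iw.const_mul _).add (iA.const_mul _)
  have i3 : Integrable (fun h => (A p - A (p.1, p.2 + h)) * (w p - w (p.1, p.2 + h))) (nuS s) := by
    refine (i12.sub iu).congr (Filter.Eventually.of_forall fun h => ?_)
    simp only [Pi.sub_apply, e]; ring
  have e2 : Es s u p = A p * Es s w p + w p * Es s A p - ∫ h, (A p - A (p.1, p.2 + h)) * (w p - w (p.1, p.2 + h)) ∂(nuS s) := by
    unfold Es
    simp_rw [e]
    rw [integral_sub i12 i3, integral_add (iw.const_mul _) (iA.const_mul _), integral_const_mul, integral_const_mul]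
  rw [e2]
  refine (enorm_sub_le (E := ℂ)).trans ?_
  refine add_le_add ((enorm_add_le _ _).trans (by rw [enorm_mul, enorm_mul])) ?_
  refine (enorm_integral_le_lintegral_enorm _).trans (le_of_eq ?_)
  congr 1; ext h; rw [enorm_mul]

def Nn (s θ : ℝ) (H : ℝ × V2 → ℂ) : ℝ≥0∞ := ∫⁻ q : ℝ × V2, (ENNReal.ofReal (wgt s θ q.1 q.2) * ‖H q‖ₑ) ^ 2
def Mn (pt : ℝ) (M : ℝ → ℝ≥0∞) : ℝ≥0∞ := (∫⁻ t, M t ^ pt) ^ (2 / pt)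

lemma Mn_two {pt : ℝ} (hpt : 2 < pt) (M : ℝ → ℝ≥0∞) : Mn pt (fun t => 2 * M t) = 4 * Mn pt M := by
  unfold Mn
  simp_rw [ENNReal.mul_rpow_of_nonneg _ _ (show 0 ≤ pt by linarith)]
  rw [lintegral_const_mul' _ _ (ENNReal.rpow_ne_top_of_nonneg (by linarith) (by simp)), ENNReal.mul_rpow_of_nonneg _ _ (by positivity),
    ← ENNReal.rpow_mul, mul_div_cancel₀ _ (by linarith)]
  congr 1
  have : (2:ℝ≥0∞) ^ (2:ℝ) = 2 ^ (2:ℕ) := by rw [← ENNReal.rpow_natCast]; norm_num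
  rw [this]; norm_num

lemma Dbound {s θ pt p q δ : ℝ} (hs : 0 < s) (hs1 : s < 1) (hθ : 1/2 < θ) (hpt : 2 < pt) (hq : 3 < q) (hp : 0 < p)
    (hpq : 2/p + 1/q = 1) (hδ : 0 < δ) (hδs : 3 / (2 * q) < s - δ) :
    ∃ C : ℝ≥0∞, C ≠ ⊤ ∧ ∀ (A H : SchwartzMap (ℝ × V2) ℂ) (M : ℝ → ℝ≥0∞) (_ : Measurable M) (_ : ∀ p : ℝ × V2, ‖A p‖ₑ ≤ M p.1) (h : V2),
      ∫⁻ z : ℝ × V2, (‖A z - A (z.1, z.2 + h)‖ₑ * ‖ch H z - ch H (z.1, z.2 + h)‖ₑ) ^ 2 ≤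
        C * ((Mn pt M + Qn p q (fun z => ‖DxA s A z‖ₑ)) * Nn s θ H) * ENNReal.ofReal (min (‖h‖ ^ (s + δ)) 1) ^ 2 := by
  have hδ1 : δ ≤ 1 := by
    have : 0 < 3 / (2 * q) := by positivity
    linarith
  obtain ⟨C1, hC1, h1⟩ := holder_lem hs hs1 (show 1 < q by linarith)
  obtain ⟨C2, hC2, h2⟩ := T2 hθ hq hp hpq hδs
  have hcT : cT θ ≠ ⊤ := (cT_lt_top hθ).ne
  refine ⟨16 * cT θ + 16 * C2 * C1 ^ 2, by finiteness, ?_⟩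
  intro A H M hM hA h
  have hAc := A.continuous
  set G : ℝ × V2 → ℂ := fun q => e1 ⟪h, q.2⟫ * H q with hGd
  have hGm : Measurable G := by
    have := H.continuous.measurable
    have h3 : Measurable (fun q : ℝ × V2 => e1 ⟪h, q.2⟫) := measurable_e1.comp (by fun_prop)
    exact h3.mul this
  have hGi : Integrable G := by
    refine (H.integrable.norm.const_mul 2).mono' hGm.aestronglyMeasurable ?_
    filter_upwards with q
    rw [hGd, norm_mul]; gcongr; exact norm_e1_le2 _
  simp_rw [ch_diff H.integrable]
  rcases le_total ‖h‖ 1 with hh | hh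
  · have hmin : min (‖h‖ ^ (s + δ)) 1 = ‖h‖ ^ (s + δ) := min_eq_left (Real.rpow_le_one (norm_nonneg _) hh (by linarith))
    rw [hmin]
    have hY : Yn (s - δ) θ G ≤ (4 * ENNReal.ofReal (‖h‖ ^ δ)) ^ 2 * Nn s θ H := by
      refine Yn_bd _ (by finiteness) ?_
      intro q
      have e4 : (4:ℝ≥0∞) = ENNReal.ofReal 4 := by simp
      rw [e4, ← ofReal_norm, ← ofReal_norm, ← ENNReal.ofReal_mul (by positivity), ← ENNReal.ofReal_mul (by positivity), ← ENNReal.ofReal_mul (by positivity), ← ENNReal.ofReal_mul (by positivity)]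
      apply ENNReal.ofReal_le_ofReal
      rw [hGd, norm_mul]
      have a1 := e1_del hδ.le hδ1 h q.2
      have a2 : ‖q.2‖ ^ δ ≤ (1 + ‖q.2‖) ^ δ := Real.rpow_le_rpow (norm_nonneg _) (by linarith) hδ.le
      have a3 := jap2 hs hs1 ‖q.2‖ (norm_nonneg _)
      have a4 : (1 + ‖q.2‖) ^ (s - δ) * (1 + ‖q.2‖) ^ δ = (1 + ‖q.2‖) ^ s := by
        rw [← Real.rpow_add (by positivity)]; congr 1; ring
      calc (1 + ‖q.2‖) ^ (s - δ) * (‖e1 ⟪h, q.2⟫‖ * ‖H q‖) ≤ (1 + ‖q.2‖) ^ (s - δ) * ((2 * (‖h‖ ^ δ * (1 + ‖q.2‖) ^ δ)) * ‖H q‖) := by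
            gcongr
            exact a1.trans (by gcongr)
        _ = 2 * ‖h‖ ^ δ * ((1 + ‖q.2‖) ^ (s - δ) * (1 + ‖q.2‖) ^ δ) * ‖H q‖ := by ring
        _ ≤ 2 * ‖h‖ ^ δ * (2 * (1 + ‖q.2‖ ^ 2) ^ (s / 2)) * ‖H q‖ := by rw [a4]; gcongr
        _ = _ := by ring
    have hQ := Qn_diff hp (by linarith : 0 < q) hC1 (fun t => h1 A t h)
    have hdm : Measurable (fun z : ℝ × V2 => ‖A z - A (z.1, z.2 + h)‖ₑ) :=
      (show Continuous (fun z : ℝ × V2 => A z - A (z.1, z.2 + h)) by fun_prop).measurable.enorm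
    refine (h2 _ hdm G hGm hGi).trans ?_
    have ee : ENNReal.ofReal (‖h‖ ^ (s + δ)) = ENNReal.ofReal (‖h‖ ^ s) * ENNReal.ofReal (‖h‖ ^ δ) := by
      rw [← ENNReal.ofReal_mul (by positivity), ← Real.rpow_add_of_nonneg (norm_nonneg _) hs.le hδ.le]
    calc _ ≤ C2 * ((C1 * ENNReal.ofReal (‖h‖ ^ s)) ^ 2 * Qn p q (fun z => ‖DxA s A z‖ₑ)) * ((4 * ENNReal.ofReal (‖h‖ ^ δ)) ^ 2 * Nn s θ H) := by
          gcongr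
      _ = (16 * C2 * C1 ^ 2) * (Qn p q (fun z => ‖DxA s A z‖ₑ) * Nn s θ H) * ENNReal.ofReal (‖h‖ ^ (s + δ)) ^ 2 := by
          rw [ee]; ring
      _ ≤ _ := by
          gcongr
          · exact le_add_self
          · exact le_add_self
  · have hmin : min (‖h‖ ^ (s + δ)) 1 = 1 := min_eq_right (Real.one_le_rpow hh (by linarith))
    rw [hmin]
    have hX : Xn θ G ≤ ENNReal.ofReal 2 ^ 2 * Nn s θ H := by
      refine Xn_bd _ (by finiteness) ?_
      intro q
      rw [← ofReal_norm, ← ofReal_norm, ← ENNReal.ofReal_mul (by positivity), ← ENNReal.ofReal_mul (by positivity)]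
      apply ENNReal.ofReal_le_ofReal
      rw [hGd, norm_mul]
      have a2 := norm_e1_le2 ⟪h, q.2⟫
      have a3 : 1 ≤ (1 + ‖q.2‖ ^ 2) ^ (s / 2) := Real.one_le_rpow (by nlinarith [sq_nonneg ‖q.2‖]) (by linarith)
      calc _ ≤ 2 * (1 * ‖H q‖) := by rw [one_mul]; gcongr
        _ ≤ _ := by gcongr
    have hA2 : ∀ z : ℝ × V2, ‖A z - A (z.1, z.2 + h)‖ₑ ≤ 2 * M z.1 := by
      intro z
      refine (enorm_sub_le (E := ℂ)).trans ?_
      rw [two_mul]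
      exact add_le_add (hA z) (hA (z.1, z.2 + h))
    have := T1 hθ hpt (fun z => A z - A (z.1, z.2 + h)) (fun t => 2 * M t) (by fun_prop) hA2 G hGi
    refine this.trans ?_
    change Mn pt (fun t => 2 * M t) * _ ≤ _
    rw [Mn_two hpt]
    calc _ ≤ 4 * Mn pt M * (cT θ * (ENNReal.ofReal 2 ^ 2 * Nn s θ H)) := by gcongr
      _ = 16 * cT θ * (Mn pt M * Nn s θ H) * ENNReal.ofReal 1 ^ 2 := by simp; ring
      _ ≤ _ := by
          gcongr
          · exact le_self_add
          · exact le_self_add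

lemma bil {s θ pt p q δ : ℝ} (hs : 0 < s) (hs1 : s < 1) (hθ : 1/2 < θ) (hpt : 2 < pt) (hq : 3 < q) (hp : 0 < p)
    (hpq : 2/p + 1/q = 1) (hδ : 0 < δ) (hδs : 3 / (2 * q) < s - δ) :
    ∃ C : ℝ≥0∞, C ≠ ⊤ ∧ ∀ (A H : SchwartzMap (ℝ × V2) ℂ) (M : ℝ → ℝ≥0∞) (_ : Measurable M) (_ : ∀ p : ℝ × V2, ‖A p‖ₑ ≤ M p.1),
      ∫⁻ z : ℝ × V2, (∫⁻ h, ‖A z - A (z.1, z.2 + h)‖ₑ * ‖ch H z - ch H (z.1, z.2 + h)‖ₑ ∂(nuS s)) ^ 2 ≤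
        C * ((Mn pt M + Qn p q (fun z => ‖DxA s A z‖ₑ)) * Nn s θ H) := by
  obtain ⟨C, hC, hD⟩ := Dbound hs hs1 hθ hpt hq hp hpq hδ hδs
  set ω : V2 → ℝ≥0∞ := fun h => ENNReal.ofReal (min (‖h‖ ^ (s + δ)) 1) with hω
  have hωm : Measurable ω := by fun_prop
  set K : ℝ≥0∞ := ∫⁻ h, ω h ∂(nuS s) with hK
  have hKt : K ≠ ⊤ := (nu_min hs (by linarith : s < s + δ)).ne
  refine ⟨K * (K * C), by finiteness, ?_⟩
  intro A H M hM hA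
  have hAc := A.continuous
  have hHc := continuous_ch H H.integrable
  set X : (ℝ × V2) × V2 → ℝ≥0∞ := fun y => ‖A y.1 - A (y.1.1, y.1.2 + y.2)‖ₑ * ‖ch H y.1 - ch H (y.1.1, y.1.2 + y.2)‖ₑ with hX
  have hXm : Measurable X := by
    have c1 : Continuous (fun y : (ℝ × V2) × V2 => A y.1 - A (y.1.1, y.1.2 + y.2)) := by fun_prop
    have c2 : Continuous (fun y : (ℝ × V2) × V2 => ch H y.1 - ch H (y.1.1, y.1.2 + y.2)) := by fun_prop
    exact c1.measurable.enorm.mul c2.measurable.enorm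
  have hωt : ∀ h, ω h ≠ ⊤ := fun h => ENNReal.ofReal_ne_top
  have hX0 : ∀ z h, ω h = 0 → X (z, h) = 0 := by
    intro z h h0
    have : h = 0 := by
      by_contra hc
      have hn : 0 < ‖h‖ := norm_pos_iff.2 hc
      have : 0 < min (‖h‖ ^ (s + δ)) 1 := lt_min (by positivity) one_pos
      simp only [hω, ENNReal.ofReal_eq_zero] at h0
      linarith
    simp [hX, this]
  have hsq : ∀ h, (ω h ^ (1/2:ℝ)) ^ 2 = ω h := by
    intro h; rw [← ENNReal.rpow_natCast, ← ENNReal.rpow_mul]; norm_num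
  have cs : ∀ z, (∫⁻ h, X (z, h) ∂(nuS s)) ^ 2 ≤ K * ∫⁻ h, (ω h)⁻¹ * X (z, h) ^ 2 ∂(nuS s) := by
    intro z
    have hXz : Measurable (fun h => X (z, h)) := hXm.comp (measurable_prodMk_left (x := z))
    have e : ∀ h, X (z, h) = ω h ^ (1/2:ℝ) * ((ω h ^ (1/2:ℝ))⁻¹ * X (z, h)) := by
      intro h
      by_cases h0 : ω h = 0
      · rw [hX0 z h h0]; simp
      · rw [← mul_assoc, ENNReal.mul_inv_cancel, one_mul]
        · simp [h0, hωt h]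
        · exact ENNReal.rpow_ne_top_of_nonneg (by norm_num) (hωt h)
    have h2 := cs_lint (μ := nuS s) (f := fun h => ω h ^ (1/2:ℝ)) (g := fun h => (ω h ^ (1/2:ℝ))⁻¹ * X (z, h)) (by fun_prop) (by fun_prop)
    simp_rw [← e, hsq, mul_pow, ← ENNReal.inv_pow, hsq] at h2
    exact h2
  have hm2 : Measurable (fun y : (ℝ × V2) × V2 => (ω y.2)⁻¹ * X y ^ 2) := by fun_prop
  calc _ = ∫⁻ z, (∫⁻ h, X (z, h) ∂(nuS s)) ^ 2 := rfl
    _ ≤ ∫⁻ z, K * ∫⁻ h, (ω h)⁻¹ * X (z, h) ^ 2 ∂(nuS s) := lintegral_mono cs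
    _ = K * ∫⁻ z, ∫⁻ h, (ω h)⁻¹ * X (z, h) ^ 2 ∂(nuS s) := lintegral_const_mul' _ _ hKt
    _ = K * ∫⁻ h, (∫⁻ z, (ω h)⁻¹ * X (z, h) ^ 2) ∂(nuS s) := by
        rw [lintegral_lintegral_swap (f := fun z h => (ω h)⁻¹ * X (z, h) ^ 2) hm2.aemeasurable]
    _ ≤ K * ∫⁻ h, C * ((Mn pt M + Qn p q (fun z => ‖DxA s A z‖ₑ)) * Nn s θ H) * ω h ∂(nuS s) := by
        refine mul_le_mul' le_rfl (lintegral_mono fun h => ?_)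
        simp only
        by_cases h0 : ω h = 0
        · simp [hX0 _ h h0]
        have hXh : Measurable (fun z => X (z, h) ^ 2) := (hXm.comp (measurable_prodMk_right (y := h))).pow_const 2
        rw [lintegral_const_mul _ hXh]
        calc _ ≤ (ω h)⁻¹ * (C * ((Mn pt M + Qn p q (fun z => ‖DxA s A z‖ₑ)) * Nn s θ H) * ω h ^ 2) := by
              gcongr; exact hD A H M hM hA h
          _ = ((ω h)⁻¹ * ω h) * (C * ((Mn pt M + Qn p q (fun z => ‖DxA s A z‖ₑ)) * Nn s θ H) * ω h) := by ring
          _ = _ := by rw [ENNReal.inv_mul_cancel h0 (hωt h), one_mul]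
    _ = _ := by rw [lintegral_const_mul _ hωm]; ring

lemma sq_add_le' (a b : ℝ≥0∞) : (a + b) ^ 2 ≤ 4 * (a ^ 2 + b ^ 2) := by
  have h : a + b ≤ 2 * max a b := by rw [two_mul]; exact add_le_add (le_max_left _ _) (le_max_right _ _)
  calc (a + b) ^ 2 ≤ (2 * max a b) ^ 2 := by gcongr
    _ = 4 * max a b ^ 2 := by rw [mul_pow]; norm_num
    _ ≤ _ := by
      gcongr
      rcases max_choice a b with h | h <;> rw [h]
      · exact le_self_add
      · exact le_add_self

lemma Es_form {s : ℝ} (hs : 0 < s) (hs1 : s < 1) (w H : SchwartzMap (ℝ × V2) ℂ)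
    (hw : ∀ x, w x = ((((2*π)^3)⁻¹:ℝ):ℂ) * ch H x) (p : ℝ × V2) :
    Es s w p = ((((2*π)^3)⁻¹:ℝ):ℂ) * (cS s * ch (fun q => ((‖q.2‖ ^ s : ℝ) : ℂ) * H q) p) := by
  have hi : Integrable (fun q : ℝ × V2 => ((‖q.2‖ ^ s : ℝ) : ℂ) * H q) :=
    schw_pow_int volume H (N := fun e => ‖e.2‖) (by fun_prop) (fun _ => norm_nonneg _) (fun e => norm_snd_le e) hs.le hs1.le
  rw [← (Es_ch hs hs1 H.integrable hi p).2]
  unfold Es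
  simp_rw [hw, ← mul_sub]
  rw [integral_const_mul]

lemma Es_meas {s : ℝ} (hs : 0 < s) (hs1 : s < 1) (w : SchwartzMap (ℝ × V2) ℂ) : Measurable (Es s w) := by
  obtain ⟨H, -, hw⟩ := inv3 w
  have hi : Integrable (fun q : ℝ × V2 => ((‖q.2‖ ^ s : ℝ) : ℂ) * H q) :=
    schw_pow_int volume H (N := fun e => ‖e.2‖) (by fun_prop) (fun _ => norm_nonneg _) (fun e => norm_snd_le e) hs.le hs1.le
  have hc := (continuous_ch _ hi).measurable
  have : Es s w = fun p => ((((2*π)^3)⁻¹:ℝ):ℂ) * (cS s * ch (fun q => ((‖q.2‖ ^ s : ℝ) : ℂ) * H q) p) :=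
    funext (Es_form hs hs1 w H hw)
  rw [this]
  exact (hc.const_mul _).const_mul _

lemma c3_le : ‖((((2*π)^3)⁻¹:ℝ):ℂ)‖ₑ ≤ 1 := by
  rw [← ofReal_norm, Complex.norm_real, Real.norm_of_nonneg (by positivity), ENNReal.ofReal_le_one]
  apply inv_le_one_of_one_le₀
  apply one_le_pow₀
  linarith [Real.pi_gt_three]

lemma EsU {s θ pt p q δ : ℝ} (hs : 0 < s) (hs1 : s < 1) (hθ : 1/2 < θ) (hpt : 2 < pt) (hq : 3 < q) (hp : 0 < p)
    (hpq : 2/p + 1/q = 1) (hδ : 0 < δ) (hδs : 3 / (2 * q) < s - δ) :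
    ∃ C : ℝ≥0∞, C ≠ ⊤ ∧ ∀ (A w u H : SchwartzMap (ℝ × V2) ℂ) (_ : ∀ p, u p = A p * w p)
      (_ : ∀ x, w x = ((((2*π)^3)⁻¹:ℝ):ℂ) * ch H x)
      (M : ℝ → ℝ≥0∞) (_ : Measurable M) (_ : ∀ p : ℝ × V2, ‖A p‖ₑ ≤ M p.1),
      ∫⁻ z, ‖u z‖ₑ ^ 2 ≤ C * ((Mn pt M + Qn p q (fun z => ‖DxA s A z‖ₑ)) * Nn s θ H) ∧
      ∫⁻ z, ‖Es s u z‖ₑ ^ 2 ≤ C * ((Mn pt M + Qn p q (fun z => ‖DxA s A z‖ₑ)) * Nn s θ H) := by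
  obtain ⟨C1, hC1, h1⟩ := bil hs hs1 hθ hpt hq hp hpq hδ hδs
  obtain ⟨C2, hC2, h2⟩ := T2 hθ hq hp hpq (show 3 / (2 * q) < s by linarith)
  have hcT : cT θ ≠ ⊤ := (cT_lt_top hθ).ne
  refine ⟨cT θ + 4 * (4 * (‖cS s‖ₑ ^ 2 * cT θ + ‖cS s‖ₑ ^ 2 * (C2 * 2 ^ 2)) + C1), by finiteness, ?_⟩
  intro A w u H hu hw M hM hA
  set B := (Mn pt M + Qn p q (fun z => ‖DxA s A z‖ₑ)) * Nn s θ H with hB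
  have hMB : Mn pt M * Nn s θ H ≤ B := by rw [hB]; gcongr; exact le_self_add
  have hQB : Qn p q (fun z => ‖DxA s A z‖ₑ) * Nn s θ H ≤ B := by rw [hB]; gcongr; exact le_add_self
  have hi : Integrable (fun q : ℝ × V2 => ((‖q.2‖ ^ s : ℝ) : ℂ) * H q) :=
    schw_pow_int volume H (N := fun e => ‖e.2‖) (by fun_prop) (fun _ => norm_nonneg _) (fun e => norm_snd_le e) hs.le hs1.le
  have hJ : ∀ q : ℝ × V2, 1 ≤ (1 + ‖q.2‖ ^ 2) ^ (s / 2) := fun q => Real.one_le_rpow (by nlinarith [sq_nonneg ‖q.2‖]) (by linarith)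
  have hwle : ∀ z, ‖w z‖ₑ ≤ ‖ch H z‖ₑ := by
    intro z; rw [hw, enorm_mul]; exact mul_le_of_le_one_left' c3_le
  have X1 : Xn θ H ≤ 1 ^ 2 * Nn s θ H := by
    refine Xn_bd _ (by finiteness) fun q => ?_
    rw [one_mul]
    exact le_mul_of_one_le_left' (by rw [ENNReal.one_le_ofReal]; exact hJ q)
  have X2 : Xn θ (fun q => ((‖q.2‖ ^ s : ℝ) : ℂ) * H q) ≤ 1 ^ 2 * Nn s θ H := by
    refine Xn_bd _ (by finiteness) fun q => ?_
    rw [one_mul, enorm_mul]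
    gcongr
    rw [← ofReal_norm, Complex.norm_real, Real.norm_of_nonneg (by positivity)]
    exact ENNReal.ofReal_le_ofReal (jap1 hs _ (norm_nonneg _))
  have Y1 : Yn s θ H ≤ (ENNReal.ofReal 2) ^ 2 * Nn s θ H := by
    refine Yn_bd _ (by finiteness) fun q => ?_
    rw [← mul_assoc, ← ENNReal.ofReal_mul (by positivity)]
    gcongr
    exact jap2 hs hs1 _ (norm_nonneg _)
  rw [one_pow, one_mul] at X1 X2
  have b1 : ∫⁻ z, ‖u z‖ₑ ^ 2 ≤ cT θ * B := by
    calc _ ≤ ∫⁻ z, (‖A z‖ₑ * ‖ch H z‖ₑ) ^ 2 := by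
          refine lintegral_mono fun z => ?_
          simp only
          rw [hu, enorm_mul]; gcongr; exact hwle z
      _ ≤ Mn pt M * (cT θ * Xn θ H) := T1 hθ hpt A M hM hA H H.integrable
      _ ≤ Mn pt M * (cT θ * Nn s θ H) := by gcongr
      _ = cT θ * (Mn pt M * Nn s θ H) := by ring
      _ ≤ _ := by gcongr
  have b2 : ∫⁻ z, (‖A z‖ₑ * ‖Es s w z‖ₑ) ^ 2 ≤ ‖cS s‖ₑ ^ 2 * cT θ * B := by
    calc _ ≤ ∫⁻ z, ‖cS s‖ₑ ^ 2 * (‖A z‖ₑ * ‖ch (fun q => ((‖q.2‖ ^ s : ℝ) : ℂ) * H q) z‖ₑ) ^ 2 := by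
          refine lintegral_mono fun z => ?_
          simp only
          rw [← mul_pow, mul_left_comm, Es_form hs hs1 w H hw, enorm_mul, enorm_mul]
          exact pow_le_pow_left' (mul_le_mul' le_rfl (mul_le_of_le_one_left' c3_le)) 2
      _ = ‖cS s‖ₑ ^ 2 * ∫⁻ z, (‖A z‖ₑ * ‖ch (fun q => ((‖q.2‖ ^ s : ℝ) : ℂ) * H q) z‖ₑ) ^ 2 := lintegral_const_mul' _ _ (by finiteness)
      _ ≤ ‖cS s‖ₑ ^ 2 * (Mn pt M * (cT θ * Xn θ (fun q => ((‖q.2‖ ^ s : ℝ) : ℂ) * H q))) := by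
          gcongr; exact T1 hθ hpt A M hM hA _ hi
      _ ≤ ‖cS s‖ₑ ^ 2 * (Mn pt M * (cT θ * Nn s θ H)) := by gcongr
      _ = ‖cS s‖ₑ ^ 2 * cT θ * (Mn pt M * Nn s θ H) := by ring
      _ ≤ _ := by gcongr
  have hDm : Measurable (fun z => ‖DxA s A z‖ₑ) := by
    have : DxA s A = fun z => (cS s)⁻¹ * Es s A z := by
      ext z; rw [(Es_A hs hs1 A z).2, ← mul_assoc, inv_mul_cancel₀ (cS_ne_zero hs hs1), one_mul]
    rw [this]; exact ((Es_meas hs hs1 A).const_mul _).enorm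
  have b3 : ∫⁻ z, (‖w z‖ₑ * ‖Es s A z‖ₑ) ^ 2 ≤ ‖cS s‖ₑ ^ 2 * (C2 * 2 ^ 2) * B := by
    calc _ ≤ ∫⁻ z, ‖cS s‖ₑ ^ 2 * (‖DxA s A z‖ₑ * ‖ch H z‖ₑ) ^ 2 := by
          refine lintegral_mono fun z => ?_
          simp only
          rw [← mul_pow, mul_comm ‖w z‖ₑ, ← mul_assoc, (Es_A hs hs1 A z).2, enorm_mul]
          gcongr
          exact hwle z
      _ = ‖cS s‖ₑ ^ 2 * ∫⁻ z, (‖DxA s A z‖ₑ * ‖ch H z‖ₑ) ^ 2 := lintegral_const_mul' _ _ (by finiteness)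
      _ ≤ ‖cS s‖ₑ ^ 2 * (C2 * Qn p q (fun z => ‖DxA s A z‖ₑ) * Yn s θ H) := by
          gcongr; exact h2 _ hDm H H.continuous.measurable H.integrable
      _ ≤ ‖cS s‖ₑ ^ 2 * (C2 * Qn p q (fun z => ‖DxA s A z‖ₑ) * ((ENNReal.ofReal 2) ^ 2 * Nn s θ H)) := by gcongr
      _ = ‖cS s‖ₑ ^ 2 * (C2 * (ENNReal.ofReal 2) ^ 2) * (Qn p q (fun z => ‖DxA s A z‖ₑ) * Nn s θ H) := by ring
      _ ≤ ‖cS s‖ₑ ^ 2 * (C2 * (ENNReal.ofReal 2) ^ 2) * B := by gcongr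
      _ = _ := by simp
  have b4 : ∫⁻ z : ℝ × V2, (∫⁻ h, ‖A z - A (z.1, z.2 + h)‖ₑ * ‖w z - w (z.1, z.2 + h)‖ₑ ∂(nuS s)) ^ 2 ≤ C1 * B := by
    refine le_trans (lintegral_mono fun z => ?_) (h1 A H M hM hA)
    simp only
    gcongr
    rw [hw, hw, ← mul_sub, enorm_mul]; exact mul_le_of_le_one_left' c3_le
  refine ⟨b1.trans (by gcongr; exact le_self_add), ?_⟩
  have m1 : Measurable (fun z => (‖A z‖ₑ * ‖Es s w z‖ₑ) ^ 2) := by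
    have := A.continuous.measurable
    have := Es_meas hs hs1 w
    fun_prop
  have m2 : Measurable (fun z => (‖w z‖ₑ * ‖Es s A z‖ₑ) ^ 2) := by
    have := w.continuous.measurable
    have := Es_meas hs hs1 A
    fun_prop
  have m3 : Measurable (fun z => 4 * ((‖A z‖ₑ * ‖Es s w z‖ₑ) ^ 2 + (‖w z‖ₑ * ‖Es s A z‖ₑ) ^ 2)) := (m1.add m2).const_mul _
  calc _ ≤ ∫⁻ z, 4 * (4 * ((‖A z‖ₑ * ‖Es s w z‖ₑ) ^ 2 + (‖w z‖ₑ * ‖Es s A z‖ₑ) ^ 2) + (∫⁻ h, ‖A z - A (z.1, z.2 + h)‖ₑ * ‖w z - w (z.1, z.2 + h)‖ₑ ∂(nuS s)) ^ 2) := by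
        refine lintegral_mono fun z => ?_
        simp only
        calc _ ≤ (‖A z‖ₑ * ‖Es s w z‖ₑ + ‖w z‖ₑ * ‖Es s A z‖ₑ + ∫⁻ h, ‖A z - A (z.1, z.2 + h)‖ₑ * ‖w z - w (z.1, z.2 + h)‖ₑ ∂(nuS s)) ^ 2 := by
              gcongr; exact leib hs hs1 A w u hu z
          _ ≤ _ := (sq_add_le' _ _).trans (by gcongr; exact sq_add_le' _ _)
    _ = 4 * (4 * ((∫⁻ z, (‖A z‖ₑ * ‖Es s w z‖ₑ) ^ 2) + (∫⁻ z, (‖w z‖ₑ * ‖Es s A z‖ₑ) ^ 2)) + ∫⁻ z, (∫⁻ h, ‖A z - A (z.1, z.2 + h)‖ₑ * ‖w z - w (z.1, z.2 + h)‖ₑ ∂(nuS s)) ^ 2) := by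
        rw [lintegral_const_mul' _ _ (by finiteness), lintegral_add_left m3, lintegral_const_mul' _ _ (by finiteness), lintegral_add_left m1]
    _ ≤ 4 * (4 * (‖cS s‖ₑ ^ 2 * cT θ * B + ‖cS s‖ₑ ^ 2 * (C2 * 2 ^ 2) * B) + C1 * B) := by gcongr
    _ = (4 * (4 * (‖cS s‖ₑ ^ 2 * cT θ + ‖cS s‖ₑ ^ 2 * (C2 * 2 ^ 2)) + C1)) * B := by ring
    _ ≤ _ := by gcongr; exact le_add_self

lemma HNu {s η : ℝ} (hs : 0 < s) (hs1 : s < 1) (hη : η ≤ 0) (u : SchwartzMap (ℝ × V2) ℂ) :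
    ∫⁻ q : ℝ × V2, (ENNReal.ofReal (wgt s η q.1 q.2) * ‖ftST u q.1 q.2‖ₑ) ^ 2 ≤
      4 * ENNReal.ofReal cB3 * ((∫⁻ z, ‖u z‖ₑ ^ 2) + (‖cS s‖ₑ ^ 2)⁻¹ * ∫⁻ z, ‖Es s u z‖ₑ ^ 2) := by
  obtain ⟨U, hU, -⟩ := inv3 u
  have hUm := U.continuous.measurable
  have h0 : ‖cS s‖ₑ ^ 2 ≠ 0 := by simpa using cS_ne_zero hs hs1
  have h1 := planch_ft u u.integrable
  have h2 := lowerE hs hs1 u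
  simp_rw [← hU] at h1 h2 ⊢
  have h3 : ∫⁻ q : ℝ × V2, (ENNReal.ofReal (‖q.2‖ ^ s) * ‖U q‖ₑ) ^ 2 ≤ (‖cS s‖ₑ ^ 2)⁻¹ * (ENNReal.ofReal cB3 * ∫⁻ z, ‖Es s u z‖ₑ ^ 2) := by
    calc _ = (‖cS s‖ₑ ^ 2)⁻¹ * (‖cS s‖ₑ ^ 2 * ∫⁻ q : ℝ × V2, (ENNReal.ofReal (‖q.2‖ ^ s) * ‖U q‖ₑ) ^ 2) := by
          rw [← mul_assoc, ENNReal.inv_mul_cancel h0 (by finiteness), one_mul]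
      _ ≤ _ := by gcongr
  calc _ ≤ ∫⁻ q : ℝ × V2, 4 * (‖U q‖ₑ ^ 2 + (ENNReal.ofReal (‖q.2‖ ^ s) * ‖U q‖ₑ) ^ 2) := by
        refine lintegral_mono fun q => ?_
        simp only
        refine le_trans ?_ (sq_add_le' _ _)
        gcongr ?_ ^ 2
        calc _ ≤ ENNReal.ofReal (1 + ‖q.2‖ ^ s) * ‖U q‖ₑ := by
              gcongr
              unfold wgt
              have a1 := jap3 hs hs1 ‖q.2‖ (norm_nonneg _)
              have a2 : (1 + |(|q.1| - ‖q.2‖)|) ^ η ≤ 1 := Real.rpow_le_one_of_one_le_of_nonpos (by linarith [abs_nonneg (|q.1| - ‖q.2‖)]) hη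
              calc _ ≤ (1 + ‖q.2‖ ^ 2) ^ (s / 2) * 1 := by gcongr
                _ ≤ _ := by linarith
          _ = _ := by rw [ENNReal.ofReal_add zero_le_one (by positivity), add_mul]; simp
    _ = 4 * ((∫⁻ q, ‖U q‖ₑ ^ 2) + ∫⁻ q : ℝ × V2, (ENNReal.ofReal (‖q.2‖ ^ s) * ‖U q‖ₑ) ^ 2) := by
        rw [lintegral_const_mul' _ _ (by finiteness), lintegral_add_left (by fun_prop)]
    _ ≤ 4 * (ENNReal.ofReal cB3 * (∫⁻ z, ‖u z‖ₑ ^ 2) + (‖cS s‖ₑ ^ 2)⁻¹ * (ENNReal.ofReal cB3 * ∫⁻ z, ‖Es s u z‖ₑ ^ 2)) := by gcongr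
    _ = _ := by ring

/-- For `1/4 < s < 1/2`, `0 ≤ ε < min(2s-1/2, 1/2)`, `3/4 - ε/2 < θ ≤ s + 1/2 - ε`,
`θ < 1 - ε`, and exponents `1 - 2s < 1/p̃ < 1/2`, `2/p = 1 - 1/q`,
`max((1-2s)/3, s/2) < 1/q < 2s/3`, there is a constant `C` such that
`‖A₀w‖_{H^{s,θ-1+ε}} ≤ C (‖A₀‖_{L^p̃_t L^∞_x} + ‖D_x^s A₀‖_{L^p_t L^q_x}) ‖w‖_{H^{s,θ}}`
for all Schwartz `A₀, w` on `ℝ^{1+2}`. -/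
theorem elliptic_product_estimate (s ε θ pt p q : ℝ)
    (hs1 : 1 / 4 < s) (hs2 : s < 1 / 2)
    (hε1 : 0 ≤ ε) (hε2 : ε < min (2 * s - 1 / 2) (1 / 2))
    (hθ1 : 3 / 4 - ε / 2 < θ) (hθ2 : θ ≤ s + 1 / 2 - ε) (hθ3 : θ < 1 - ε)
    (hpt1 : 1 - 2 * s < 1 / pt) (hpt2 : 1 / pt < 1 / 2)
    (hpq : 2 / p = 1 - 1 / q)
    (hq1 : max ((1 - 2 * s) / 3) (s / 2) < 1 / q) (hq2 : 1 / q < 2 * s / 3) :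
    ∃ C : ℝ, 0 < C ∧
      ∀ A0 w : SchwartzMap (ℝ × V2) ℂ,
        HN s (θ - 1 + ε) (fun p' => A0 p' * w p') ≤
          ENNReal.ofReal C *
            ((LpLinf pt ⇑A0 + LpLq p q (DxA s ⇑A0)) * HN s θ ⇑w) := by
  have hs0 : 0 < s := by linarith
  have hs3 : s < 1 := by linarith
  have hθ : 1 / 2 < θ := by
    have := hε2.trans_le (min_le_right _ _); linarith
  have hη : θ - 1 + ε ≤ 0 := by linarith
  have hpt : 2 < pt := by
    have h0 : 0 < pt := one_div_pos.1 (by linarith)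
    rw [one_div_lt_one_div h0 (by norm_num)] at hpt2
    exact hpt2
  have hqq : s / 2 < 1 / q := (le_max_right _ _).trans_lt hq1
  have hq0 : 0 < q := one_div_pos.1 (by linarith)
  have hq : 3 < q := by
    have : 1 / q < 1 / 3 := by linarith
    rw [one_div_lt_one_div hq0 (by norm_num)] at this
    exact this
  have hp : 0 < p := by
    have : 0 < 2 / p := by rw [hpq]; linarith
    exact (div_pos_iff_of_pos_left (by norm_num)).1 this
  have hpq' : 2 / p + 1 / q = 1 := by linarith
  have e32 : 3 / (2 * q) = 3 / 2 * (1 / q) := by field_simp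
  have hδ : 0 < (s - 3 / (2 * q)) / 2 := by rw [e32]; linarith
  obtain ⟨C, hC, hE⟩ := EsU hs0 hs3 hθ hpt hq hp hpq' hδ (by linarith)
  have hcS0 : ‖cS s‖ₑ ^ 2 ≠ 0 := by simpa using cS_ne_zero hs0 hs3
  set K : ℝ≥0∞ := 4 * ENNReal.ofReal cB3 * (C + (‖cS s‖ₑ ^ 2)⁻¹ * C) with hK
  have hKt : K ≠ ⊤ := by
    have : (‖cS s‖ₑ ^ 2)⁻¹ ≠ ⊤ := ENNReal.inv_ne_top.2 hcS0
    finiteness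
  have hK2 : K ^ (1/2:ℝ) ≠ ⊤ := ENNReal.rpow_ne_top_of_nonneg (by norm_num) hKt
  refine ⟨(K ^ (1/2:ℝ)).toReal + 1, by positivity, ?_⟩
  intro A w
  obtain ⟨H, hH, hw⟩ := inv3 w
  obtain ⟨M, hM, hAM, hMe⟩ := exists_M A
  let u : SchwartzMap (ℝ × V2) ℂ := SchwartzMap.smulLeftCLM ℂ A w
  have hu : ∀ p, u p = A p * w p := by
    intro p; simp only [u]
    rw [SchwartzMap.smulLeftCLM_apply_apply A.hasTemperateGrowth]; rfl
  have hu' : (fun p' => A p' * w p') = u := by ext p; rw [hu]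
  rw [hu']
  obtain ⟨f1, f2⟩ := hE A w u H hu hw M hM hAM
  have hN : HN s θ w = Nn s θ H ^ (1/2:ℝ) := by
    unfold HN Nn; simp_rw [hH]; rfl
  have hMn : Mn pt M ^ (1/2:ℝ) ≤ LpLinf pt A := by
    unfold Mn LpLinf
    rw [← ENNReal.rpow_mul, show 2 / pt * (1 / 2) = pt⁻¹ by field_simp]
    gcongr with t
    exact hMe t
  have hQn : Qn p q (fun z => ‖DxA s A z‖ₑ) ^ (1/2:ℝ) = LpLq p q (DxA s A) := by
    unfold Qn LpLq
    rw [← ENNReal.rpow_mul, show 2 / p * (1 / 2) = p⁻¹ by field_simp]; rfl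
  set Q := Qn p q (fun z => ‖DxA s A z‖ₑ)
  have main := HNu hs0 hs3 hη u
  calc HN s (θ - 1 + ε) u ≤ (K * ((Mn pt M + Q) * Nn s θ H)) ^ (1/2:ℝ) := by
        unfold HN
        refine ENNReal.rpow_le_rpow (main.trans ?_) (by norm_num)
        calc _ ≤ 4 * ENNReal.ofReal cB3 * (C * ((Mn pt M + Q) * Nn s θ H) + (‖cS s‖ₑ ^ 2)⁻¹ * (C * ((Mn pt M + Q) * Nn s θ H))) := by gcongr
          _ = _ := by rw [hK]; ring
    _ = K ^ (1/2:ℝ) * ((Mn pt M + Q) ^ (1/2:ℝ) * Nn s θ H ^ (1/2:ℝ)) := by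
        rw [ENNReal.mul_rpow_of_nonneg K _ (by norm_num), ENNReal.mul_rpow_of_nonneg (Mn pt M + Q) _ (by norm_num)]
    _ ≤ ENNReal.ofReal ((K ^ (1/2:ℝ)).toReal + 1) * ((LpLinf pt A + LpLq p q (DxA s A)) * HN s θ w) := by
        rw [hN]
        gcongr
        · rw [ENNReal.le_ofReal_iff_toReal_le hK2 (by positivity)]; linarith
        · refine (ENNReal.rpow_add_le_add_rpow _ _ (by norm_num) (by norm_num)).trans ?_
          rw [hQn]; gcongr
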